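/- Let f satisfy (H) with 0 < τ₋ ≤ τ₊ < 2 and let Ω be an arbitrary bounded smooth domain in ℝⁿ. Let (u_m) be a sequence of semistable solutions of (N_{λ_m}) each satisfying the stability inequality. Then sup_m ‖u_m‖_{L^∞(Ω)} < a_f whenever n < N(f), where N(f) = ((4α*(2−τ₊)+2τ₊)/τ₊)·max{1, τ₊} if f is regular and N(f) = (4α*(2−τ₊)+2τ₊)/τ₊ if f is singular, α* being the largest real root of the polynomial P_f(α,τ₋,τ₊) = (2−τ₋)²α⁴ − 8(2−τ₊)α² + 4(4−3τ₊)α − 4(1−τ₊). -/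

import Mathlib

open MeasureTheory Filter Topology Real Set

noncomputable section

/-- The Laplacian of a real-valued function on Euclidean space. -/
def lap {n : ℕ} (u : EuclideanSpace ℝ (Fin n) → ℝ) (x : EuclideanSpace ℝ (Fin n)) : ℝ :=
  ∑ i : Fin n, iteratedFDeriv ℝ 2 u x ![EuclideanSpace.single i (1:ℝ), EuclideanSpace.single i (1:ℝ)]

/-- A bounded (smooth) domain. -/
def GoodDomain {n : ℕ} (Ω : Set (EuclideanSpace ℝ (Fin n))) : Prop :=
  IsOpen Ω ∧ Bornology.IsBounded Ω ∧ Ω.Nonempty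

/-- The domain `[0, a_f)` of the nonlinearity. -/
def domf (a : EReal) : Set ℝ := {t : ℝ | 0 ≤ t ∧ (t : EReal) < a}

/-- The filter of `t → a_f⁻`. -/
def afFilter (a : EReal) : Filter ℝ :=
  if a = ⊤ then Filter.atTop else nhdsWithin a.toReal (Set.Iio a.toReal)

/-- Hypothesis (H) on the nonlinearity `f : [0, a_f) → ℝ₊`. -/
structure HypH (a : EReal) (f : ℝ → ℝ) : Prop where
  a_pos : 0 < a
  smooth : ContDiffOn ℝ (⊤ : ℕ∞) f (domf a)
  mono : StrictMonoOn f (domf a)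
  convex : ConvexOn ℝ (domf a) f
  f0_pos : 0 < f 0
  pos : ∀ t ∈ domf a, 0 < f t
  blowup : Filter.Tendsto f (afFilter a) Filter.atTop
  superlinear : a = ⊤ → Filter.Tendsto (fun t => f t / t) Filter.atTop Filter.atTop

/-- `τ₋ = liminf_{t → a_f} f f'' / (f')²`. -/
def tauMinus (a : EReal) (f : ℝ → ℝ) : ℝ :=
  Filter.liminf (fun t => f t * deriv (deriv f) t / (deriv f t) ^ 2) (afFilter a)

/-- `τ₊ = limsup_{t → a_f} f f'' / (f')²`. -/
def tauPlus (a : EReal) (f : ℝ → ℝ) : ℝ :=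
  Filter.limsup (fun t => f t * deriv (deriv f) t / (deriv f t) ^ 2) (afFilter a)

/-- `u` is a (smooth, `[0,a_f)`-valued) solution of `Δ²u = λ f(u)` in `Ω`,
`u = Δu = 0` on `∂Ω`. -/
def Solves {n : ℕ} (Ω : Set (EuclideanSpace ℝ (Fin n))) (a : EReal) (lam : ℝ)
    (f : ℝ → ℝ) (u : EuclideanSpace ℝ (Fin n) → ℝ) : Prop :=
  ContDiff ℝ (⊤ : ℕ∞) u ∧ (∀ x ∈ Ω, 0 ≤ u x ∧ (u x : EReal) < a) ∧
  (∀ x ∈ Ω, lap (lap u) x = lam * f (u x)) ∧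
  (∀ x ∈ frontier Ω, u x = 0) ∧ (∀ x ∈ frontier Ω, lap u x = 0)

/-- `u` is a semistable solution: the second variation is nonnegative over
test functions in `H² ∩ H¹₀` (modelled by smooth functions vanishing on `∂Ω`). -/
def Semistable {n : ℕ} (Ω : Set (EuclideanSpace ℝ (Fin n))) (lam : ℝ)
    (f : ℝ → ℝ) (u : EuclideanSpace ℝ (Fin n) → ℝ) : Prop :=
  ∀ φ : EuclideanSpace ℝ (Fin n) → ℝ, ContDiff ℝ (⊤ : ℕ∞) φ → (∀ x ∈ frontier Ω, φ x = 0) →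
    0 ≤ ∫ x in Ω, ((lap φ x) ^ 2 - lam * deriv f (u x) * (φ x) ^ 2)

/-- `u` satisfies the stability inequality
`√λ ∫ √(f'(u)) φ² ≤ ∫ |∇φ|²` for all `φ ∈ H¹₀(Ω)`
(modelled by smooth compactly supported test functions). -/
def StabIneq {n : ℕ} (Ω : Set (EuclideanSpace ℝ (Fin n))) (lam : ℝ)
    (f : ℝ → ℝ) (u : EuclideanSpace ℝ (Fin n) → ℝ) : Prop :=
  ∀ φ : EuclideanSpace ℝ (Fin n) → ℝ, ContDiff ℝ (⊤ : ℕ∞) φ → HasCompactSupport φ →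
    tsupport φ ⊆ Ω →
    Real.sqrt lam * ∫ x in Ω, Real.sqrt (deriv f (u x)) * (φ x) ^ 2 ≤
      ∫ x in Ω, ‖gradient φ x‖ ^ 2

/-- The quartic polynomial `P_f(α, τ₋, τ₊)`. -/
def Pf (τm τp α : ℝ) : ℝ :=
  (2 - τm) ^ 2 * α ^ 4 - 8 * (2 - τp) * α ^ 2 + 4 * (4 - 3 * τp) * α - 4 * (1 - τp)

/-- `F(t) = ∫₀ᵗ f(s) ds`. -/
def Fint (f : ℝ → ℝ) (t : ℝ) : ℝ := ∫ s in (0:ℝ)..t, f s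

/-- `f̃(t) = f(t) - f(0)`. -/
def ftil (f : ℝ → ℝ) (t : ℝ) : ℝ := f t - f 0

/-- `Θ(t) = ∫₀ᵗ θ'(s)² ds`. -/
def Theta (θ : ℝ → ℝ) (t : ℝ) : ℝ := ∫ s in (0:ℝ)..t, (deriv θ s) ^ 2

abbrev Eu (n : ℕ) := EuclideanSpace ℝ (Fin n)

theorem two_le_tp : (2 : WithTop ℕ∞) ≤ ((⊤ : ℕ∞) : WithTop ℕ∞) := by
  have : ((2 : ℕ∞) : WithTop ℕ∞) ≤ ((⊤ : ℕ∞) : WithTop ℕ∞) := WithTop.coe_le_coe.2 le_top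
  simpa using this

/-- basis vector -/
abbrev eb {n : ℕ} (i : Fin n) : Eu n := EuclideanSpace.single i (1:ℝ)

/-- partial derivative -/
def pd {n : ℕ} (i : Fin n) (φ : Eu n → ℝ) (x : Eu n) : ℝ := fderiv ℝ φ x (eb i)

theorem pd_contDiff {n : ℕ} (i : Fin n) {φ : Eu n → ℝ} {k m : WithTop ℕ∞} (h : ContDiff ℝ k φ)
    (hk : m + 1 ≤ k) : ContDiff ℝ m (pd i φ) := by
  unfold pd
  exact (h.fderiv_right hk).clm_apply contDiff_const

theorem lap_eq {n : ℕ} {φ : Eu n → ℝ} {x : Eu n} (h : ContDiffAt ℝ 2 φ x) :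
    lap φ x = ∑ i, pd i (pd i φ) x := by
  unfold lap
  refine Finset.sum_congr rfl fun i _ => ?_
  rw [iteratedFDeriv_two_apply]
  unfold pd
  have hd : DifferentiableAt ℝ (fderiv ℝ φ) x :=
    (h.fderiv_right (m := 1) (by norm_num)).differentiableAt (by norm_num)
  rw [fderiv_clm_apply hd (differentiableAt_const _)]
  simp

theorem lap_contDiff {n : ℕ} {φ : Eu n → ℝ} (h : ContDiff ℝ (⊤ : ℕ∞) φ) :
    ContDiff ℝ (⊤ : ℕ∞) (lap φ) := by
  have : lap φ = fun x => ∑ i, pd i (pd i φ) x := by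
    ext x
    exact lap_eq (h.contDiffAt.of_le two_le_tp)
  rw [this]
  refine ContDiff.sum fun i _ => ?_
  exact pd_contDiff i (pd_contDiff i h (m := (⊤ : ℕ∞)) (by simp)) (by simp)

theorem pd_congr {n : ℕ} (i : Fin n) {φ ψ : Eu n → ℝ} {x : Eu n} (h : φ =ᶠ[𝓝 x] ψ) :
    pd i φ x = pd i ψ x := by
  unfold pd; rw [h.fderiv_eq]

theorem lap_congr {n : ℕ} {φ ψ : Eu n → ℝ} {x : Eu n} (h : φ =ᶠ[𝓝 x] ψ) :
    lap φ x = lap ψ x := by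
  unfold lap; rw [(Filter.EventuallyEq.iteratedFDeriv (𝕜 := ℝ) h 2).eq_of_nhds]

theorem pd_comp {n : ℕ} (i : Fin n) {z : Eu n → ℝ} {Γ : ℝ → ℝ} {x : Eu n} {d : ℝ}
    (hz : DifferentiableAt ℝ z x) (hΓ : HasDerivAt Γ d (z x)) :
    pd i (fun y => Γ (z y)) x = d * pd i z x := by
  unfold pd
  have := (hΓ.comp_hasFDerivAt x hz.hasFDerivAt).fderiv
  change fderiv ℝ (Γ ∘ z) x (eb i) = _
  rw [this]; simp

theorem pd_mul {n : ℕ} (i : Fin n) {g h : Eu n → ℝ} {x : Eu n}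
    (hg : DifferentiableAt ℝ g x) (hh : DifferentiableAt ℝ h x) :
    pd i (fun y => g y * h y) x = g x * pd i h x + pd i g x * h x := by
  unfold pd
  rw [fderiv_fun_mul hg hh]
  simp; ring

theorem pd_sub {n : ℕ} (i : Fin n) {g h : Eu n → ℝ} {x : Eu n}
    (hg : DifferentiableAt ℝ g x) (hh : DifferentiableAt ℝ h x) :
    pd i (fun y => g y - h y) x = pd i g x - pd i h x := by
  unfold pd
  rw [fderiv_fun_sub hg hh]
  simp

theorem pd_smul {n : ℕ} (i : Fin n) {g : Eu n → ℝ} {x : Eu n} (c : ℝ)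
    (hg : DifferentiableAt ℝ g x) :
    pd i (fun y => c * g y) x = c * pd i g x := by
  unfold pd
  rw [fderiv_const_mul hg]
  simp

theorem grad_sq {n : ℕ} {φ : Eu n → ℝ} {x : Eu n} :
    ‖gradient φ x‖ ^ 2 = ∑ i, (pd i φ x) ^ 2 := by
  rw [EuclideanSpace.norm_sq_eq]
  refine Finset.sum_congr rfl fun i _ => ?_
  have : (gradient φ x) i = pd i φ x := by
    have h1 : inner ℝ (gradient φ x) (eb i) = fderiv ℝ φ x (eb i) := by
      unfold gradient
      simp
    rw [EuclideanSpace.inner_single_right] at h1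
    simpa [pd] using h1
  rw [this]; simp

theorem lap_comp {n : ℕ} {z : Eu n → ℝ} {Γ Γ1 : ℝ → ℝ} {x : Eu n} {d2 : ℝ}
    (hz : ContDiff ℝ 2 z) (hΓ : ContDiffAt ℝ 2 Γ (z x))
    (h1 : ∀ᶠ t in 𝓝 (z x), HasDerivAt Γ (Γ1 t) t) (h2 : HasDerivAt Γ1 d2 (z x)) :
    lap (fun y => Γ (z y)) x = d2 * ∑ i, (pd i z x) ^ 2 + Γ1 (z x) * lap z x := by
  have hc : ContDiffAt ℝ 2 (fun y => Γ (z y)) x := hΓ.comp x hz.contDiffAt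
  rw [lap_eq hc, lap_eq hz.contDiffAt, Finset.mul_sum, Finset.mul_sum, ← Finset.sum_add_distrib]
  refine Finset.sum_congr rfl fun i _ => ?_
  have hd : Differentiable ℝ z := hz.differentiable (by norm_num)
  have e : pd i (fun y => Γ (z y)) =ᶠ[𝓝 x] fun y => Γ1 (z y) * pd i z y := by
    have := hz.continuous.continuousAt.eventually h1
    filter_upwards [this] with y hy
    exact pd_comp i (hd y) hy
  rw [pd_congr i e, pd_mul, pd_comp i (hd x) h2]
  · ring
  · exact (h2.comp_hasFDerivAt x (hd x).hasFDerivAt).differentiableAt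
  · exact ((pd_contDiff i hz (m := 1) (by norm_num)).differentiable (by norm_num)) x

theorem integral_pd_eq_zero {n : ℕ} (i : Fin n) {g : Eu n → ℝ} (hg : ContDiff ℝ 1 g)
    (hc : HasCompactSupport g) : ∫ x, pd i g x = 0 := by
  have hcp : Continuous (pd i g) := (pd_contDiff i hg (m := 0) (by norm_num)).continuous
  have h2 : HasCompactSupport (pd i g) := hc.fderiv_apply (𝕜 := ℝ) _
  have := integral_mul_fderiv_eq_neg_fderiv_mul_of_integrable (μ := (volume : Measure (Eu n)))
    (f := fun _ => (1:ℝ)) (g := g) (v := eb i)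
    (by simp) (by simp only [one_mul]; exact hcp.integrable_of_hasCompactSupport h2)
    (by simpa using hg.continuous.integrable_of_hasCompactSupport hc)
    (fun x _ => differentiableAt_const _) (fun x _ => hg.differentiable (by norm_num) x)
  simpa [pd] using this

/-- truncated function -/
def tr {n : ℕ} (Ω : Set (Eu n)) (Γ : ℝ → ℝ) (z : Eu n → ℝ) : Eu n → ℝ :=
  Ω.indicator (fun x => Γ (z x))

section trunc
variable {n : ℕ} {Ω : Set (Eu n)} {Γ : ℝ → ℝ} {z : Eu n → ℝ} {ε : ℝ}

theorem tr_eq {x : Eu n} (hO : IsOpen Ω) (hx : x ∈ Ω) :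
    tr Ω Γ z =ᶠ[𝓝 x] fun y => Γ (z y) := by
  filter_upwards [hO.mem_nhds hx] with y hy
  simp [tr, hy]

theorem tr_compact (hO : IsOpen Ω) (hb : Bornology.IsBounded Ω) (hz : Continuous z)
    (hz0 : ∀ x ∈ frontier Ω, z x = 0) (hε : 0 < ε) :
    IsCompact {x | x ∈ closure Ω ∧ ε ≤ z x} ∧ {x | x ∈ closure Ω ∧ ε ≤ z x} ⊆ Ω := by
  constructor
  · have : IsCompact (closure Ω) := hb.isCompact_closure
    exact this.inter_right (isClosed_le continuous_const hz)
  · rintro x ⟨hx, hx2⟩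
    by_contra hn
    have : x ∈ frontier Ω := by rw [hO.frontier_eq]; exact ⟨hx, hn⟩
    rw [hz0 x this] at hx2; linarith

theorem tr_tsupport (hO : IsOpen Ω) (hb : Bornology.IsBounded Ω) (hz : Continuous z)
    (hz0 : ∀ x ∈ frontier Ω, z x = 0) (hε : 0 < ε) (hΓ0 : ∀ t ≤ ε, Γ t = 0) :
    tsupport (tr Ω Γ z) ⊆ {x | x ∈ closure Ω ∧ ε ≤ z x} := by
  apply closure_minimal _ (tr_compact hO hb hz hz0 hε).1.isClosed
  intro x hx
  have hx1 : x ∈ Ω := by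
    by_contra h; simp [tr, h] at hx
  refine ⟨subset_closure hx1, ?_⟩
  by_contra h
  push Not at h
  simp [tr, hΓ0 _ h.le] at hx

theorem tr_subset (hO : IsOpen Ω) (hb : Bornology.IsBounded Ω) (hz : Continuous z)
    (hz0 : ∀ x ∈ frontier Ω, z x = 0) (hε : 0 < ε) (hΓ0 : ∀ t ≤ ε, Γ t = 0) :
    tsupport (tr Ω Γ z) ⊆ Ω :=
  (tr_tsupport hO hb hz hz0 hε hΓ0).trans (tr_compact hO hb hz hz0 hε).2

theorem tr_hasCompact (hO : IsOpen Ω) (hb : Bornology.IsBounded Ω) (hz : Continuous z)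
    (hz0 : ∀ x ∈ frontier Ω, z x = 0) (hε : 0 < ε) (hΓ0 : ∀ t ≤ ε, Γ t = 0) :
    HasCompactSupport (tr Ω Γ z) :=
  (tr_compact hO hb hz hz0 hε).1.of_isClosed_subset (isClosed_tsupport _)
    (tr_tsupport hO hb hz hz0 hε hΓ0)

theorem tr_contDiff {k : WithTop ℕ∞} (hO : IsOpen Ω) (hb : Bornology.IsBounded Ω) (hz : ContDiff ℝ k z)
    (hz0 : ∀ x ∈ frontier Ω, z x = 0) (hε : 0 < ε) (hΓ0 : ∀ t ≤ ε, Γ t = 0)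
    (hΓ : ∀ x ∈ Ω, ContDiffAt ℝ k Γ (z x)) :
    ContDiff ℝ k (tr Ω Γ z) := by
  rw [contDiff_iff_contDiffAt]
  intro x
  by_cases hx : x ∈ Ω
  · refine ContDiffAt.congr_of_eventuallyEq ?_ (tr_eq hO hx)
    exact (hΓ x hx).comp x hz.contDiffAt
  · have h1 : x ∉ tsupport (tr Ω Γ z) := fun h =>
      hx (tr_subset hO hb hz.continuous hz0 hε hΓ0 h)
    have : tr Ω Γ z =ᶠ[𝓝 x] fun _ => 0 := by
      rw [notMem_tsupport_iff_eventuallyEq] at h1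
      exact h1
    exact contDiffAt_const.congr_of_eventuallyEq this

/-- the basic energy identity -/
theorem energy_identity {J : Set ℝ} (hJ : IsOpen J) {Θ : ℝ → ℝ} {Θ1 : ℝ → ℝ}
    (hO : IsOpen Ω) (hb : Bornology.IsBounded Ω)
    (hz : ContDiff ℝ (⊤ : ℕ∞) z) (hz0 : ∀ x ∈ frontier Ω, z x = 0) (hzJ : ∀ x ∈ Ω, z x ∈ J)
    (hε : 0 < ε) (hΘ0 : ∀ t ≤ ε, Θ t = 0)
    (hΘ : ∀ t ∈ J, HasDerivAt Θ (Θ1 t) t) (hc : ContinuousOn Θ1 J) :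
    ∫ x in Ω, Θ1 (z x) * ∑ i, (pd i z x) ^ 2 = ∫ x in Ω, Θ (z x) * (- lap z x) := by
  have hz2 : ContDiff ℝ 2 z := hz.of_le two_le_tp
  have hz1 : ContDiff ℝ 1 z := hz.of_le (by exact_mod_cast le_top)
  have hΘc : ∀ x ∈ Ω, ContDiffAt ℝ 1 Θ (z x) := by
    intro x hx
    have : ContDiffOn ℝ 1 Θ J := by
      rw [show (1 : WithTop ℕ∞) = 0 + 1 by simp, contDiffOn_succ_iff_deriv_of_isOpen hJ]
      refine ⟨fun t ht => (hΘ t ht).differentiableAt.differentiableWithinAt, by simp, ?_⟩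
      rw [contDiffOn_zero]
      exact hc.congr fun t ht => (hΘ t ht).deriv
    exact this.contDiffAt (hJ.mem_nhds (hzJ x hx))
  set Ψ := tr Ω Θ z with hΨ
  have hΨc : ContDiff ℝ 1 Ψ := tr_contDiff hO hb hz1 hz0 hε hΘ0 hΘc
  have hΨs : HasCompactSupport Ψ := tr_hasCompact hO hb hz.continuous hz0 hε hΘ0
  have hpz : ∀ i, ContDiff ℝ 1 (pd i z) := fun i => pd_contDiff i hz2 (by norm_num)
  have hpzc : ∀ i, Continuous (pd i z) := fun i => (hpz i).continuous
  have hpp : ∀ i, Continuous (pd i (pd i z)) := fun i => (pd_contDiff i (hpz i) (m := 0) (by norm_num)).continuous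
  have hpΨ : ∀ i, Continuous (pd i Ψ) := fun i => (pd_contDiff i hΨc (m := 0) (by norm_num)).continuous
  have key : ∀ i, ∫ x, (Ψ x * pd i (pd i z) x + pd i Ψ x * pd i z x) = 0 := by
    intro i
    have := integral_pd_eq_zero i (g := fun x => Ψ x * pd i z x) (hΨc.mul (hpz i)) hΨs.mul_right
    rw [← this]
    congr 1; ext x
    rw [pd_mul i (hΨc.differentiable (by norm_num) x) ((hpz i).differentiable (by norm_num) x)]
  have hs1 : ∀ i, HasCompactSupport (pd i Ψ) := fun i => hΨs.fderiv_apply (𝕜 := ℝ) _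
  have int1 : ∀ i, Integrable (fun x => Ψ x * pd i (pd i z) x) := fun i =>
    (hΨc.continuous.mul (hpp i)).integrable_of_hasCompactSupport hΨs.mul_right
  have int2 : ∀ i, Integrable (fun x => pd i Ψ x * pd i z x) := fun i =>
    ((hpΨ i).mul (hpzc i)).integrable_of_hasCompactSupport (hs1 i).mul_right
  have sum0 : (∫ x, (∑ i, Ψ x * pd i (pd i z) x)) + ∫ x, (∑ i, pd i Ψ x * pd i z x) = 0 := by
    rw [integral_finsetSum _ fun i _ => int1 i, integral_finsetSum _ fun i _ => int2 i,
      ← Finset.sum_add_distrib]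
    refine Finset.sum_eq_zero fun i _ => ?_
    rw [← integral_add (int1 i) (int2 i)]; exact key i
  have e1 : ∫ x, (∑ i, Ψ x * pd i (pd i z) x) = - ∫ x in Ω, Θ (z x) * (- lap z x) := by
    rw [← integral_neg, ← integral_indicator hO.measurableSet]
    congr 1; ext x
    by_cases hx : x ∈ Ω
    · simp only [indicator_of_mem hx, hΨ, tr, lap_eq hz2.contDiffAt, ← Finset.mul_sum]; ring
    · simp [hΨ, tr, indicator_of_notMem hx]
  have e2 : ∫ x, (∑ i, pd i Ψ x * pd i z x) = ∫ x in Ω, Θ1 (z x) * ∑ i, (pd i z x) ^ 2 := by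
    rw [← integral_indicator hO.measurableSet]
    congr 1; ext x
    by_cases hx : x ∈ Ω
    · rw [indicator_of_mem hx, Finset.mul_sum]
      refine Finset.sum_congr rfl fun i _ => ?_
      rw [pd_congr i (tr_eq hO hx), pd_comp i (hz1.differentiable (by norm_num) x) (hΘ _ (hzJ x hx))]
      ring
    · rw [indicator_of_notMem hx]
      refine Finset.sum_eq_zero fun i _ => ?_
      have h1 : x ∉ tsupport Ψ := fun h => hx (tr_subset hO hb hz.continuous hz0 hε hΘ0 h)
      have : pd i Ψ x = 0 := by
        unfold pd
        rw [fderiv_of_notMem_tsupport (𝕜 := ℝ) h1]; simp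
      rw [this, zero_mul]
  rw [e1, e2] at sum0
  linarith

end trunc

theorem stab_energy {n : ℕ} {Ω : Set (Eu n)} {z : Eu n → ℝ} {ε : ℝ} {J : Set ℝ} (hJ : IsOpen J)
    {Γ Θ : ℝ → ℝ} {rl : ℝ} {ω : Eu n → ℝ}
    (hO : IsOpen Ω) (hb : Bornology.IsBounded Ω)
    (hz : ContDiff ℝ (⊤ : ℕ∞) z) (hz0 : ∀ x ∈ frontier Ω, z x = 0) (hzJ : ∀ x ∈ Ω, z x ∈ J)
    (hε : 0 < ε) (hΓ0 : ∀ t ≤ ε, Γ t = 0) (hΘ0 : ∀ t ≤ ε, Θ t = 0)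
    (hΓ : ContDiffOn ℝ (⊤ : ℕ∞) Γ J)
    (hΘ : ∀ t ∈ J, HasDerivAt Θ ((deriv Γ t) ^ 2) t)
    (hst : ∀ φ : Eu n → ℝ, ContDiff ℝ (⊤ : ℕ∞) φ → HasCompactSupport φ → tsupport φ ⊆ Ω →
      rl * ∫ x in Ω, ω x * (φ x) ^ 2 ≤ ∫ x in Ω, ‖gradient φ x‖ ^ 2) :
    rl * ∫ x in Ω, ω x * (Γ (z x)) ^ 2 ≤ ∫ x in Ω, Θ (z x) * (- lap z x) := by
  have hΓa : ∀ x ∈ Ω, ContDiffAt ℝ (⊤ : ℕ∞) Γ (z x) := fun x hx =>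
    hΓ.contDiffAt (hJ.mem_nhds (hzJ x hx))
  have h := hst (tr Ω Γ z) (tr_contDiff hO hb hz hz0 hε hΓ0 hΓa)
    (tr_hasCompact hO hb hz.continuous hz0 hε hΓ0) (tr_subset hO hb hz.continuous hz0 hε hΓ0)
  have hc : ContinuousOn (fun t => (deriv Γ t) ^ 2) J :=
    (hΓ.continuousOn_deriv_of_isOpen hJ (by exact_mod_cast le_top)).pow 2
  rw [← energy_identity hJ hO hb hz hz0 hzJ hε hΘ0 hΘ hc]
  have e1 : ∫ x in Ω, ω x * (tr Ω Γ z x) ^ 2 = ∫ x in Ω, ω x * (Γ (z x)) ^ 2 := by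
    refine setIntegral_congr_fun hO.measurableSet fun x hx => ?_
    simp [tr, hx]
  have e2 : ∫ x in Ω, ‖gradient (tr Ω Γ z) x‖ ^ 2
      = ∫ x in Ω, (deriv Γ (z x)) ^ 2 * ∑ i, (pd i z x) ^ 2 := by
    refine setIntegral_congr_fun hO.measurableSet fun x hx => ?_
    simp only [grad_sq, Finset.mul_sum]
    refine Finset.sum_congr rfl fun i _ => ?_
    rw [pd_congr i (tr_eq hO hx), pd_comp i (hz.differentiable (by simp) x)
      ((hΓa x hx).differentiableAt (by simp)).hasDerivAt]
    ring
  rwa [e1, e2] at h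

theorem deriv2_line {n : ℕ} (i : Fin n) {z : Eu n → ℝ} (hz : ContDiff ℝ 2 z) (x : Eu n) :
    (deriv (fun t : ℝ => z (x + t • eb i)) = fun t => pd i z (x + t • eb i)) ∧
    deriv (deriv (fun t : ℝ => z (x + t • eb i))) 0 = pd i (pd i z) x := by
  have hl : ∀ t : ℝ, HasDerivAt (fun t : ℝ => x + t • eb i) (eb i) t := by
    intro t
    simpa using ((hasDerivAt_id t).smul_const (eb i)).const_add x
  have h1 : ∀ (g : Eu n → ℝ), Differentiable ℝ g → ∀ t,
      HasDerivAt (fun t : ℝ => g (x + t • eb i)) (pd i g (x + t • eb i)) t := by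
    intro g hg t
    exact (hg _).hasFDerivAt.comp_hasDerivAt t (hl t)
  have e : (deriv (fun t : ℝ => z (x + t • eb i)) = fun t => pd i z (x + t • eb i)) := by
    ext t
    exact (h1 z (hz.differentiable (by norm_num)) t).deriv
  refine ⟨e, ?_⟩
  rw [e, (h1 (pd i z) ((pd_contDiff i hz (m := 1) (by norm_num)).differentiable (by norm_num)) 0).deriv]
  simp

theorem lap_nonneg_of_localMin {n : ℕ} {z : Eu n → ℝ} (hz : ContDiff ℝ 2 z) {x : Eu n}
    (hx : IsLocalMin z x) : 0 ≤ lap z x := by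
  rw [lap_eq hz.contDiffAt]
  refine Finset.sum_nonneg fun i _ => ?_
  obtain ⟨e1, e2⟩ := deriv2_line i hz x
  set g := fun t : ℝ => z (x + t • eb i) with hg
  have hgc : Continuous g := by
    have := hz.continuous
    fun_prop
  have hmin : IsLocalMin g 0 := by
    have hc : ContinuousAt (fun t : ℝ => x + t • eb i) 0 := by fun_prop
    have : Tendsto (fun t : ℝ => x + t • eb i) (𝓝 0) (𝓝 x) := by simpa using hc.tendsto
    have h2 := this.eventually hx
    filter_upwards [h2] with t ht
    simpa [hg] using ht
  rw [← e2]
  by_contra hneg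
  push Not at hneg
  have hmax := isLocalMax_of_deriv_deriv_neg hneg hmin.deriv_eq_zero hgc.continuousAt
  have hconst : g =ᶠ[𝓝 0] fun _ => g 0 := by
    filter_upwards [hmin, hmax] with t h1 h2
    exact le_antisymm h2 h1
  have : deriv (deriv g) 0 = 0 := by
    rw [(hconst.deriv).deriv_eq]; simp
  linarith

theorem min_principle {n : ℕ} {U : Set (Eu n)} (hU : IsOpen U) (hb : Bornology.IsBounded U)
    {z : Eu n → ℝ} (hz : ContDiff ℝ 2 z) (hl : ∀ x ∈ U, lap z x < 0)
    (hf : ∀ x ∈ frontier U, 0 ≤ z x) : ∀ x ∈ U, 0 < z x := by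
  intro x hx
  have hK : IsCompact (closure U) := hb.isCompact_closure
  obtain ⟨y, hy, hmin⟩ := hK.exists_isMinOn ⟨x, subset_closure hx⟩ hz.continuous.continuousOn
  have nomin : ∀ y ∈ U, ¬ IsMinOn z (closure U) y := by
    intro y hy hmin
    have : IsLocalMin z y := hmin.isLocalMin (mem_of_superset (hU.mem_nhds hy) subset_closure)
    exact absurd (lap_nonneg_of_localMin hz this) (not_le.2 (hl y hy))
  have hyU : y ∉ U := fun h => nomin y h hmin
  have h0 : 0 ≤ z y := hf y (by rw [hU.frontier_eq]; exact ⟨hy, hyU⟩)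
  have h1 : z y ≤ z x := hmin (subset_closure hx)
  rcases (h0.trans h1).lt_or_eq with h | h
  · exact h
  · exfalso
    refine nomin x hx fun w hw => ?_
    have : z y ≤ z w := hmin hw
    show z x ≤ z w
    linarith

/-- squared distance -/
def nsq {n : ℕ} (x0 : Eu n) (x : Eu n) : ℝ := ‖x - x0‖ ^ 2

theorem nsq_contDiff {n : ℕ} (x0 : Eu n) {k : WithTop ℕ∞} : ContDiff ℝ k (nsq x0) := by
  unfold nsq
  exact (contDiff_id.sub contDiff_const).norm_sq ℝ

theorem pd_nsq {n : ℕ} (i : Fin n) (x0 x : Eu n) : pd i (nsq x0) x = 2 * (x i - x0 i) := by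
  unfold pd
  have h1 : HasFDerivAt (fun x : Eu n => x - x0) (ContinuousLinearMap.id ℝ (Eu n)) x :=
    (hasFDerivAt_id x).sub_const x0
  have := h1.norm_sq
  have h2 : fderiv ℝ (nsq x0) x = _ := this.fderiv
  rw [h2]
  simp [EuclideanSpace.inner_single_right]

theorem pd_coord {n : ℕ} (i : Fin n) (x : Eu n) : pd i (fun y : Eu n => y i) x = 1 := by
  unfold pd
  have : (fun y : Eu n => y i) = (EuclideanSpace.proj i : Eu n →L[ℝ] ℝ) := by ext; simp
  rw [this, ContinuousLinearMap.fderiv]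
  simp

theorem coord_contDiff {n : ℕ} (i : Fin n) {k : WithTop ℕ∞} : ContDiff ℝ k (fun y : Eu n => y i) := by
  have : (fun y : Eu n => y i) = (EuclideanSpace.proj i : Eu n →L[ℝ] ℝ) := by ext; simp
  rw [this]; exact ContinuousLinearMap.contDiff _

theorem sum_pd_nsq {n : ℕ} (x0 x : Eu n) : ∑ i, (pd i (nsq x0) x) ^ 2 = 4 * nsq x0 x := by
  simp only [pd_nsq, nsq, EuclideanSpace.norm_sq_eq, Finset.mul_sum]
  refine Finset.sum_congr rfl fun i _ => ?_
  simp; ring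

theorem lap_nsq {n : ℕ} (x0 x : Eu n) : lap (nsq x0) x = 2 * n := by
  rw [lap_eq (nsq_contDiff x0).contDiffAt]
  have : ∀ i, pd i (pd i (nsq x0)) x = 2 := by
    intro i
    have e : pd i (nsq x0) = fun y => 2 * (y i - x0 i) := by ext y; exact pd_nsq i x0 y
    rw [e, pd_smul i 2, pd_sub i, pd_coord]
    · simp [pd]
    · exact (coord_contDiff i (k := 1)).differentiable (by norm_num) x
    · fun_prop
    · exact ((coord_contDiff i (k := 1)).differentiable (by norm_num) x).sub_const _
  simp [this]; ring

theorem lap_sub_mul {n : ℕ} {g h : Eu n → ℝ} (c : ℝ) (hg : ContDiff ℝ 2 g) (hh : ContDiff ℝ 2 h)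
    (x : Eu n) : lap (fun y => g y - c * h y) x = lap g x - c * lap h x := by
  have hh2 : ContDiff ℝ 2 (fun y => c * h y) := contDiff_const.mul hh
  rw [lap_eq (hg.sub hh2).contDiffAt, lap_eq hg.contDiffAt, lap_eq hh.contDiffAt,
    Finset.mul_sum, ← Finset.sum_sub_distrib]
  refine Finset.sum_congr rfl fun i _ => ?_
  have e : pd i (fun y => g y - c * h y) = fun y => pd i g y - c * pd i h y := by
    ext y
    rw [pd_sub i (hg.differentiable (by norm_num) y) (hh2.differentiable (by norm_num) y),
      pd_smul i c (hh.differentiable (by norm_num) y)]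
  have d1 := (pd_contDiff i hg (m := 1) (by norm_num)).differentiable (by norm_num)
  have d2 := (pd_contDiff i hh (m := 1) (by norm_num)).differentiable (by norm_num)
  rw [e, pd_sub i (d1 x) ((d2 x).const_mul c), pd_smul i c (d2 x)]

theorem lap_smul {n : ℕ} {h : Eu n → ℝ} (c : ℝ) (hh : ContDiff ℝ 2 h)
    (x : Eu n) : lap (fun y => c * h y) x = c * lap h x := by
  have hh2 : ContDiff ℝ 2 (fun y => c * h y) := contDiff_const.mul hh
  rw [lap_eq hh2.contDiffAt, lap_eq hh.contDiffAt, Finset.mul_sum]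
  refine Finset.sum_congr rfl fun i _ => ?_
  have e : pd i (fun y => c * h y) = fun y => c * pd i h y := by
    ext y
    rw [pd_smul i c (hh.differentiable (by norm_num) y)]
  have d2 := (pd_contDiff i hh (m := 1) (by norm_num)).differentiable (by norm_num)
  rw [e, pd_smul i c (d2 x)]

theorem barrier {n : ℕ} (hn : 0 < n) {z : Eu n → ℝ} (hz : ContDiff ℝ 2 z) {x0 : Eu n} {ρ c : ℝ}
    (hρ : 0 < ρ) (hc : 0 < c) (hl : ∀ x ∈ Metric.ball x0 ρ, lap z x ≤ -c)
    (h0 : ∀ x ∈ Metric.closedBall x0 ρ, 0 ≤ z x) :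
    ∀ x ∈ Metric.ball x0 ρ, c / (4 * n) * (ρ ^ 2 - ‖x - x0‖ ^ 2) ≤ z x := by
  have hn' : (0:ℝ) < n := by exact_mod_cast hn
  intro x hx
  have hb : ContDiff ℝ 2 (fun y => ρ ^ 2 - 1 * nsq x0 y) :=
    contDiff_const.sub (contDiff_const.mul (nsq_contDiff x0))
  have hb' : ∀ y, lap (fun y => ρ ^ 2 - 1 * nsq x0 y) y = - (2 * n) := by
    intro y
    rw [lap_sub_mul (g := fun _ => ρ ^ 2) 1 contDiff_const (nsq_contDiff x0), lap_nsq]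
    have h0 : lap (fun _ : Eu n => ρ ^ 2) y = 0 := by
      rw [lap_eq contDiffAt_const]
      have : ∀ i : Fin n, pd i (fun _ : Eu n => ρ ^ 2) = fun _ => (0:ℝ) := by
        intro i; ext y; simp [pd]
      simp only [this]
      simp [pd]
    rw [h0]; ring
  have := min_principle Metric.isOpen_ball Metric.isBounded_ball
    (z := fun y => z y - c / (4 * n) * (ρ ^ 2 - 1 * nsq x0 y)) (U := Metric.ball x0 ρ)
    (hz.sub (contDiff_const.mul hb)) ?_ ?_ x hx
  · simp only [nsq] at this; linarith
  · intro y hy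
    rw [lap_sub_mul _ hz hb, hb' y]
    have := hl y hy
    have e : c / (4 * n) * (2 * n) = c / 2 := by field_simp; norm_num
    linarith
  · intro y hy
    rw [frontier_ball x0 hρ.ne'] at hy
    have h1 := h0 y (Metric.sphere_subset_closedBall hy)
    have : ‖y - x0‖ = ρ := by simpa [dist_eq_norm] using hy
    simp [nsq, this, h1]

theorem bdd_int {n : ℕ} {Ω : Set (Eu n)} (hO : IsOpen Ω) (hb : Bornology.IsBounded Ω)
    {g : Eu n → ℝ} (hg : ContinuousOn g Ω) {C : ℝ} (hC : ∀ x ∈ Ω, |g x| ≤ C) :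
    IntegrableOn g Ω := by
  haveI : IsFiniteMeasure (volume.restrict Ω) := ⟨by simpa using hb.measure_lt_top⟩
  refine Integrable.of_bound (hg.aestronglyMeasurable hO.measurableSet) C ?_
  filter_upwards [ae_restrict_mem hO.measurableSet] with x hx using hC x hx

theorem poincare {n : ℕ} (hn : 0 < n) {Ω : Set (Eu n)} (hO : IsOpen Ω)
    (hb : Bornology.IsBounded Ω) : ∃ c > 0, ∀ φ : Eu n → ℝ, ContDiff ℝ (⊤ : ℕ∞) φ →
      HasCompactSupport φ → tsupport φ ⊆ Ω →
      c * ∫ x in Ω, (φ x) ^ 2 ≤ ∫ x in Ω, ‖gradient φ x‖ ^ 2 := by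
  obtain ⟨R, hR0, hR⟩ := hb.exists_pos_norm_le
  refine ⟨1 / (4 * R ^ 2), by positivity, fun φ hφ hc hs => ?_⟩
  set i : Fin n := ⟨0, hn⟩
  have hφ1 : ContDiff ℝ 1 φ := hφ.of_le (by exact_mod_cast le_top)
  have hpc : ∀ i, Continuous (pd i φ) := fun i => (pd_contDiff i hφ1 (m := 0) (by norm_num)).continuous
  have hps : ∀ i, HasCompactSupport (pd i φ) := fun i => hc.fderiv_apply (𝕜 := ℝ) _
  have hd := hφ1.differentiable (by norm_num)
  have hxc : ContDiff ℝ 1 (fun y : Eu n => y i) := coord_contDiff i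
  have key := integral_pd_eq_zero i (g := fun x => (x i * φ x) * φ x)
    ((hxc.mul hφ1).mul hφ1) (hc.mul_left)
  have e : ∀ x, pd i (fun x => (x i * φ x) * φ x) x = φ x ^ 2 + 2 * x i * φ x * pd i φ x := by
    intro x
    rw [pd_mul i ((hxc.mul hφ1).differentiable (by norm_num) x) (hd x),
      pd_mul i (hxc.differentiable (by norm_num) x) (hd x), pd_coord]
    ring
  have e1 : ∫ x in Ω, (φ x) ^ 2 = ∫ x, (φ x) ^ 2 := by
    refine setIntegral_eq_integral_of_forall_compl_eq_zero fun x hx => ?_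
    rw [image_eq_zero_of_notMem_tsupport (fun h => hx (hs h))]; simp
  have hz : ∀ x, x ∉ Ω → ∀ i, pd i φ x = 0 := by
    intro x hx i
    unfold pd
    rw [fderiv_of_notMem_tsupport (𝕜 := ℝ) (fun h => hx (hs h))]; simp
  have e2 : ∫ x in Ω, ‖gradient φ x‖ ^ 2 = ∫ x, ∑ i, (pd i φ x) ^ 2 := by
    simp only [grad_sq]
    refine setIntegral_eq_integral_of_forall_compl_eq_zero fun x hx => ?_
    simp [hz x hx]
  have i1 : Integrable (fun x => (φ x) ^ 2) :=
    (hφ.continuous.pow 2).integrable_of_hasCompactSupport (by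
      have := hc.mul_left (f := φ); simpa [pow_two] using this)
  have i2 : Integrable (fun x => ∑ i, (pd i φ x) ^ 2) := by
    refine integrable_finsetSum _ fun i _ => ((hpc i).pow 2).integrable_of_hasCompactSupport ?_
    have := (hps i).mul_left (f := pd i φ)
    convert! this using 1
    ext x; simp [pow_two]
  have i3 : Integrable (fun x => φ x ^ 2 + 2 * x i * φ x * pd i φ x) := by
    have h1 : Continuous (fun x => φ x ^ 2 + 2 * x i * φ x * pd i φ x) := by
      have := hφ.continuous; have := hpc i; have := hxc.continuous
      fun_prop
    refine h1.integrable_of_hasCompactSupport (hc.mono' ?_)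
    intro x hx
    by_contra h
    have h0 := image_eq_zero_of_notMem_tsupport h
    simp [h0] at hx
  rw [e1, e2]
  simp only [e] at key
  have h4 : ∫ x, ((1/2) * φ x ^ 2 - 2 * R ^ 2 * ∑ i, (pd i φ x) ^ 2) ≤ 0 := by
    rw [← key]
    refine integral_mono ((i1.const_mul _).sub (i2.const_mul _)) i3 fun x => ?_
    show (1/2) * φ x ^ 2 - 2 * R ^ 2 * ∑ i, (pd i φ x) ^ 2 ≤ φ x ^ 2 + 2 * x i * φ x * pd i φ x
    by_cases hx : x ∈ Ω
    · have h1 : (pd i φ x) ^ 2 ≤ ∑ i, (pd i φ x) ^ 2 :=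
        Finset.single_le_sum (f := fun i => (pd i φ x) ^ 2) (fun j _ => sq_nonneg _) (Finset.mem_univ i)
      have h2 : (x i) ^ 2 ≤ R ^ 2 := by
        have := (PiLp.norm_apply_le x i).trans (hR x hx)
        rw [Real.norm_eq_abs] at this
        exact sq_le_sq' (abs_le.1 this).1 (abs_le.1 this).2
      have h3 : (x i) ^ 2 * (pd i φ x) ^ 2 ≤ R ^ 2 * ∑ i, (pd i φ x) ^ 2 :=
        mul_le_mul h2 h1 (sq_nonneg _) (sq_nonneg _)
      nlinarith [sq_nonneg (φ x + 2 * x i * pd i φ x)]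
    · have h0 := image_eq_zero_of_notMem_tsupport (fun h => hx (hs h))
      simp [h0, hz x hx]
  rw [integral_sub (i1.const_mul _) (i2.const_mul _), integral_const_mul, integral_const_mul] at h4
  rw [div_mul_eq_mul_div, div_le_iff₀ (by positivity)]
  linarith

theorem green {n : ℕ} {φ K : Eu n → ℝ} (hφ : ContDiff ℝ 2 φ) (hK : ContDiff ℝ 2 K)
    (hc : HasCompactSupport φ) : ∫ x, φ x * lap K x = ∫ x, K x * lap φ x := by
  have hφ1 : ContDiff ℝ 1 φ := hφ.of_le (by norm_num)
  have hK1 : ContDiff ℝ 1 K := hK.of_le (by norm_num)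
  have dφ : ∀ i, ContDiff ℝ 1 (pd i φ) := fun i => pd_contDiff i hφ (by norm_num)
  have dK : ∀ i, ContDiff ℝ 1 (pd i K) := fun i => pd_contDiff i hK (by norm_num)
  have ddφ : ∀ i, Continuous (pd i (pd i φ)) := fun i => (pd_contDiff i (dφ i) (m := 0) (by norm_num)).continuous
  have ddK : ∀ i, Continuous (pd i (pd i K)) := fun i => (pd_contDiff i (dK i) (m := 0) (by norm_num)).continuous
  have cφ : ∀ i, HasCompactSupport (pd i φ) := fun i => hc.fderiv_apply (𝕜 := ℝ) _
  have ccφ : ∀ i, HasCompactSupport (pd i (pd i φ)) := fun i => (cφ i).fderiv_apply (𝕜 := ℝ) _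
  have lφ : ∀ x, lap φ x = ∑ i, pd i (pd i φ) x := fun x => lap_eq hφ.contDiffAt
  have lK : ∀ x, lap K x = ∑ i, pd i (pd i K) x := fun x => lap_eq hK.contDiffAt
  simp only [lφ, lK, Finset.mul_sum]
  have i1 : ∀ i, Integrable (fun x => φ x * pd i (pd i K) x) := fun i =>
    (hφ.continuous.mul (ddK i)).integrable_of_hasCompactSupport hc.mul_right
  have i2 : ∀ i, Integrable (fun x => K x * pd i (pd i φ) x) := fun i =>
    (hK.continuous.mul (ddφ i)).integrable_of_hasCompactSupport (ccφ i).mul_left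
  rw [integral_finsetSum _ (fun i _ => i1 i), integral_finsetSum _ (fun i _ => i2 i)]
  refine Finset.sum_congr rfl fun i _ => ?_
  have key := integral_pd_eq_zero i (g := fun x => φ x * pd i K x - K x * pd i φ x)
    ((hφ1.mul (dK i)).sub (hK1.mul (dφ i))) (by
      have := (hc.mul_right (f' := pd i K)).sub ((cφ i).mul_left (f := K))
      exact this)
  have e : ∀ x, pd i (fun x => φ x * pd i K x - K x * pd i φ x) x =
      φ x * pd i (pd i K) x - K x * pd i (pd i φ) x := by
    intro x
    have a1 := hφ1.differentiable (by norm_num) x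
    have a2 := hK1.differentiable (by norm_num) x
    have a3 := (dφ i).differentiable (by norm_num) x
    have a4 := (dK i).differentiable (by norm_num) x
    rw [pd_sub (g := fun x => φ x * pd i K x) (h := fun x => K x * pd i φ x) i (a1.mul a4) (a2.mul a3), pd_mul i a1 a4, pd_mul i a2 a3]
    ring
  simp only [e] at key
  rw [integral_sub (i1 i) (i2 i)] at key
  linarith

/-- primitive of the Newtonian kernel -/
def psi (n : ℕ) (R : ℝ) (t : ℝ) : ℝ := ∫ r in t..R, r ^ (-(n:ℝ) / 2)

theorem psi_deriv (n : ℕ) {R t : ℝ} (hR : 0 < R) (ht : 0 < t) :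
    HasDerivAt (psi n R) (-(t ^ (-(n:ℝ) / 2))) t := by
  have hc : ContinuousOn (fun r : ℝ => r ^ (-(n:ℝ) / 2)) (Ioi 0) := fun r hr =>
    (continuousAt_rpow_const _ _ (Or.inl (ne_of_gt hr))).continuousWithinAt
  unfold psi
  refine intervalIntegral.integral_hasDerivAt_left ?_ ?_ ?_
  · refine (hc.mono ?_).intervalIntegrable
    intro r hr
    exact lt_of_lt_of_le (lt_min ht hR) hr.1
  · exact hc.stronglyMeasurableAtFilter isOpen_Ioi t ht
  · exact hc.continuousAt (Ioi_mem_nhds ht)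

theorem psi_contDiffAt (n : ℕ) {R t : ℝ} (hR : 0 < R) (ht : 0 < t) :
    ContDiffAt ℝ 2 (psi n R) t := by
  have : ContDiffOn ℝ 2 (psi n R) (Ioi 0) := by
    rw [show (2 : WithTop ℕ∞) = 1 + 1 by norm_num, contDiffOn_succ_iff_deriv_of_isOpen isOpen_Ioi]
    refine ⟨fun t ht => (psi_deriv n hR ht).differentiableAt.differentiableWithinAt, by simp, ?_⟩
    have h2 : ContDiffOn ℝ 1 (fun t : ℝ => -(t ^ (-(n:ℝ) / 2))) (Ioi 0) := fun t ht =>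
      (contDiffAt_rpow_const_of_ne (ne_of_gt ht)).neg.contDiffWithinAt
    exact h2.congr fun t ht => (psi_deriv n hR ht).deriv
  exact this.contDiffAt (Ioi_mem_nhds ht)

theorem psi_nonneg (n : ℕ) {R t : ℝ} (ht : 0 < t) (hR : t ≤ R) : 0 ≤ psi n R t := by
  refine intervalIntegral.integral_nonneg hR fun r hr => ?_
  exact rpow_nonneg (ht.le.trans hr.1) _

theorem psi_le (n : ℕ) {R t β : ℝ} (ht : 0 < t) (hR : t ≤ R) (hβ : 0 < β) (hβn : (n:ℝ) / 2 - 1 ≤ β) :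
    psi n R t ≤ R ^ (β + 1 - n / 2) / β * t ^ (-β) := by
  have hc : ∀ p : ℝ, IntervalIntegrable (fun r : ℝ => r ^ p) volume t R := by
    intro p
    refine ContinuousOn.intervalIntegrable fun r hr => ?_
    rw [uIcc_of_le hR] at hr
    exact (continuousAt_rpow_const _ _ (Or.inl (ne_of_gt (ht.trans_le hr.1)))).continuousWithinAt
  have h1 : psi n R t ≤ ∫ r in t..R, R ^ (β + 1 - n / 2) * r ^ (-β - 1) := by
    refine intervalIntegral.integral_mono_on hR (hc _) ((hc _).const_mul _) fun r hr => ?_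
    have hr0 : 0 < r := ht.trans_le hr.1
    have e : r ^ (-(n:ℝ) / 2) = r ^ (β + 1 - n / 2) * r ^ (-β - 1) := by
      rw [← rpow_add hr0]; congr 1; ring
    rw [e]
    gcongr
    · linarith
    · exact hr.2
  refine h1.trans ?_
  rw [intervalIntegral.integral_const_mul, integral_rpow (Or.inr ⟨by linarith, by
    rw [uIcc_of_le hR]; intro h; linarith [h.1]⟩)]
  have hR0 : 0 < R := ht.trans_le hR
  rw [div_mul_eq_mul_div, mul_div_assoc]
  refine mul_le_mul_of_nonneg_left ?_ (by positivity)
  rw [show -β - 1 + 1 = -β by ring, div_neg, ← neg_div]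
  gcongr
  have : 0 < R ^ (-β) := by positivity
  linarith

/-- regularised Newtonian kernel -/
def Kn {n : ℕ} (R : ℝ) (x0 : Eu n) (ε : ℝ) (x : Eu n) : ℝ := psi n R (nsq x0 x + ε ^ 2)

theorem Kn_contDiff {n : ℕ} {R : ℝ} (hR : 0 < R) (x0 : Eu n) {ε : ℝ} (hε : 0 < ε) :
    ContDiff ℝ 2 (Kn R x0 ε) := by
  rw [contDiff_iff_contDiffAt]
  intro x
  have hp : 0 < nsq x0 x + ε ^ 2 := by unfold nsq; positivity
  exact (psi_contDiffAt n hR hp).comp x ((nsq_contDiff x0).add contDiff_const).contDiffAt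

theorem Kn_lap {n : ℕ} {R : ℝ} (hR : 0 < R) (x0 : Eu n) {ε : ℝ} (hε : 0 < ε) (x : Eu n) :
    lap (Kn R x0 ε) x = - (2 * n * ε ^ 2 * (nsq x0 x + ε ^ 2) ^ (-(n:ℝ) / 2 - 1)) := by
  have hp : 0 < nsq x0 x + ε ^ 2 := by unfold nsq; positivity
  set t := nsq x0 x + ε ^ 2 with ht
  have hs : HasDerivAt (fun t : ℝ => t + ε ^ 2) 1 (nsq x0 x) := (hasDerivAt_id _).add_const _
  have := lap_comp (z := nsq x0) (Γ := fun t => psi n R (t + ε ^ 2))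
    (Γ1 := fun t => -((t + ε ^ 2) ^ (-(n:ℝ) / 2))) (x := x)
    (d2 := -((-(n:ℝ) / 2) * t ^ (-(n:ℝ) / 2 - 1))) (nsq_contDiff x0)
    (ContDiffAt.comp (g := psi n R) (f := fun t : ℝ => t + ε ^ 2) (nsq x0 x) (psi_contDiffAt n hR hp)
      (contDiffAt_id.add contDiffAt_const)) ?_ ?_
  · change lap (fun y => psi n R (nsq x0 y + ε ^ 2)) x = _
    rw [this, sum_pd_nsq, lap_nsq]
    have e : t ^ (-(n:ℝ) / 2) = t ^ (-(n:ℝ) / 2 - 1) * t := by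
      rw [← rpow_add_one hp.ne']; congr 1; ring
    rw [← ht, e]
    have : nsq x0 x = t - ε ^ 2 := by rw [ht]; ring
    rw [this]; ring
  · have : ∀ᶠ s in 𝓝 (nsq x0 x), 0 < s + ε ^ 2 :=
      (hs.continuousAt.eventually (Ioi_mem_nhds hp))
    filter_upwards [this] with s hs
    have := HasDerivAt.comp (h₂ := psi n R) (h := fun t : ℝ => t + ε ^ 2) s
      (psi_deriv n hR hs) ((hasDerivAt_id s).add_const (ε ^ 2))
    rw [mul_one] at this
    exact this
  · have h3 : HasDerivAt (fun s : ℝ => s ^ (-(n:ℝ) / 2)) ((-(n:ℝ) / 2) * t ^ (-(n:ℝ) / 2 - 1))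
        (nsq x0 x + ε ^ 2) := Real.hasDerivAt_rpow_const (Or.inl hp.ne')
    have := (h3.comp (nsq x0 x) hs).neg
    rw [mul_one] at this
    exact this

theorem kernel_int {n : ℕ} (hn : 0 < n) {Ω : Set (Eu n)} (hO : IsOpen Ω)
    (hb : Bornology.IsBounded Ω) {e : ℝ} (he : e < n) :
    ∃ C : ℝ, 0 ≤ C ∧ ∀ x ∈ Ω, IntegrableOn (fun y => ‖x - y‖ ^ (-e)) Ω ∧
      ∫ y in Ω, ‖x - y‖ ^ (-e) ≤ C := by
  obtain ⟨D, hD⟩ := hb.exists_pos_norm_lt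
  set G : Eu n → ℝ := (Metric.ball 0 (2 * D)).indicator (fun y => ‖y‖ ^ (-e)) with hG
  have hm : Measurable (fun y : Eu n => ‖y‖ ^ (-e)) := by fun_prop
  have h1 : IntegrableOn (fun y : Eu n => ‖y‖ ^ (-e)) (Metric.ball 0 (2 * D)) := by
    refine integrableOn_ball_of_norm_le_rpow (C := 1) (α := e) ?_ ?_ ?_ hm.aestronglyMeasurable
    · simpa using Nat.succ_le_of_lt hn
    · simpa using he
    · refine Eventually.of_forall fun x => ?_
      rw [one_mul, Real.norm_of_nonneg (by positivity)]
  have hGi : Integrable G := h1.integrable_indicator Metric.isOpen_ball.measurableSet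
  have hG0 : ∀ y, 0 ≤ G y := fun y => indicator_nonneg (fun y _ => by positivity) y
  refine ⟨∫ y, G y, integral_nonneg hG0, fun x hx => ?_⟩
  have hGx : Integrable (fun y => G (x - y)) := hGi.comp_sub_left x
  have eq : EqOn (fun y => G (x - y)) (fun y => ‖x - y‖ ^ (-e)) Ω := by
    intro y hy
    have : x - y ∈ Metric.ball (0 : Eu n) (2 * D) := by
      rw [mem_ball_zero_iff]
      have := norm_sub_le x y
      linarith [hD.2 x hx, hD.2 y hy]
    simp only [hG, indicator_of_mem this]
  refine ⟨hGx.integrableOn.congr_fun eq hO.measurableSet, ?_⟩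
  rw [← setIntegral_congr_fun hO.measurableSet eq]
  refine (setIntegral_le_integral hGx (Eventually.of_forall fun y => hG0 _)).trans ?_
  rw [integral_sub_left_eq_self G]

def chi {n : ℕ} (y : Eu n) : ℝ := (1 + ‖y‖ ^ 2) ^ (-((n:ℝ) + 2) / 2)

theorem chi_pos {n : ℕ} (y : Eu n) : 0 < chi y := by unfold chi; positivity

theorem chi_int {n : ℕ} : Integrable (chi (n := n)) := by
  unfold chi
  exact integrable_rpow_neg_one_add_norm_sq (by simp)

def chiI (n : ℕ) : ℝ := ∫ y : Eu n, chi y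

theorem chiI_pos {n : ℕ} : 0 < chiI n := by
  unfold chiI
  rw [integral_pos_iff_support_of_nonneg (fun y => (chi_pos y).le) chi_int]
  have : Function.support (chi (n := n)) = univ := by
    ext y; simp [(chi_pos y).ne']
  rw [this]; exact Measure.measure_univ_pos.2 (NeZero.ne _)

theorem chi_lim {n : ℕ} {φ : Eu n → ℝ} (hφ : Continuous φ) (hφi : Integrable φ) (x : Eu n) :
    Tendsto (fun c : ℝ => ∫ y, (c ^ n * (chi (c • (x - y)) / chiI n)) * φ y) atTop (𝓝 (φ x)) := by
  have hfin : Module.finrank ℝ (Eu n) = n := by simp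
  have hI := chiI_pos (n := n)
  have hlim := tendsto_integral_comp_smul_smul_of_integrable' (μ := (volume : Measure (Eu n)))
    (φ := fun y => chi y / chiI n) (g := φ) (x₀ := x) (fun y => (div_pos (chi_pos y) hI).le) (by
      rw [integral_div]; exact div_self hI.ne') (by
      have h2 : Tendsto (fun y : Eu n => ‖y‖ ^ (-(2:ℝ)) * (chiI n)⁻¹) (Bornology.cobounded (Eu n)) (𝓝 0) := by
        have := ((tendsto_rpow_neg_atTop (y := 2) (by norm_num)).comp
          (tendsto_norm_cobounded_atTop (E := Eu n))).mul_const (chiI n)⁻¹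
        rw [zero_mul] at this
        exact this
      refine squeeze_zero' (Eventually.of_forall fun y => by have := chi_pos y; positivity) ?_ h2
      filter_upwards [(tendsto_norm_cobounded_atTop (E := Eu n)).eventually_gt_atTop 0] with y hy
      rw [hfin, ← mul_div_assoc, div_eq_mul_inv]
      gcongr
      have : chi y ≤ ‖y‖ ^ (-((n:ℝ) + 2)) := by
        have e : ‖y‖ ^ (-((n:ℝ) + 2)) = (‖y‖ ^ 2) ^ (-((n:ℝ) + 2) / 2) := by
          rw [← rpow_natCast, ← rpow_mul hy.le]; congr 1; push_cast; ring
        rw [e]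
        have hn0 : (0:ℝ) ≤ n := Nat.cast_nonneg n
        refine rpow_le_rpow_of_nonpos (by positivity) (by linarith) (by linarith)
      calc ‖y‖ ^ n * chi y ≤ ‖y‖ ^ n * ‖y‖ ^ (-((n:ℝ) + 2)) := by gcongr
        _ = ‖y‖ ^ (-(2:ℝ)) := by
          rw [← rpow_natCast, ← rpow_add hy]; congr 1; ring) hφi hφ.continuousAt
  simp only [hfin, smul_eq_mul] at hlim
  exact hlim

theorem chi_lap {n : ℕ} (hn : 0 < n) {R : ℝ} (hR : 0 < R) (x y : Eu n) {c : ℝ} (hc0 : 0 < c) :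
    c ^ n * (chi (c • (x - y)) / chiI n) = -(1 / (2 * n * chiI n)) * lap (Kn R x (1 / c)) y := by
  have hI := chiI_pos (n := n)
  have hn' : (0:ℝ) < n := by exact_mod_cast hn
  have hε0 : 0 < 1 / c := by positivity
  rw [Kn_lap hR x hε0]
  have hcn : nsq x y + (1 / c) ^ 2 = (1 + ‖c • (x - y)‖ ^ 2) * (c ^ 2)⁻¹ := by
    rw [norm_smul, nsq, norm_sub_rev, Real.norm_of_nonneg hc0.le]
    field_simp
    ring
  have h3 : (nsq x y + (1 / c) ^ 2) ^ (-(n:ℝ) / 2 - 1) = chi (c • (x - y)) * c ^ (n + 2) := by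
    rw [hcn, mul_rpow (by positivity) (by positivity), inv_rpow (by positivity), ← rpow_neg (by positivity)]
    have : (c ^ 2) ^ (-(-(n:ℝ) / 2 - 1)) = c ^ (n + 2) := by
      rw [← rpow_natCast, ← rpow_natCast, ← rpow_mul hc0.le]; congr 1; push_cast; ring
    rw [this, chi]
    congr 2; ring
  rw [h3, pow_add]
  field_simp

theorem rep_bound {n : ℕ} (hn : 0 < n) {Ω : Set (Eu n)} (hO : IsOpen Ω)
    (hb : Bornology.IsBounded Ω) {s D C1 R ε : ℝ} (hs0 : 0 < s) (hs2 : (n:ℝ) - 2 ≤ s)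
    (hD : ∀ x ∈ Ω, ‖x‖ < D) (hR : R = (2 * D) ^ 2 + 1) (hC1 : C1 = R ^ (s / 2 + 1 - n / 2) / (s / 2))
    (hε0 : 0 < ε) (hε1 : ε ≤ 1) {φ g : Eu n → ℝ} (hφ : ContDiff ℝ 2 φ) (hc : HasCompactSupport φ)
    (hsup : tsupport φ ⊆ Ω) (hg0 : ∀ x ∈ Ω, 0 ≤ g x) (hlap : ∀ x ∈ Ω, -lap φ x ≤ g x)
    {x : Eu n} (hx : x ∈ Ω) (hkint : IntegrableOn (fun y => ‖x - y‖ ^ (-s) * g y) Ω) :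
    - ∫ y, φ y * lap (Kn R x ε) y ≤ C1 * ∫ y in Ω, ‖x - y‖ ^ (-s) * g y := by
  have hR0 : 0 < R := by rw [hR]; positivity
  have hKc := Kn_contDiff hR0 x hε0
  have hfin : Module.finrank ℝ (Eu n) = n := by simp
  rw [green hφ hKc hc]
  have e2 : ∫ y, Kn R x ε y * lap φ y = ∫ y in Ω, Kn R x ε y * lap φ y := by
    symm
    refine setIntegral_eq_integral_of_forall_compl_eq_zero fun y hy => ?_
    have : φ =ᶠ[𝓝 y] fun _ => 0 := by
      have h1 : y ∉ tsupport φ := fun h => hy (hsup h)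
      rw [notMem_tsupport_iff_eventuallyEq] at h1
      exact h1
    rw [lap_congr this, lap_eq contDiffAt_const]
    have : ∀ i : Fin n, pd i (fun _ : Eu n => (0:ℝ)) = fun _ => (0:ℝ) := by
      intro i; ext y; simp [pd]
    simp [this]
  have hlc : Continuous (lap φ) := by
    have : lap φ = fun x => ∑ i, pd i (pd i φ) x := by
      ext x; exact lap_eq hφ.contDiffAt
    rw [this]
    refine continuous_finsetSum _ fun i _ => ?_
    exact (pd_contDiff i (pd_contDiff i hφ (m := 1) (by norm_num)) (m := 0) (by norm_num)).continuous
  have e3 : ∫ y in Ω, Kn R x ε y * (- lap φ y) ≤ ∫ y in Ω, C1 * (‖x - y‖ ^ (-s) * g y) := by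
    refine setIntegral_mono_ae_restrict ?_ (hkint.const_mul C1) ?_
    · have hcont : Continuous (fun y => Kn R x ε y * (- lap φ y)) := hKc.continuous.mul hlc.neg
      exact (hcont.continuousOn.integrableOn_compact hb.isCompact_closure).mono_set subset_closure
    · have hae : ∀ᵐ y ∂(volume.restrict Ω), y ≠ x := by
        refine ae_restrict_of_ae ?_
        have : Nontrivial (Eu n) := Module.nontrivial_of_finrank_pos (R := ℝ) (by rw [hfin]; exact hn)
        exact Measure.ae_ne volume x
      filter_upwards [ae_restrict_mem hO.measurableSet, hae] with y hy hyx
      have hd : 0 < ‖x - y‖ := norm_pos_iff.2 (sub_ne_zero.2 hyx.symm)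
      have hd2 : ‖x - y‖ ≤ 2 * D := by
        have := norm_sub_le x y; linarith [hD x hx, hD y hy]
      have hnq : nsq x y = ‖x - y‖ ^ 2 := by rw [nsq, norm_sub_rev]
      have ht : 0 < nsq x y + ε ^ 2 := by rw [hnq]; positivity
      have htR : nsq x y + ε ^ 2 ≤ R := by
        rw [hnq, hR]
        have : ε ^ 2 ≤ 1 := pow_le_one₀ hε0.le hε1
        gcongr
      have hK0 : 0 ≤ Kn R x ε y := psi_nonneg n ht htR
      have hK1 : Kn R x ε y ≤ C1 * ‖x - y‖ ^ (-s) := by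
        refine (psi_le n ht htR (β := s / 2) (by positivity) (by linarith)).trans ?_
        rw [← hC1]
        have hC0 : 0 ≤ C1 := by rw [hC1]; positivity
        refine mul_le_mul_of_nonneg_left ?_ hC0
        have e : ‖x - y‖ ^ (-s) = (‖x - y‖ ^ 2) ^ (-(s / 2)) := by
          rw [← rpow_natCast, ← rpow_mul hd.le]; congr 1; push_cast; ring
        rw [e, hnq]
        exact rpow_le_rpow_of_nonpos (by positivity) (by nlinarith) (by linarith)
      calc Kn R x ε y * (- lap φ y) ≤ Kn R x ε y * g y :=
            mul_le_mul_of_nonneg_left (hlap y hy) hK0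
        _ ≤ (C1 * ‖x - y‖ ^ (-s)) * g y := mul_le_mul_of_nonneg_right hK1 (hg0 y hy)
        _ = _ := by ring
  rw [integral_const_mul] at e3
  have e4 : ∫ y in Ω, Kn R x ε y * (- lap φ y) = - ∫ y in Ω, Kn R x ε y * lap φ y := by
    rw [← integral_neg]; congr 1; ext y; ring
  rw [e2, ← e4]
  exact e3

theorem kmul_int {n : ℕ} {Ω : Set (Eu n)} (hO : IsOpen Ω) {s : ℝ} {g : Eu n → ℝ} {x : Eu n}
    (hk : IntegrableOn (fun y => ‖x - y‖ ^ (-s)) Ω) (hg : ContinuousOn g Ω)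
    {M : ℝ} (hM : ∀ x ∈ Ω, |g x| ≤ M) : IntegrableOn (fun y => ‖x - y‖ ^ (-s) * g y) Ω := by
  refine Integrable.mul_bdd (c := M) hk (hg.aestronglyMeasurable hO.measurableSet) ?_
  filter_upwards [ae_restrict_mem hO.measurableSet] with y hy using hM y hy

theorem rep {n : ℕ} (hn : 0 < n) {Ω : Set (Eu n)} (hO : IsOpen Ω)
    (hb : Bornology.IsBounded Ω) {s : ℝ} (hs0 : 0 < s) (hs2 : (n:ℝ) - 2 ≤ s) (hsn : s < n) :
    ∃ C : ℝ, 0 < C ∧ ∀ (φ g : Eu n → ℝ), ContDiff ℝ 2 φ → HasCompactSupport φ → tsupport φ ⊆ Ω →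
      ContinuousOn g Ω → (∃ M, ∀ x ∈ Ω, |g x| ≤ M) → (∀ x ∈ Ω, 0 ≤ g x) →
      (∀ x ∈ Ω, -lap φ x ≤ g x) → ∀ x ∈ Ω, φ x ≤ C * ∫ y in Ω, ‖x - y‖ ^ (-s) * g y := by
  obtain ⟨D, hD0, hD⟩ := hb.exists_pos_norm_lt
  obtain ⟨_, _, hki⟩ := kernel_int hn hO hb hsn
  have hn' : (0:ℝ) < n := by exact_mod_cast hn
  obtain ⟨R, hR⟩ : ∃ R, R = (2 * D) ^ 2 + 1 := ⟨_, rfl⟩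
  have hR0 : 0 < R := by rw [hR]; positivity
  obtain ⟨C1, hC1⟩ : ∃ C1, C1 = R ^ (s / 2 + 1 - n / 2) / (s / 2) := ⟨_, rfl⟩
  have hC1p : 0 < C1 := by rw [hC1]; positivity
  have hI := chiI_pos (n := n)
  refine ⟨C1 / (2 * n * chiI n), by positivity, fun φ g hφ hc hsup hg hgb hg0 hlap x hx => ?_⟩
  obtain ⟨M, hM⟩ := hgb
  have hφi : Integrable φ := hφ.continuous.integrable_of_hasCompactSupport hc
  have hkint := kmul_int hO (hki x hx).1 hg hM
  refine le_of_tendsto (chi_lim hφ.continuous hφi x) ?_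
  filter_upwards [eventually_ge_atTop 1] with c hc1
  have hc0 : 0 < c := by linarith
  have hε1 : 1 / c ≤ 1 := by rw [div_le_one hc0]; exact hc1
  have hB := rep_bound hn hO hb hs0 hs2 hD hR hC1 (by positivity) hε1 hφ hc hsup hg0 hlap hx hkint
  have e1 : ∀ y, (c ^ n * (chi (c • (x - y)) / chiI n)) * φ y =
      -(1 / (2 * n * chiI n)) * (φ y * lap (Kn R x (1 / c)) y) := by
    intro y
    rw [chi_lap hn hR0 x y hc0]; ring
  simp_rw [e1]
  rw [integral_const_mul]
  have : 0 < 1 / (2 * n * chiI n) := by positivity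
  calc _ = 1 / (2 * n * chiI n) * (- ∫ y, φ y * lap (Kn R x (1 / c)) y) := by ring
    _ ≤ 1 / (2 * n * chiI n) * (C1 * ∫ y in Ω, ‖x - y‖ ^ (-s) * g y) :=
      mul_le_mul_of_nonneg_left hB this.le
    _ = _ := by ring

/-- convex truncation -/
def GG (t : ℝ) : ℝ := ∫ r in (0:ℝ)..t, smoothTransition r

theorem GG_deriv (t : ℝ) : HasDerivAt GG (smoothTransition t) t :=
  intervalIntegral.integral_hasDerivAt_right (smoothTransition.continuous.intervalIntegrable _ _)
    (smoothTransition.continuous.stronglyMeasurableAtFilter _ _) smoothTransition.continuousAt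

theorem GG_contDiff : ContDiff ℝ (⊤ : ℕ∞) GG := by
  rw [contDiff_infty_iff_deriv]
  refine ⟨fun t => (GG_deriv t).differentiableAt, ?_⟩
  have : deriv GG = smoothTransition := by ext t; exact (GG_deriv t).deriv
  rw [this]; exact smoothTransition.contDiff

theorem GG_zero {t : ℝ} (ht : t ≤ 0) : GG t = 0 := by
  unfold GG
  rw [intervalIntegral.integral_congr (g := fun _ => (0:ℝ))]
  · simp
  · intro r hr
    rw [uIcc_of_ge ht] at hr
    exact smoothTransition.zero_of_nonpos hr.2

theorem GG_nonneg (t : ℝ) : 0 ≤ GG t := by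
  rcases le_total t 0 with h | h
  · rw [GG_zero h]
  · exact intervalIntegral.integral_nonneg h fun r _ => smoothTransition.nonneg r

theorem GG_ge (t : ℝ) : t - 1 ≤ GG t := by
  rcases le_total t 1 with h | h
  · linarith [GG_nonneg t]
  · have hi : ∀ a b, IntervalIntegrable smoothTransition volume a b := fun a b =>
      smoothTransition.continuous.intervalIntegrable _ _
    have h1 : GG t = GG 1 + ∫ r in (1:ℝ)..t, smoothTransition r :=
      (intervalIntegral.integral_add_adjacent_intervals (hi 0 1) (hi 1 t)).symm
    have h2 : ∫ r in (1:ℝ)..t, smoothTransition r = ∫ r in (1:ℝ)..t, (1:ℝ) := by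
      refine intervalIntegral.integral_congr fun r hr => ?_
      rw [uIcc_of_le h] at hr
      exact smoothTransition.one_of_one_le hr.1
    rw [h1, h2]
    simp
    linarith [GG_nonneg 1]

theorem st_deriv_nonneg (t : ℝ) : 0 ≤ deriv smoothTransition t :=
  smoothTransition.monotone.deriv_nonneg

theorem trunc {J : Set ℝ} (hJ : IsOpen J) (hJc : J.OrdConnected) {t0 t1 : ℝ} (h0 : 0 < t0)
    (h01 : t0 < t1) (m0 : t0 ∈ J) (m1 : t1 ∈ J) {g B B1 : ℝ → ℝ}
    (hg : ContDiffOn ℝ (⊤ : ℕ∞) g (J ∩ Ioi 0)) (hg0 : ∀ t ∈ J, 0 < t → 0 ≤ g t)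
    (hB : ∀ t ∈ J, t1 ≤ t → HasDerivAt B (B1 t) t ∧ (deriv g t) ^ 2 ≤ B1 t) (hB0 : 0 ≤ B t1) :
    ∃ (Γ Θ : ℝ → ℝ) (C0 : ℝ), ContDiffOn ℝ (⊤ : ℕ∞) Γ J ∧ (∀ t ≤ t0, Γ t = 0) ∧
      (∀ t ≤ t0, Θ t = 0) ∧ (∀ t ∈ J, HasDerivAt Θ ((deriv Γ t) ^ 2) t) ∧
      (∀ t, t1 ≤ t → Γ t = g t) ∧ (∀ t ∈ J, 0 ≤ Γ t) ∧ 0 ≤ C0 ∧ (∀ t ∈ J, t ≤ t1 → Θ t ≤ C0) ∧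
      (∀ t ∈ J, t1 ≤ t → Θ t ≤ C0 + B t) ∧ (∀ t ∈ J, 0 ≤ Θ t) := by
  set Γ : ℝ → ℝ := fun t => smoothTransition ((t - t0) / (t1 - t0)) * g t with hΓ
  have hd : 0 < t1 - t0 := by linarith
  have hz : ∀ t ≤ t0, Γ t = 0 := by
    intro t ht
    have : smoothTransition ((t - t0) / (t1 - t0)) = 0 :=
      smoothTransition.zero_of_nonpos (div_nonpos_of_nonpos_of_nonneg (by linarith) hd.le)
    simp [hΓ, this]
  have hone : ∀ t, t1 ≤ t → Γ t = g t := by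
    intro t ht
    have : smoothTransition ((t - t0) / (t1 - t0)) = 1 :=
      smoothTransition.one_of_one_le (by rw [le_div_iff₀ hd]; linarith)
    simp [hΓ, this]
  have hΓs : ContDiffOn ℝ (⊤ : ℕ∞) Γ J := by
    intro t ht
    refine ContDiffAt.contDiffWithinAt ?_
    rcases lt_or_ge t t0 with h | h
    · refine (contDiffAt_const (c := (0:ℝ))).congr_of_eventuallyEq ?_
      filter_upwards [Iio_mem_nhds h] with s hs using hz s (le_of_lt hs)
    · have h1 : ContDiffAt ℝ (⊤ : ℕ∞) g t :=
        hg.contDiffAt ((hJ.inter isOpen_Ioi).mem_nhds ⟨ht, h0.trans_le h⟩)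
      refine ContDiffAt.mul ?_ h1
      exact smoothTransition.contDiff.contDiffAt.comp t
        ((contDiffAt_id.sub contDiffAt_const).div_const _)
  have hΓc : ContinuousOn (deriv Γ) J :=
    hΓs.continuousOn_deriv_of_isOpen hJ (by exact_mod_cast le_top)
  have hΓc2 : ContinuousOn (fun t => (deriv Γ t) ^ 2) J := hΓc.pow 2
  set Θ : ℝ → ℝ := fun t => ∫ r in t0..t, (deriv Γ r) ^ 2 with hΘ
  have hΘd : ∀ t ∈ J, HasDerivAt Θ ((deriv Γ t) ^ 2) t := by
    intro t ht
    refine intervalIntegral.integral_hasDerivAt_right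
      (hΓc2.mono (hJc.uIcc_subset m0 ht)).intervalIntegrable
      (hΓc2.stronglyMeasurableAtFilter hJ t ht) (hΓc2.continuousAt (hJ.mem_nhds ht))
  have hΘz : ∀ t ≤ t0, Θ t = 0 := by
    intro t ht
    simp only [hΘ]
    rw [intervalIntegral.integral_symm]
    have : ∫ r in t..t0, (deriv Γ r) ^ 2 = ∫ r in t..t0, (0:ℝ) := by
      refine intervalIntegral.integral_congr_uIoo fun r hr => ?_
      rw [uIoo_of_le ht] at hr
      have : Γ =ᶠ[𝓝 r] fun _ => 0 := by
        filter_upwards [Iio_mem_nhds hr.2] with s hs using hz s (le_of_lt hs)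
      simp [this.deriv_eq]
    rw [this]; simp
  have hΘm : MonotoneOn Θ J := by
    refine monotoneOn_of_deriv_nonneg hJc.convex (fun t ht => (hΘd t ht).continuousAt.continuousWithinAt)
      (fun t ht => (hΘd t (interior_subset ht)).differentiableAt.differentiableWithinAt)
      fun t ht => ?_
    rw [(hΘd t (interior_subset ht)).deriv]; positivity
  have hΘ0 : ∀ t ∈ J, 0 ≤ Θ t := by
    intro t ht
    rcases le_total t t0 with h | h
    · rw [hΘz t h]
    · rw [← hΘz t0 le_rfl]; exact hΘm m0 ht h
  refine ⟨Γ, Θ, Θ t1, hΓs, hz, hΘz, hΘd, hone, ?_, hΘ0 _ m1, fun t ht h => hΘm ht m1 h, ?_, hΘ0⟩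
  · intro t ht
    rcases le_total t t0 with h | h
    · rw [hz t h]
    · exact mul_nonneg (smoothTransition.nonneg _) (hg0 t ht (h0.trans_le h))
  · intro t ht h
    have hsub : Icc t1 t ⊆ J := hJc.out m1 ht
    have hmon : MonotoneOn (fun t => B t - Θ t) (Icc t1 t) := by
      have hdd : ∀ r ∈ Icc t1 t, HasDerivAt (fun t => B t - Θ t) (B1 r - (deriv Γ r) ^ 2) r :=
        fun r hr => (hB r (hsub hr) hr.1).1.sub (hΘd r (hsub hr))
      refine monotoneOn_of_deriv_nonneg (convex_Icc _ _)
        (fun r hr => (hdd r hr).continuousAt.continuousWithinAt)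
        (fun r hr => (hdd r (interior_subset hr)).differentiableAt.differentiableWithinAt)
        fun r hr => ?_
      rw [(hdd r (interior_subset hr)).deriv]
      rw [interior_Icc] at hr
      have e : Γ =ᶠ[𝓝 r] g := by
        filter_upwards [Ioi_mem_nhds hr.1] with s hs using hone s (le_of_lt hs)
      rw [e.deriv_eq]
      have := (hB r (hsub (Ioo_subset_Icc_self hr)) hr.1.le).2
      linarith
    have := hmon (left_mem_Icc.2 h) (right_mem_Icc.2 h) h
    simp only at this
    linarith

/-- open interval `(0,a)` -/
def Jp (a : EReal) : Set ℝ := {t : ℝ | 0 < t ∧ (t : EReal) < a}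
/-- `(-∞,a)` -/
def Jn (a : EReal) : Set ℝ := {t : ℝ | (t : EReal) < a}

theorem Jn_open (a : EReal) : IsOpen (Jn a) := isOpen_Iio.preimage continuous_coe_real_ereal
theorem Jp_open (a : EReal) : IsOpen (Jp a) := isOpen_Ioi.inter (Jn_open a)
theorem Jn_lower {a : EReal} {s t : ℝ} (ht : t ∈ Jn a) (h : s ≤ t) : s ∈ Jn a :=
  lt_of_le_of_lt (EReal.coe_le_coe_iff.2 h) ht
theorem Jn_ord (a : EReal) : (Jn a).OrdConnected :=
  ⟨fun _ _ _ hy _ hz => Jn_lower hy hz.2⟩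
theorem Jp_conv (a : EReal) : Convex ℝ (Jp a) := by
  refine OrdConnected.convex ⟨fun x hx y hy z hz => ⟨hx.1.trans_le hz.1, Jn_lower hy.2 hz.2⟩⟩
theorem Jp_sub (a : EReal) : Jp a ⊆ domf a := fun _ h => ⟨h.1.le, h.2⟩

theorem Jp_gt {a : EReal} {t : ℝ} (h : t ∈ Jp a) : ∃ s, t < s ∧ s ∈ Jp a := by
  have : ∀ᶠ s in 𝓝[>] t, s ∈ Jp a := nhdsWithin_le_nhds ((Jp_open a).mem_nhds h)
  obtain ⟨s, hs, hs2⟩ := (this.and self_mem_nhdsWithin).exists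
  exact ⟨s, hs2, hs⟩

theorem ev_af {a : EReal} (ha : 0 < a) {P : ℝ → Prop} (h : ∀ᶠ t in afFilter a, P t) :
    ∃ t0 ∈ Jp a, ∀ s ∈ Jp a, t0 ≤ s → P s := by
  unfold afFilter at h
  split_ifs at h with hT
  · obtain ⟨t, ht⟩ := eventually_atTop.1 h
    refine ⟨max t 1, ⟨by positivity, ?_⟩, fun s _ hs => ht s ((le_max_left _ _).trans hs)⟩
    rw [hT]; exact EReal.coe_lt_top _
  · have e : ((a.toReal : ℝ) : EReal) = a := EReal.coe_toReal hT (by rintro rfl; simp at ha)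
    have hpos : 0 < a.toReal := by
      have : ((0:ℝ) : EReal) < (a.toReal : EReal) := by rw [e]; exact_mod_cast ha
      exact_mod_cast this
    obtain ⟨l, hl, hl2⟩ := (mem_nhdsLT_iff_exists_Ioo_subset' (a := a.toReal) hpos).1 h
    have hl' : l < a.toReal := hl
    obtain ⟨m, hm1, hm2⟩ := exists_between (max_lt hl' hpos)
    refine ⟨m, ⟨(le_max_right _ _).trans_lt hm1, ?_⟩, fun s hs hms => hl2 ⟨?_, ?_⟩⟩
    · rw [← e]; exact_mod_cast hm2
    · exact ((le_max_left _ _).trans_lt hm1).trans_le hms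
    · have := hs.2; rw [← e] at this; exact_mod_cast this


theorem f_smooth {a : EReal} {f : ℝ → ℝ} (hf : HypH a f) {t : ℝ} (ht : t ∈ Jp a) : ContDiffAt ℝ (⊤ : ℕ∞) f t :=
  (hf.smooth.mono (Jp_sub a)).contDiffAt ((Jp_open a).mem_nhds ht)

theorem f_d {a : EReal} {f : ℝ → ℝ} (hf : HypH a f) {t : ℝ} (ht : t ∈ Jp a) : HasDerivAt f (deriv f t) t :=
  ((f_smooth hf ht).differentiableAt (by simp)).hasDerivAt

theorem f1_smooth {a : EReal} {f : ℝ → ℝ} (hf : HypH a f) : ContDiffOn ℝ (⊤ : ℕ∞) (deriv f) (Jp a) :=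
  (hf.smooth.mono (Jp_sub a)).deriv_of_isOpen (Jp_open a) (by simp)

theorem f_dd {a : EReal} {f : ℝ → ℝ} (hf : HypH a f) {t : ℝ} (ht : t ∈ Jp a) : HasDerivAt (deriv f) (deriv (deriv f) t) t :=
  (((f1_smooth hf).contDiffAt ((Jp_open a).mem_nhds ht)).differentiableAt (by simp)).hasDerivAt

theorem zero_mem {a : EReal} {f : ℝ → ℝ} (hf : HypH a f) : (0:ℝ) ∈ domf a := ⟨le_rfl, by exact_mod_cast hf.a_pos⟩

theorem f1_pos {a : EReal} {f : ℝ → ℝ} (hf : HypH a f) {t : ℝ} (ht : t ∈ Jp a) : 0 < deriv f t := by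
  have h := hf.convex.slope_le_of_hasDerivAt (zero_mem hf) (Jp_sub a ht) ht.1 (f_d hf ht)
  have h2 := hf.mono (zero_mem hf) (Jp_sub a ht) ht.1
  refine lt_of_lt_of_le ?_ h
  rw [slope_def_field]
  exact div_pos (by linarith) (by linarith [ht.1])

theorem f1_mono {a : EReal} {f : ℝ → ℝ} (hf : HypH a f) : MonotoneOn (deriv f) (Jp a) :=
  (hf.convex.subset (Jp_sub a) (Jp_conv a)).monotoneOn_deriv
    fun _ hx => (f_d hf hx).differentiableAt

theorem f2_nonneg {a : EReal} {f : ℝ → ℝ} (hf : HypH a f) {t : ℝ} (ht : t ∈ Jp a) : 0 ≤ deriv (deriv f) t := by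
  rw [← derivWithin_of_isOpen (Jp_open a) ht]
  exact (f1_mono hf).derivWithin_nonneg

theorem f_pos {a : EReal} {f : ℝ → ℝ} (hf : HypH a f) {t : ℝ} (ht : t ∈ Jp a) : 0 < f t := hf.pos t (Jp_sub a ht)

theorem f_ge {a : EReal} {f : ℝ → ℝ} (hf : HypH a f) {t : ℝ} (ht : t ∈ Jp a) : f 0 < f t := hf.mono (zero_mem hf) (Jp_sub a ht) ht.1

theorem f_mono {a : EReal} {f : ℝ → ℝ} (hf : HypH a f) : StrictMonoOn f (Jp a) := hf.mono.mono (Jp_sub a)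

theorem tau_bounds {a : EReal} {f : ℝ → ℝ} (hf : HypH a f) (h1 : 0 < tauMinus a f) (h2 : 0 < tauPlus a f) {τ1 τ2 : ℝ} (hτ1 : τ1 < tauMinus a f)
    (hτ2 : tauPlus a f < τ2) : ∃ t0 ∈ Jp a, ∀ t ∈ Jp a, t0 ≤ t →
      τ1 * (deriv f t) ^ 2 ≤ f t * deriv (deriv f) t ∧
      f t * deriv (deriv f) t ≤ τ2 * (deriv f t) ^ 2 := by
  have e1 : ∀ᶠ t in afFilter a, τ1 ≤ f t * deriv (deriv f) t / (deriv f t) ^ 2 := by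
    unfold tauMinus at h1 hτ1
    rw [liminf_eq] at h1 hτ1
    obtain ⟨b, hb, hb2⟩ := exists_lt_of_lt_csSup (by
      by_contra h; rw [not_nonempty_iff_eq_empty] at h; simp [h] at h1) hτ1
    filter_upwards [hb] with t ht using hb2.le.trans ht
  have e2 : ∀ᶠ t in afFilter a, f t * deriv (deriv f) t / (deriv f t) ^ 2 ≤ τ2 := by
    unfold tauPlus at h2 hτ2
    rw [limsup_eq] at h2 hτ2
    obtain ⟨b, hb, hb2⟩ := exists_lt_of_csInf_lt (by
      by_contra h; rw [not_nonempty_iff_eq_empty] at h; simp [h] at h2) hτ2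
    filter_upwards [hb] with t ht using ht.trans hb2.le
  obtain ⟨t0, ht0, h⟩ := ev_af hf.a_pos (e1.and e2)
  refine ⟨t0, ht0, fun t ht htt => ?_⟩
  obtain ⟨h3, h4⟩ := h t ht htt
  have := f1_pos hf ht
  rw [le_div_iff₀ (by positivity)] at h3
  rw [div_le_iff₀ (by positivity)] at h4
  exact ⟨h3, h4⟩

theorem bound_of_f {a : EReal} {f : ℝ → ℝ} (hf : HypH a f) {M : ℝ} : ∃ C : ℝ, (C : EReal) < a ∧ ∀ t ∈ Jp a, f t ≤ M → t ≤ C := by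
  obtain ⟨t0, ht0, h⟩ := ev_af hf.a_pos (hf.blowup.eventually_gt_atTop M)
  refine ⟨t0, ht0.2, fun t ht hM => ?_⟩
  by_contra hc
  exact absurd (h t ht (not_le.1 hc).le) (not_lt.2 hM)

/-- `f / sqrt f'` -/
def qq (f : ℝ → ℝ) (t : ℝ) : ℝ := f t / √(deriv f t)

theorem qq_pos {a : EReal} {f : ℝ → ℝ} (hf : HypH a f) {t : ℝ} (ht : t ∈ Jp a) : 0 < qq f t := by
  have := f_pos hf ht
  have := f1_pos hf ht
  unfold qq; positivity

theorem qq_mul {a : EReal} {f : ℝ → ℝ} (hf : HypH a f) {t : ℝ} (ht : t ∈ Jp a) :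
    √(deriv f t) * qq f t = f t := by
  have := f1_pos hf ht
  unfold qq; field_simp

theorem qq_smooth {a : EReal} {f : ℝ → ℝ} (hf : HypH a f) : ContDiffOn ℝ (⊤ : ℕ∞) (qq f) (Jp a) := by
  unfold qq
  refine (hf.smooth.mono (Jp_sub a)).div ((f1_smooth hf).sqrt fun t ht => (f1_pos hf ht).ne') ?_
  intro t ht
  exact (sqrt_pos.2 (f1_pos hf ht)).ne'

theorem qq_deriv {a : EReal} {f : ℝ → ℝ} (hf : HypH a f) {t : ℝ} (ht : t ∈ Jp a) :
    HasDerivAt (qq f) (√(deriv f t) * (1 - f t * deriv (deriv f) t / (deriv f t) ^ 2 / 2)) t := by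
  have h1 := f1_pos hf ht
  have h2 := (f_d hf ht).div ((f_dd hf ht).sqrt h1.ne') (sqrt_pos.2 h1).ne'
  convert! h2 using 1
  have hs := sqrt_pos.2 h1
  have e : deriv f t = √(deriv f t) ^ 2 := (sq_sqrt h1.le).symm
  set r := √(deriv f t)
  rw [e]
  field_simp

theorem f1_le {a : EReal} {f : ℝ → ℝ} (hf : HypH a f) {t0 τ2 : ℝ} (h0 : t0 ∈ Jp a) (hτ : 0 < τ2)
    (h : ∀ t ∈ Jp a, t0 ≤ t → f t * deriv (deriv f) t ≤ τ2 * (deriv f t) ^ 2) :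
    ∃ C : ℝ, 0 < C ∧ ∀ t ∈ Jp a, deriv f t ≤ C * f t ^ τ2 := by
  have hd : ∀ t ∈ Jp a, HasDerivAt (fun t => deriv f t * f t ^ (-τ2))
      (deriv (deriv f) t * f t ^ (-τ2) + deriv f t * (deriv f t * (-τ2) * f t ^ (-τ2 - 1))) t := by
    intro t ht
    exact (f_dd hf ht).mul ((f_d hf ht).rpow_const (Or.inl (f_pos hf ht).ne'))
  have hsub : Jp a ∩ Ici t0 ⊆ Jp a := inter_subset_left
  have hanti : AntitoneOn (fun t => deriv f t * f t ^ (-τ2)) (Jp a ∩ Ici t0) := by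
    refine antitoneOn_of_deriv_nonpos ((Jp_conv a).inter (convex_Ici _))
      (fun t ht => (hd t (hsub ht)).continuousAt.continuousWithinAt)
      (fun t ht => (hd t (hsub (interior_subset ht))).differentiableAt.differentiableWithinAt)
      fun t ht => ?_
    have ht' := interior_subset ht
    rw [(hd t ht'.1).deriv]
    have hfp := f_pos hf ht'.1
    have e : f t ^ (-τ2) = f t ^ (-τ2 - 1) * f t := by
      rw [← rpow_add_one hfp.ne']; congr 1; ring
    rw [e]
    have h3 := h t ht'.1 ht'.2
    have h4 : 0 < f t ^ (-τ2 - 1) := by positivity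
    nlinarith
  have hf0 := f_pos hf h0
  have hf00 := hf.f0_pos
  have h10 := f1_pos hf h0
  refine ⟨deriv f t0 * f t0 ^ (-τ2) + deriv f t0 * f 0 ^ (-τ2), by positivity, fun t ht => ?_⟩
  have hfp := f_pos hf ht
  have hp : 0 < f t ^ τ2 := by positivity
  rcases le_total t0 t with h1 | h1
  · have h2 : deriv f t * f t ^ (-τ2) ≤ deriv f t0 * f t0 ^ (-τ2) :=
      hanti ⟨h0, mem_Ici.2 le_rfl⟩ ⟨ht, h1⟩ h1
    have h3 : deriv f t = deriv f t * f t ^ (-τ2) * f t ^ τ2 := by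
      rw [mul_assoc, ← rpow_add hfp]; simp
    rw [h3]
    gcongr
    have : 0 < deriv f t0 * f 0 ^ (-τ2) := by positivity
    linarith
  · have h2 := f1_mono hf ht h0 h1
    have h3 : f 0 ^ (-τ2) * f t ^ τ2 ≥ 1 := by
      rw [rpow_neg hf00.le, ge_iff_le, ← div_eq_inv_mul, one_le_div (by positivity)]
      exact rpow_le_rpow hf00.le (f_ge hf ht).le hτ.le
    have h4 : 0 < deriv f t0 * f t0 ^ (-τ2) * f t ^ τ2 := by positivity
    nlinarith

theorem f_energy {a : EReal} {f : ℝ → ℝ} (hf : HypH a f) {t0 τ1 τ2 α : ℝ} (h0 : t0 ∈ Jp a)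
    (hα : 1 < α) (hτ2 : τ2 < 2)
    (h : ∀ t ∈ Jp a, t0 ≤ t →
      τ1 * (deriv f t) ^ 2 ≤ f t * deriv (deriv f) t ∧
      f t * deriv (deriv f) t ≤ τ2 * (deriv f t) ^ 2) :
    ∃ t1 ∈ Jp a, ∃ (Γ Θ : ℝ → ℝ) (C0 : ℝ), ContDiffOn ℝ (⊤ : ℕ∞) Γ (Jn a) ∧ (∀ t ≤ t0, Γ t = 0) ∧
      (∀ t ≤ t0, Θ t = 0) ∧ (∀ t ∈ Jn a, HasDerivAt Θ ((deriv Γ t) ^ 2) t) ∧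
      (∀ t, t1 ≤ t → Γ t = qq f t ^ α) ∧ (∀ t ∈ Jn a, 0 ≤ Γ t) ∧ 0 ≤ C0 ∧
      (∀ t ∈ Jn a, t ≤ t1 → Θ t ≤ C0) ∧
      (∀ t ∈ Jn a, t1 ≤ t → Θ t ≤ C0 +
        α ^ 2 * (1 - τ1 / 2) ^ 2 / (1 + (α - 1) * (2 - τ2)) * (f t * qq f t ^ (2 * α - 2))) ∧
      (∀ t ∈ Jn a, 0 ≤ Θ t) := by
  obtain ⟨t1, h01, ht1⟩ := Jp_gt h0
  have hκ : 0 < 1 + (α - 1) * (2 - τ2) := by nlinarith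
  refine ⟨t1, ht1, ?_⟩
  refine trunc (Jn_open a) (Jn_ord a) h0.1 h01 h0.2 ht1.2 (g := fun t => qq f t ^ α)
    (B1 := fun t => α ^ 2 * (1 - τ1 / 2) ^ 2 / (1 + (α - 1) * (2 - τ2)) *
      (deriv f t * qq f t ^ (2 * α - 2) + f t * (√(deriv f t) *
        (1 - f t * deriv (deriv f) t / (deriv f t) ^ 2 / 2) * (2 * α - 2) * qq f t ^ (2 * α - 2 - 1))))
    ?_ ?_ ?_ ?_
  · intro t ht
    have ht' : t ∈ Jp a := ⟨ht.2, ht.1⟩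
    have : ContDiffAt ℝ (⊤ : ℕ∞) (qq f) t := (qq_smooth hf).contDiffAt ((Jp_open a).mem_nhds ht')
    exact (this.rpow_const_of_ne (qq_pos hf ht').ne').contDiffWithinAt
  · intro t ht htp
    exact rpow_nonneg (qq_pos hf ⟨htp, ht⟩).le _
  · intro t ht htt
    have ht' : t ∈ Jp a := ⟨ht1.1.trans_le htt, ht⟩
    have hq := qq_pos hf ht'
    have hqd := qq_deriv hf ht'
    have h1 := f1_pos hf ht'
    constructor
    · exact ((f_d hf ht').mul (hqd.rpow_const (Or.inl hq.ne'))).const_mul _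
    · rw [(hqd.rpow_const (p := α) (Or.inl hq.ne')).deriv]
      obtain ⟨b1, b2⟩ := h t ht' (h01.le.trans htt)
      set ρ := f t * deriv (deriv f) t / (deriv f t) ^ 2 with hρ
      have c1 : τ1 ≤ ρ := by rw [hρ, le_div_iff₀ (by positivity)]; exact b1
      have c2 : ρ ≤ τ2 := by rw [hρ, div_le_iff₀ (by positivity)]; exact b2
      have e1 : qq f t ^ (α - 1) * qq f t ^ (α - 1) = qq f t ^ (2 * α - 2) := by
        rw [← rpow_add hq]; congr 1; ring
      have e2 : f t * qq f t ^ (2 * α - 2 - 1) = √(deriv f t) * qq f t ^ (2 * α - 2) := by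
        rw [← qq_mul hf ht', mul_assoc]
        congr 1
        rw [mul_comm, ← rpow_add_one hq.ne']; congr 1; ring
      have e3 : √(deriv f t) * √(deriv f t) = deriv f t := mul_self_sqrt h1.le
      set r := √(deriv f t)
      set Q := qq f t ^ (2 * α - 2) with hQ
      have hQp : 0 < Q := by positivity
      have l : (r * (1 - ρ / 2) * α * qq f t ^ (α - 1)) ^ 2 =
          deriv f t * Q * α ^ 2 * (1 - ρ / 2) ^ 2 := by
        rw [← e1, ← e3]; ring
      have l2 : deriv f t * Q + f t * (r * (1 - ρ / 2) * (2 * α - 2) * qq f t ^ (2 * α - 2 - 1)) =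
          deriv f t * Q * (1 + (α - 1) * (2 - ρ)) := by
        calc _ = deriv f t * Q + (r * (1 - ρ / 2) * (2 * α - 2)) * (f t * qq f t ^ (2 * α - 2 - 1)) := by ring
          _ = deriv f t * Q + (r * r) * Q * ((1 - ρ / 2) * (2 * α - 2)) := by rw [e2]; ring
          _ = _ := by rw [e3]; ring
      rw [l, l2]
      have hw : 0 < deriv f t * Q := by positivity
      have i1 : (1 - ρ / 2) ^ 2 ≤ (1 - τ1 / 2) ^ 2 := by
        apply pow_le_pow_left₀ (by linarith); linarith
      have i2 : 1 + (α - 1) * (2 - τ2) ≤ 1 + (α - 1) * (2 - ρ) := by nlinarith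
      rw [div_mul_eq_mul_div, le_div_iff₀ hκ]
      calc deriv f t * Q * α ^ 2 * (1 - ρ / 2) ^ 2 * (1 + (α - 1) * (2 - τ2))
          ≤ deriv f t * Q * α ^ 2 * (1 - τ1 / 2) ^ 2 * (1 + (α - 1) * (2 - ρ)) := by
            gcongr
        _ = _ := by ring
  · have := f_pos hf ht1
    have := qq_pos hf ht1
    have hw : 0 ≤ f t1 * qq f t1 ^ (2 * α - 2) := by positivity
    exact mul_nonneg (div_nonneg (by positivity) hκ.le) hw

theorem qq_ge {a : EReal} {f : ℝ → ℝ} (hf : HypH a f) {τ2 C : ℝ} (hC : 0 < C)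
    (h : ∀ t ∈ Jp a, deriv f t ≤ C * f t ^ τ2) :
    ∀ t ∈ Jp a, (√C)⁻¹ * f t ^ (1 - τ2 / 2) ≤ qq f t := by
  intro t ht
  have hfp := f_pos hf ht
  have h1 := f1_pos hf ht
  have h2 : √(deriv f t) ≤ √C * f t ^ (τ2 / 2) := by
    have : √(C * f t ^ τ2) = √C * f t ^ (τ2 / 2) := by
      rw [sqrt_mul hC.le, sqrt_eq_rpow (f t ^ τ2), ← rpow_mul hfp.le]; congr 2; ring
    rw [← this]; exact sqrt_le_sqrt (h t ht)
  unfold qq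
  rw [le_div_iff₀ (sqrt_pos.2 h1)]
  have hs : 0 < √C := sqrt_pos.2 hC
  calc (√C)⁻¹ * f t ^ (1 - τ2 / 2) * √(deriv f t)
      ≤ (√C)⁻¹ * f t ^ (1 - τ2 / 2) * (√C * f t ^ (τ2 / 2)) := by gcongr
    _ = f t ^ (1 - τ2 / 2) * f t ^ (τ2 / 2) := by field_simp
    _ = f t := by rw [← rpow_add hfp]; simp

theorem f_growth {a : EReal} {f : ℝ → ℝ} (hf : HypH a f) {τ2 C α : ℝ} (hC : 0 < C) (hτ2 : τ2 < 2)
    (hα : 1 < α) (h : ∀ t ∈ Jp a, deriv f t ≤ C * f t ^ τ2) :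
    (∀ ε > 0, ∃ D, 0 ≤ D ∧ ∀ t ∈ Jp a, f t ≤ ε * (√(deriv f t) * qq f t ^ (2 * α)) + D ∧
      f t * qq f t ^ (2 * α - 2) ≤ ε * (√(deriv f t) * qq f t ^ (2 * α)) + D) ∧
    ∃ c > 0, ∀ t ∈ Jp a, c * f t ^ (α * (2 - τ2) + τ2 / 2) ≤ √(deriv f t) * qq f t ^ (2 * α) := by
  have hq := qq_ge hf hC h
  have hs : 0 < √C := sqrt_pos.2 hC
  have key : ∀ t ∈ Jp a, √(deriv f t) * qq f t ^ (2 * α) = f t * qq f t ^ (2 * α - 1) := by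
    intro t ht
    have hqp := qq_pos hf ht
    rw [← qq_mul hf ht, mul_assoc]
    congr 1
    rw [mul_comm (qq f t), ← rpow_add_one hqp.ne']; congr 1; ring
  have bd : ∀ Q : ℝ, ∃ F : ℝ, 0 ≤ F ∧ ∀ t ∈ Jp a, qq f t ≤ Q → f t ≤ F := by
    intro Q
    refine ⟨|√C * Q| ^ (1 / (1 - τ2 / 2)), by positivity, fun t ht hQ => ?_⟩
    have hfp := f_pos hf ht
    have h1 : f t ^ (1 - τ2 / 2) ≤ |√C * Q| := by
      have := (hq t ht).trans hQ
      rw [inv_mul_le_iff₀ hs] at this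
      exact this.trans (le_abs_self _)
    calc f t = (f t ^ (1 - τ2 / 2)) ^ (1 / (1 - τ2 / 2)) := by
          rw [← rpow_mul hfp.le, mul_one_div_cancel (by linarith), rpow_one]
      _ ≤ _ := rpow_le_rpow (by positivity) h1 (one_div_nonneg.2 (by linarith))
  constructor
  · intro ε hε
    set Q := max 1 (1 / ε) ^ (1 / (2 * α - 1)) + 1 / ε with hQ
    have hQ1 : max 1 (1 / ε) ^ (1 / (2 * α - 1)) ≤ Q := by
      have : 0 < 1 / ε := by positivity
      linarith
    have hQ2 : 1 / ε ≤ Q := by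
      have : 0 ≤ max 1 (1 / ε) ^ (1 / (2 * α - 1)) := by positivity
      linarith
    have hQ0 : 0 < Q := by positivity
    obtain ⟨F, hF0, hF⟩ := bd Q
    refine ⟨F + F * Q ^ (2 * α - 2), by positivity, fun t ht => ?_⟩
    have hfp := f_pos hf ht
    have hqp := qq_pos hf ht
    rw [key t ht]
    have hD : 0 ≤ F * Q ^ (2 * α - 2) := by positivity
    rcases le_total (qq f t) Q with h1 | h1
    · have h2 := hF t ht h1
      have h3 : 0 ≤ ε * (f t * qq f t ^ (2 * α - 1)) := by positivity
      constructor
      · linarith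
      · have : f t * qq f t ^ (2 * α - 2) ≤ F * Q ^ (2 * α - 2) := by
          gcongr; linarith
        linarith
    · have h2 : 1 ≤ ε * qq f t ^ (2 * α - 1) := by
        have : 1 / ε ≤ qq f t ^ (2 * α - 1) := by
          calc 1 / ε ≤ max 1 (1 / ε) := le_max_right _ _
            _ = (max 1 (1 / ε) ^ (1 / (2 * α - 1))) ^ (2 * α - 1) := by
              rw [← rpow_mul (by positivity), one_div_mul_cancel (by linarith), rpow_one]
            _ ≤ _ := rpow_le_rpow (by positivity) (hQ1.trans h1) (by linarith)
        rw [div_le_iff₀ hε] at this; linarith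
      have h3 : 1 ≤ ε * qq f t := by
        have := hQ2.trans h1
        rw [div_le_iff₀ hε] at this; linarith
      have e : qq f t ^ (2 * α - 1) = qq f t ^ (2 * α - 2) * qq f t := by
        rw [← rpow_add_one hqp.ne']; congr 1; ring
      constructor
      · nlinarith
      · have h4 : 0 < f t * qq f t ^ (2 * α - 2) := by positivity
        rw [e]
        nlinarith
  · refine ⟨(√C)⁻¹ ^ (2 * α - 1), by positivity, fun t ht => ?_⟩
    have hfp := f_pos hf ht
    rw [key t ht]
    have h1 : ((√C)⁻¹ * f t ^ (1 - τ2 / 2)) ^ (2 * α - 1) ≤ qq f t ^ (2 * α - 1) :=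
      rpow_le_rpow (by positivity) (hq t ht) (by linarith)
    rw [mul_rpow (by positivity) (by positivity), ← rpow_mul hfp.le] at h1
    have e : f t ^ (α * (2 - τ2) + τ2 / 2) = f t * f t ^ ((1 - τ2 / 2) * (2 * α - 1)) := by
      rw [mul_comm (f t), ← rpow_add_one hfp.ne']; congr 1; ring
    rw [e]
    calc _ = f t * ((√C)⁻¹ ^ (2 * α - 1) * f t ^ ((1 - τ2 / 2) * (2 * α - 1))) := by ring
      _ ≤ _ := by gcongr

theorem Pf_neg {τm τp α β : ℝ} (hτ0 : 0 < τp) (hτp : τp < 2) (h1 : 1 < α) (hαβ : α < β)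
    (hr : Pf τm τp β = 0) : Pf τm τp α < 0 := by
  have hα0 : 0 < α := by linarith
  have hβ0 : 0 < β := by linarith
  have d1 : 0 < β ^ 2 * (2 * α - 1) - α ^ 2 * (2 * β - 1) := by
    have : β ^ 2 * (2 * α - 1) - α ^ 2 * (2 * β - 1) = (β - α) * (α * (β - 1) + β * (α - 1)) := by ring
    rw [this]
    exact mul_pos (by linarith) (add_pos (mul_pos hα0 (by linarith)) (mul_pos hβ0 (by linarith)))
  have d2 : 0 < β ^ 4 * (2 * α - 1) ^ 2 - α ^ 4 * (2 * β - 1) ^ 2 := by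
    have : β ^ 4 * (2 * α - 1) ^ 2 - α ^ 4 * (2 * β - 1) ^ 2 =
      (β ^ 2 * (2 * α - 1) - α ^ 2 * (2 * β - 1)) * (β ^ 2 * (2 * α - 1) + α ^ 2 * (2 * β - 1)) := by ring
    rw [this]
    refine mul_pos d1 (add_pos (mul_pos (by positivity) (by linarith)) (mul_pos (by positivity) (by linarith)))
  have d3 : 0 < β ^ 4 * (2 * α - 1) - α ^ 4 * (2 * β - 1) := by
    have : β ^ 4 * (2 * α - 1) - α ^ 4 * (2 * β - 1) =
      β ^ 2 * (β ^ 2 * (2 * α - 1) - α ^ 2 * (2 * β - 1)) + α ^ 2 * (2 * β - 1) * ((β - α) * (β + α)) := by ring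
    rw [this]
    refine add_pos (mul_pos (by positivity) d1) (mul_pos (mul_pos (by positivity) (by linarith))
      (mul_pos (by linarith) (by linarith)))
  have key : β ^ 4 * Pf τm τp α = α ^ 4 * Pf τm τp β -
      4 * ((2 - τp) / 2 * (β ^ 4 * (2 * α - 1) ^ 2 - α ^ 4 * (2 * β - 1) ^ 2) +
        τp / 2 * (β ^ 4 * (2 * α - 1) - α ^ 4 * (2 * β - 1))) := by
    unfold Pf; ring
  have h5 : 0 < (2 - τp) / 2 * (β ^ 4 * (2 * α - 1) ^ 2 - α ^ 4 * (2 * β - 1) ^ 2) :=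
    mul_pos (by linarith) d2
  have h6 : 0 < τp / 2 * (β ^ 4 * (2 * α - 1) - α ^ 4 * (2 * β - 1)) := mul_pos (by linarith) d3
  rw [hr] at key
  have : β ^ 4 * Pf τm τp α < 0 := by rw [key]; linarith
  by_contra hc
  push Not at hc
  have : 0 ≤ β ^ 4 * Pf τm τp α := by positivity
  linarith

theorem astar_gt {τm τp αs : ℝ} (hm : 0 < τm) (hmp : τm ≤ τp) (hp : τp < 2)
    (hmax : ∀ β : ℝ, Pf τm τp β = 0 → β ≤ αs) : 1 < αs := by
  set A := (2 - τm) ^ 2 with hA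
  have hA0 : 0 < A := by have : 0 < 2 - τm := by linarith
                         positivity
  set B := 1 + 28 / A with hB
  have hB1 : 1 ≤ B := by have : 0 < 28 / A := by positivity
                         linarith
  have h1 : Pf τm τp 1 < 0 := by unfold Pf; nlinarith
  have h2 : 0 ≤ Pf τm τp B := by
    have hAB : 28 ≤ A * B := by
      rw [hB, mul_add, mul_div_cancel₀ _ hA0.ne']; linarith
    have hBB : B ≤ B ^ 2 := by nlinarith
    have : A * B ^ 4 ≥ 28 * B ^ 2 := by
      have : A * B ^ 4 = (A * B) * B * B ^ 2 := by ring
      have h3 : 28 * 1 ≤ (A * B) * B := mul_le_mul hAB hB1 (by norm_num) (by positivity)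
      rw [this]
      nlinarith [sq_nonneg B]
    unfold Pf
    rw [← hA]
    nlinarith [sq_nonneg B]
  have hc : ContinuousOn (Pf τm τp) (Icc 1 B) := by unfold Pf; fun_prop
  obtain ⟨b, hb, hb0⟩ := intermediate_value_Icc hB1 hc ⟨h1.le, h2⟩
  have := hmax b hb0
  rcases eq_or_lt_of_le hb.1 with h | h
  · rw [← h] at hb0; linarith
  · linarith

theorem params {τm τp αs ν : ℝ} {T : Prop} [Decidable T] (hm : 0 < τm) (hmp : τm ≤ τp) (hp : τp < 2)
    (hroot : Pf τm τp αs = 0) (hmax : ∀ β : ℝ, Pf τm τp β = 0 → β ≤ αs)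
    (hn : ν < (4 * αs * (2 - τp) + 2 * τp) / τp * (if T then max 1 τp else 1)) :
    ∃ α τ1 τ2 s : ℝ, 1 < α ∧ 0 < τ1 ∧ τ1 < τm ∧ τp < τ2 ∧ τ2 < 2 ∧ 0 < s ∧ s < 1 ∧
      α ^ 2 * (1 - τ1 / 2) ^ 2 / (1 + (α - 1) * (2 - τ2)) * (α ^ 2 / (2 * α - 1)) < (1 - s) ^ 2 ∧
      (ν * τ2 < 4 * (α * (2 - τ2) + τ2 / 2) ∨ (T ∧ ν < 4 * (α * (2 - τ2) + τ2 / 2))) := by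
  have ha := astar_gt hm hmp hp hmax
  have hτ0 : 0 < τp := by linarith
  have hcase : ν * τp < 4 * (αs * (2 - τp) + τp / 2) ∨ (T ∧ ν < 4 * (αs * (2 - τp) + τp / 2)) := by
    have c1 : ν < (4 * αs * (2 - τp) + 2 * τp) / τp → ν * τp < 4 * (αs * (2 - τp) + τp / 2) := by
      intro h; rw [lt_div_iff₀ hτ0] at h; linarith
    split_ifs at hn with hT
    · rcases le_total 1 τp with h | h
      · right
        refine ⟨hT, ?_⟩
        rw [max_eq_right h, div_mul_cancel₀ _ hτ0.ne'] at hn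
        linarith
      · left; rw [max_eq_left h, mul_one] at hn; exact c1 hn
    · left; rw [mul_one] at hn; exact c1 hn
  -- choose α
  have hα : ∃ α, 1 < α ∧ α < αs ∧
      (ν * τp < 4 * (α * (2 - τp) + τp / 2) ∨ (T ∧ ν < 4 * (α * (2 - τp) + τp / 2))) := by
    have ct : Tendsto (fun α : ℝ => 4 * (α * (2 - τp) + τp / 2)) (𝓝[<] αs)
        (𝓝 (4 * (αs * (2 - τp) + τp / 2))) :=
      (Continuous.tendsto (by fun_prop) αs).mono_left nhdsWithin_le_nhds
    have e1 : ∀ᶠ α in 𝓝[<] αs, 1 < α := nhdsWithin_le_nhds (Ioi_mem_nhds ha)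
    have e2 : ∀ᶠ α in 𝓝[<] αs, α < αs := self_mem_nhdsWithin
    rcases hcase with h | ⟨hT, h⟩
    · obtain ⟨α, h1, h2, h3⟩ := (e1.and (e2.and (ct.eventually (lt_mem_nhds h)))).exists
      exact ⟨α, h1, h2, Or.inl h3⟩
    · obtain ⟨α, h1, h2, h3⟩ := (e1.and (e2.and (ct.eventually (lt_mem_nhds h)))).exists
      exact ⟨α, h1, h2, Or.inr ⟨hT, h3⟩⟩
  obtain ⟨α, hα1, hα2, hα3⟩ := hα
  have hP := Pf_neg (τm := τm) hτ0 hp hα1 hα2 hroot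
  have hP' : α ^ 4 * (1 - τm / 2) ^ 2 < (1 - 0) ^ 2 * ((2 * α - 1) * (1 + (α - 1) * (2 - τp))) := by
    unfold Pf at hP
    nlinarith
  have tn : ∀ (F G : ℝ → ℝ), Continuous F → Continuous G → F 0 < G 0 → ∀ᶠ η in 𝓝[>] (0:ℝ), F η < G η := by
    intro F G hF hG h
    exact nhdsWithin_le_nhds (hF.continuousAt.eventually_lt hG.continuousAt h)
  have e0 : ∀ᶠ η in 𝓝[>] (0:ℝ), 0 < η := self_mem_nhdsWithin
  have e1 := tn (fun η => α ^ 4 * (1 - (τm - η) / 2) ^ 2)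
    (fun η => (1 - η) ^ 2 * ((2 * α - 1) * (1 + (α - 1) * (2 - (τp + η))))) (by fun_prop) (by fun_prop)
    (by simpa using hP')
  have e2 := tn (fun η => 0) (fun η => τm - η) (by fun_prop) (by fun_prop) (by simpa using hm)
  have e3 := tn (fun η => τp + η) (fun η => 2) (by fun_prop) (by fun_prop) (by simpa using hp)
  have e4 := tn (fun η => η) (fun η => 1) (by fun_prop) (by fun_prop) (by norm_num)
  have e5 : ∀ᶠ η in 𝓝[>] (0:ℝ), (ν * (τp + η) < 4 * (α * (2 - (τp + η)) + (τp + η) / 2) ∨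
      (T ∧ ν < 4 * (α * (2 - (τp + η)) + (τp + η) / 2))) := by
    rcases hα3 with h | ⟨hT, h⟩
    · filter_upwards [tn (fun η => ν * (τp + η)) (fun η => 4 * (α * (2 - (τp + η)) + (τp + η) / 2))
        (by fun_prop) (by fun_prop) (by simpa using h)] with η h using Or.inl h
    · filter_upwards [tn (fun η => ν) (fun η => 4 * (α * (2 - (τp + η)) + (τp + η) / 2))
        (by fun_prop) (by fun_prop) (by simpa using h)] with η h using Or.inr ⟨hT, h⟩
  obtain ⟨η, h0, h1, h2, h3, h4, h5⟩ := (e0.and (e1.and (e2.and (e3.and (e4.and e5))))).exists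
  refine ⟨α, τm - η, τp + η, η, hα1, h2, by linarith, by linarith, h3, h0, h4, ?_, h5⟩
  have k1 : 0 < 1 + (α - 1) * (2 - (τp + η)) := by
    have := mul_pos (sub_pos.2 hα1) (sub_pos.2 h3); linarith
  have k2 : 0 < 2 * α - 1 := by linarith
  rw [div_mul_div_comm, div_lt_iff₀ (mul_pos k1 k2)]
  calc _ = α ^ 4 * (1 - (τm - η) / 2) ^ 2 := by ring
    _ < _ := h1
    _ = _ := by ring

/-- Reduced form of a solution. -/
structure SolF {n : ℕ} (Ω : Set (Eu n)) (a : EReal) (f : ℝ → ℝ) (lam : ℝ) (u V : Eu n → ℝ) :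
    Prop where
  lpos : 0 < lam
  hu : ContDiff ℝ (⊤ : ℕ∞) u
  hV : ContDiff ℝ (⊤ : ℕ∞) V
  u0 : ∀ x ∈ frontier Ω, u x = 0
  V0 : ∀ x ∈ frontier Ω, V x = 0
  uJ : ∀ x ∈ Ω, u x ∈ Jp a
  Vp : ∀ x ∈ Ω, 0 < V x
  lu : ∀ x ∈ Ω, -lap u x = √lam * V x
  lV : ∀ x ∈ Ω, -lap V x = √lam * f (u x)
  ub : ∃ c ∈ Jp a, ∀ x ∈ Ω, u x ≤ c
  Vb : ∃ M, ∀ x ∈ Ω, V x ≤ M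
  st : StabIneq Ω lam f u

theorem sol_bd {n : ℕ} {Ω : Set (Eu n)} (hb : Bornology.IsBounded Ω) (hne : Ω.Nonempty)
    {z : Eu n → ℝ} (hz : Continuous z) (hz0 : ∀ x ∈ frontier Ω, z x = 0)
    (hp : ∀ x ∈ Ω, 0 < z x) : ∃ x0 ∈ Ω, ∀ x ∈ Ω, z x ≤ z x0 := by
  have hK : IsCompact (closure Ω) := hb.isCompact_closure
  obtain ⟨y0, hy0⟩ := hne
  obtain ⟨y, hy, hmax⟩ := hK.exists_isMaxOn ⟨y0, subset_closure hy0⟩ hz.continuousOn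
  have h1 : z y0 ≤ z y := hmax (subset_closure hy0)
  have h2 := hp y0 hy0
  by_cases hyO : y ∈ Ω
  · exact ⟨y, hyO, fun x hx => hmax (subset_closure hx)⟩
  · have : y ∈ frontier Ω := ⟨hy, fun h => hyO (interior_subset h)⟩
    rw [hz0 y this] at h1
    linarith

theorem solF_of {n : ℕ} {Ω : Set (Eu n)} (hΩ : GoodDomain Ω) {a : EReal} {f : ℝ → ℝ}
    (hf : HypH a f) {lam : ℝ} (hl : 0 < lam) {u : Eu n → ℝ} (hs : Solves Ω a lam f u)
    (hst : StabIneq Ω lam f u) : ∃ V, SolF Ω a f lam u V := by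
  obtain ⟨hO, hb, hne⟩ := hΩ
  obtain ⟨hu, hua, heq, hu0, hl0⟩ := hs
  have hsl : 0 < √lam := sqrt_pos.2 hl
  have hlc : ContDiff ℝ (⊤ : ℕ∞) (lap u) := lap_contDiff hu
  have hV : ContDiff ℝ (⊤ : ℕ∞) (fun x => -(√lam)⁻¹ * lap u x) := contDiff_const.mul hlc
  have hlV : ∀ x, lap (fun x => -(√lam)⁻¹ * lap u x) x = -(√lam)⁻¹ * lap (lap u) x := fun x =>
    lap_smul _ (hlc.of_le two_le_tp) x
  have lV : ∀ x ∈ Ω, -lap (fun x => -(√lam)⁻¹ * lap u x) x = √lam * f (u x) := by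
    intro x hx
    rw [hlV, heq x hx]
    nth_rewrite 2 [← mul_self_sqrt hl.le]
    field_simp
  have lu : ∀ x ∈ Ω, -lap u x = √lam * (-(√lam)⁻¹ * lap u x) := by
    intro x hx; field_simp
  have Vp : ∀ x ∈ Ω, 0 < -(√lam)⁻¹ * lap u x := by
    refine min_principle hO hb (hV.of_le two_le_tp) ?_ ?_
    · intro x hx
      have := lV x hx
      have h2 : 0 < √lam * f (u x) := mul_pos hsl (hf.pos _ (hua x hx))
      linarith
    · intro x hx; rw [hl0 x hx]; simp
  have up : ∀ x ∈ Ω, 0 < u x := by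
    refine min_principle hO hb (hu.of_le two_le_tp) ?_ ?_
    · intro x hx
      have := lu x hx
      have h2 := mul_pos hsl (Vp x hx)
      linarith
    · intro x hx; rw [hu0 x hx]
  have V0 : ∀ x ∈ frontier Ω, -(√lam)⁻¹ * lap u x = 0 := by
    intro x hx; rw [hl0 x hx]; simp
  have uJ : ∀ x ∈ Ω, u x ∈ Jp a := fun x hx => ⟨up x hx, (hua x hx).2⟩
  obtain ⟨x1, hx1, h1⟩ := sol_bd hb hne hu.continuous hu0 up
  obtain ⟨x2, hx2, h2⟩ := sol_bd hb hne hV.continuous V0 Vp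
  exact ⟨_, hl, hu, hV, hu0, V0, uJ, Vp, lu, lV, ⟨_, uJ x1 hx1, h1⟩, ⟨_, h2⟩, hst⟩

theorem u_lower {n : ℕ} (hn : 0 < n) {Ω : Set (Eu n)} (hΩ : GoodDomain Ω) {a : EReal} {f : ℝ → ℝ}
    (hf : HypH a f) : ∃ x0 r c, 0 < r ∧ 0 < c ∧ Metric.closedBall x0 r ⊆ Ω ∧
      ∀ lam u V, SolF Ω a f lam u V → ∀ x ∈ Metric.closedBall x0 r, c * lam ≤ u x := by
  obtain ⟨hO, hb, x0, hx0⟩ := hΩ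
  have hn' : (0:ℝ) < n := by exact_mod_cast hn
  obtain ⟨ρ, hρ, hball⟩ := Metric.nhds_basis_closedBall.mem_iff.1 (hO.mem_nhds hx0)
  have hsub : ∀ {r : ℝ}, r ≤ ρ → Metric.closedBall x0 r ⊆ Ω := fun h =>
    (Metric.closedBall_subset_closedBall h).trans hball
  have hf0 := hf.f0_pos
  refine ⟨x0, ρ / 4, f 0 / (4 * n) * (3 / 4 * ρ ^ 2) / (4 * n) * (3 / 16 * ρ ^ 2), by positivity,
    by positivity, hsub (by linarith), fun lam u V S x hx => ?_⟩
  have hsl : 0 < √lam := sqrt_pos.2 S.lpos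
  have b1 : ∀ x ∈ Metric.closedBall x0 (ρ / 2),
      √lam * (f 0 / (4 * n) * (3 / 4 * ρ ^ 2)) ≤ V x := by
    intro x hx
    have hx2 : ‖x - x0‖ ≤ ρ / 2 := by rwa [← dist_eq_norm]
    have := barrier hn (S.hV.of_le two_le_tp) hρ (c := √lam * f 0) (by positivity)
      (x0 := x0) ?_ ?_ x (by rw [Metric.mem_ball, dist_eq_norm]; linarith)
    · refine le_trans ?_ this
      have e : √lam * (f 0 / (4 * n) * (3 / 4 * ρ ^ 2)) = √lam * f 0 / (4 * n) * (3 / 4 * ρ ^ 2) := by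
        ring
      rw [e]
      refine mul_le_mul_of_nonneg_left ?_ (by positivity)
      nlinarith [norm_nonneg (x - x0)]
    · intro y hy
      have hy' := hball (Metric.ball_subset_closedBall hy)
      have h1 := S.lV y hy'
      have h2 := mul_le_mul_of_nonneg_left (f_ge hf (S.uJ y hy')).le hsl.le
      linarith
    · exact fun y hy => (S.Vp y (hball hy)).le
  have hx2 : ‖x - x0‖ ≤ ρ / 4 := by rwa [← dist_eq_norm]
  have := barrier hn (S.hu.of_le two_le_tp) (ρ := ρ / 2) (by positivity)
      (c := √lam * (√lam * (f 0 / (4 * n) * (3 / 4 * ρ ^ 2)))) (by positivity)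
      (x0 := x0) ?_ ?_ x (by rw [Metric.mem_ball, dist_eq_norm]; linarith)
  · refine le_trans ?_ this
    have e : f 0 / (4 * n) * (3 / 4 * ρ ^ 2) / (4 * n) * (3 / 16 * ρ ^ 2) * lam =
        √lam * (√lam * (f 0 / (4 * n) * (3 / 4 * ρ ^ 2))) / (4 * n) * (3 / 16 * ρ ^ 2) := by
      nth_rewrite 1 [← mul_self_sqrt S.lpos.le]
      ring
    rw [e]
    refine mul_le_mul_of_nonneg_left ?_ (by positivity)
    nlinarith [norm_nonneg (x - x0)]
  · intro y hy
    have hy1 := Metric.ball_subset_closedBall hy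
    have h1 := S.lu y (hsub (by linarith) hy1)
    have h2 := mul_le_mul_of_nonneg_left (b1 y hy1) hsl.le
    linarith
  · intro y hy
    exact (S.uJ y (hsub (by linarith) hy)).1.le

theorem sf1_cont {a : EReal} {f : ℝ → ℝ} (hf : HypH a f) : ContinuousOn (fun t => √(deriv f t)) (Jp a) :=
  (f1_smooth hf).continuousOn.sqrt

theorem SolF.mc {n : ℕ} {Ω : Set (Eu n)} {a : EReal} {f : ℝ → ℝ} {lam : ℝ} {u V : Eu n → ℝ}
    (S : SolF Ω a f lam u V) {g : ℝ → ℝ} (hg : ContinuousOn g (Jp a)) :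
    ContinuousOn (fun x => g (u x)) Ω :=
  hg.comp S.hu.continuous.continuousOn S.uJ

theorem SolF.f1b {n : ℕ} {Ω : Set (Eu n)} {a : EReal} {f : ℝ → ℝ} (hf : HypH a f) {lam : ℝ} {u V : Eu n → ℝ}
    (S : SolF Ω a f lam u V) : ∃ M, ∀ x ∈ Ω, deriv f (u x) ≤ M := by
  obtain ⟨c, hc, h⟩ := S.ub
  exact ⟨_, fun x hx => f1_mono hf (S.uJ x hx) hc (h x hx)⟩

theorem SolF.fb {n : ℕ} {Ω : Set (Eu n)} {a : EReal} {f : ℝ → ℝ} (hf : HypH a f) {lam : ℝ} {u V : Eu n → ℝ}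
    (S : SolF Ω a f lam u V) : ∃ M, ∀ x ∈ Ω, f (u x) ≤ M := by
  obtain ⟨c, hc, h⟩ := S.ub
  exact ⟨_, fun x hx => (f_mono hf).monotoneOn (S.uJ x hx) hc (h x hx)⟩

theorem lam_bound {n : ℕ} (hn : 0 < n) {Ω : Set (Eu n)} (hΩ : GoodDomain Ω) {a : EReal} {f : ℝ → ℝ}
    (hf : HypH a f) : ∃ Λ > 0, ∀ lam u V, SolF Ω a f lam u V → lam ≤ Λ := by
  obtain ⟨x0, r, c, hr, hc, hsub, hlow⟩ := u_lower hn hΩ hf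
  obtain ⟨hO, hb, hne⟩ := hΩ
  obtain ⟨t, ht, -⟩ := ev_af hf.a_pos (P := fun _ => True) (by simp)
  let φ : ContDiffBump x0 := ⟨r / 2, r, by positivity, by linarith⟩
  have hφc : ContDiff ℝ (⊤ : ℕ∞) φ := φ.contDiff
  have hφs : HasCompactSupport φ := φ.hasCompactSupport
  have hts : tsupport φ = Metric.closedBall x0 r := φ.tsupport_eq
  have htΩ : tsupport φ ⊆ Ω := by rw [hts]; exact hsub
  have hφi : IntegrableOn (fun x => φ x ^ 2) Ω := by
    refine bdd_int hO hb (φ.continuous.pow 2).continuousOn (C := 1) fun x _ => ?_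
    rw [abs_of_nonneg (by positivity)]
    exact pow_le_one₀ φ.nonneg φ.le_one
  have hA : 0 < ∫ x in Ω, φ x ^ 2 := by
    rw [setIntegral_pos_iff_support_of_nonneg_ae (ae_of_all _ fun x => by positivity) hφi]
    have hs : Metric.ball x0 r ⊆ (Function.support fun x => φ x ^ 2) ∩ Ω := by
      intro x hx
      refine ⟨?_, hsub (Metric.ball_subset_closedBall hx)⟩
      have : 0 < φ x := φ.pos_of_mem_ball hx
      exact (pow_pos this 2).ne'
    exact (Metric.measure_ball_pos _ _ hr).trans_le (measure_mono hs)
  obtain ⟨A, hAe⟩ : ∃ A, A = ∫ x in Ω, φ x ^ 2 := ⟨_, rfl⟩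
  obtain ⟨E, hE⟩ : ∃ E, E = ∫ x in Ω, ‖gradient φ x‖ ^ 2 := ⟨_, rfl⟩
  rw [← hAe] at hA
  have hg := f1_pos hf ht
  refine ⟨max (t / c) ((E / (√(deriv f t) * A)) ^ 2), lt_max_of_lt_left (div_pos ht.1 hc),
    fun lam u V S => ?_⟩
  by_cases h : lam ≤ t / c
  · exact le_max_of_le_left h
  refine le_max_of_le_right ?_
  rw [not_le, div_lt_iff₀ hc] at h
  have hst := S.st φ hφc hφs htΩ
  rw [← hE] at hst
  have h2 : √(deriv f t) * A ≤ ∫ x in Ω, √(deriv f (u x)) * φ x ^ 2 := by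
    rw [hAe, ← integral_const_mul]
    obtain ⟨M, hM⟩ := S.f1b hf
    refine setIntegral_mono_on (hφi.const_mul _) ?_ hO.measurableSet ?_
    · refine bdd_int hO hb ((S.mc (sf1_cont hf)).mul (φ.continuous.pow 2).continuousOn) (C := √M)
        fun x hx => ?_
      rw [abs_of_nonneg (by positivity)]
      exact (mul_le_of_le_one_right (sqrt_nonneg _) (pow_le_one₀ φ.nonneg φ.le_one)).trans
        (sqrt_le_sqrt (hM x hx))
    · intro x hx
      by_cases hxb : x ∈ Metric.closedBall x0 r
      · refine mul_le_mul_of_nonneg_right (sqrt_le_sqrt (f1_mono hf ht (S.uJ x hx) ?_)) (by positivity)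
        have := hlow lam u V S x hxb
        linarith
      · rw [← hts] at hxb
        simp [image_eq_zero_of_notMem_tsupport hxb]
  have h3 : √lam * (√(deriv f t) * A) ≤ E :=
    (mul_le_mul_of_nonneg_left h2 (sqrt_nonneg _)).trans hst
  have h4 : √lam ≤ E / (√(deriv f t) * A) := by
    rw [le_div_iff₀ (by positivity)]; exact h3
  calc lam = √lam ^ 2 := (sq_sqrt S.lpos.le).symm
    _ ≤ _ := pow_le_pow_left₀ (sqrt_nonneg _) h4 2

theorem pow_absorb {p δ : ℝ} (hp0 : 0 < p) (hp : p < 2) (hδ : 0 < δ) :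
    ∃ D, 0 ≤ D ∧ ∀ S : ℝ, 0 ≤ S → S ^ p ≤ δ * S ^ 2 + D := by
  obtain ⟨R, hR⟩ : ∃ R, R = δ ^ (1 / (p - 2)) := ⟨_, rfl⟩
  have hR0 : 0 < R := by rw [hR]; positivity
  have hRp : R ^ (p - 2) = δ := by
    rw [hR, ← rpow_mul hδ.le, one_div, inv_mul_cancel₀ (by linarith), rpow_one]
  refine ⟨R ^ p, by positivity, fun S hS => ?_⟩
  rcases le_total S R with h | h
  · have := rpow_le_rpow hS h hp0.le
    nlinarith [sq_nonneg S]
  · have hS0 := hR0.trans_le h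
    have e : S ^ p = S ^ (p - 2) * S ^ 2 := by
      rw [← rpow_natCast S 2, ← rpow_add hS0]; norm_num
    have h2 : S ^ (p - 2) ≤ δ := by
      rw [← hRp]; exact rpow_le_rpow_of_nonpos hR0 h (by linarith)
    rw [e]
    have := mul_le_mul_of_nonneg_right h2 (sq_nonneg S)
    have : 0 ≤ R ^ p := by positivity
    linarith

theorem pw {a1 a0 b1 b0 p σ ε D1 : ℝ} (ha1 : 0 ≤ a1) (ha0 : 0 ≤ a0) (hb0 : 0 ≤ b0)
    (hp0 : 0 < p) (hp : p < 2) (hσ : 0 < σ) (hε : 0 < ε) (hD1 : 0 ≤ D1) :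
    ∃ C, 0 ≤ C ∧ ∀ ω S T A B : ℝ, σ ≤ ω → 0 ≤ S → 0 ≤ T → 0 ≤ B → A ≤ a1 * S ^ p + a0 →
      B ≤ b1 * (ω * T ^ (2 - p)) + b0 → B ≤ ε / (a0 + 1) * (ω * T ^ 2) + D1 →
      A * B ≤ a1 * b1 * (ω * (S ^ p * T ^ (2 - p))) + ε * (ω * S ^ 2) + ε * (ω * T ^ 2) + C := by
  obtain ⟨D, hD0, hD⟩ := pow_absorb hp0 hp (δ := ε * σ / (a1 * b0 + 1)) (by positivity)
  refine ⟨a1 * b0 * D + a0 * D1, by positivity, fun ω S T A B hω hS hT hB h1 h2 h3 => ?_⟩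
  have hω0 := hσ.trans_le hω
  have hSp : 0 ≤ S ^ p := rpow_nonneg hS _
  have s1 : A * B ≤ (a1 * S ^ p + a0) * B := mul_le_mul_of_nonneg_right h1 hB
  have s2 : a1 * S ^ p * B ≤ a1 * S ^ p * (b1 * (ω * T ^ (2 - p)) + b0) :=
    mul_le_mul_of_nonneg_left h2 (by positivity)
  have s3 : a0 * B ≤ a0 * (ε / (a0 + 1) * (ω * T ^ 2) + D1) := mul_le_mul_of_nonneg_left h3 ha0
  have s4 : a1 * b0 * S ^ p ≤ a1 * b0 * (ε * σ / (a1 * b0 + 1) * S ^ 2 + D) :=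
    mul_le_mul_of_nonneg_left (hD S hS) (by positivity)
  have s5 : a0 * (ε / (a0 + 1) * (ω * T ^ 2)) ≤ ε * (ω * T ^ 2) := by
    rw [← mul_assoc]
    refine mul_le_mul_of_nonneg_right ?_ (by positivity)
    rw [mul_div_assoc', div_le_iff₀ (by positivity)]; nlinarith
  have s6 : a1 * b0 * (ε * σ / (a1 * b0 + 1) * S ^ 2) ≤ ε * (ω * S ^ 2) := by
    have : a1 * b0 * (ε * σ / (a1 * b0 + 1)) ≤ ε * σ := by
      rw [mul_div_assoc', div_le_iff₀ (by positivity)]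
      have : 0 < ε * σ := by positivity
      nlinarith
    calc a1 * b0 * (ε * σ / (a1 * b0 + 1) * S ^ 2) = a1 * b0 * (ε * σ / (a1 * b0 + 1)) * S ^ 2 := by ring
      _ ≤ ε * σ * S ^ 2 := mul_le_mul_of_nonneg_right this (sq_nonneg S)
      _ = ε * (σ * S ^ 2) := by ring
      _ ≤ _ := mul_le_mul_of_nonneg_left (mul_le_mul_of_nonneg_right hω (sq_nonneg S)) hε.le
  nlinarith

theorem young2 {r ℓ S T : ℝ} (hr0 : 0 < r) (hr : r < 1) (hℓ : 0 ≤ ℓ) (hS : 0 ≤ S) (hT : 0 ≤ T) :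
    ℓ ^ r * (S ^ (2 - 2 * r) * T ^ (2 * r)) ≤ (1 - r) * S ^ 2 + r * ℓ * T ^ 2 := by
  have h := geom_mean_le_arith_mean2_weighted (w₁ := 1 - r) (w₂ := r) (p₁ := S ^ 2) (p₂ := ℓ * T ^ 2)
    (by linarith) hr0.le (sq_nonneg S) (by positivity) (by ring)
  refine le_trans (le_of_eq ?_) (h.trans (le_of_eq (by ring)))
  rw [mul_rpow hℓ (sq_nonneg T), ← rpow_natCast S 2, ← rpow_natCast T 2, ← rpow_mul hS, ← rpow_mul hT]
  have e1 : ((2:ℕ):ℝ) * (1 - r) = 2 - 2 * r := by push_cast; ring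
  have e2 : ((2:ℕ):ℝ) * r = 2 * r := by push_cast; ring
  rw [e1, e2]; ring

/-- the `u`-side of the energy estimates -/
theorem u_side {a : EReal} {f : ℝ → ℝ} (hf : HypH a f) {t0 τ1 τ2 α : ℝ} (h0 : t0 ∈ Jp a)
    (hα : 1 < α) (hτ20 : 0 < τ2) (hτ2 : τ2 < 2)
    (h : ∀ t ∈ Jp a, t0 ≤ t →
      τ1 * (deriv f t) ^ 2 ≤ f t * deriv (deriv f) t ∧
      f t * deriv (deriv f) t ≤ τ2 * (deriv f t) ^ 2) :
    ∃ (Γ Θ : ℝ → ℝ) (b0 c : ℝ), ContDiffOn ℝ (⊤ : ℕ∞) Γ (Jn a) ∧ (∀ t ≤ t0, Γ t = 0) ∧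
      (∀ t ≤ t0, Θ t = 0) ∧ (∀ t ∈ Jn a, HasDerivAt Θ ((deriv Γ t) ^ 2) t) ∧
      (∀ t ∈ Jp a, 0 ≤ Γ t) ∧ (∀ t ∈ Jp a, 0 ≤ Θ t) ∧ 0 ≤ b0 ∧ 0 < c ∧
      (∀ t ∈ Jp a, f t ≤ √(deriv f t) * Γ t ^ (1 / α) + b0) ∧
      (∀ t ∈ Jp a, Θ t ≤ α ^ 2 * (1 - τ1 / 2) ^ 2 / (1 + (α - 1) * (2 - τ2)) *
        (√(deriv f t) * Γ t ^ (2 - 1 / α)) + b0) ∧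
      (∀ ε > 0, ∃ D, 0 ≤ D ∧ ∀ t ∈ Jp a, f t ≤ ε * (√(deriv f t) * Γ t ^ 2) + D ∧
        Θ t ≤ ε * (√(deriv f t) * Γ t ^ 2) + D) ∧
      (∀ t ∈ Jp a, c * f t ^ (α * (2 - τ2) + τ2 / 2) ≤ √(deriv f t) * Γ t ^ 2 + b0) := by
  obtain ⟨C, hC, hC1⟩ := f1_le hf h0 hτ20 (fun t ht h1 => (h t ht h1).2)
  obtain ⟨hgr, c, hc, hcp⟩ := f_growth hf hC hτ2 hα hC1
  obtain ⟨t1, ht1, Γ, Θ, C0, g1, g2, g3, g4, g5, g6, g7, g8, g9, g10⟩ := f_energy hf h0 hα hτ2 h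
  obtain ⟨K, hK⟩ : ∃ K, K = α ^ 2 * (1 - τ1 / 2) ^ 2 / (1 + (α - 1) * (2 - τ2)) := ⟨_, rfl⟩
  rw [← hK] at g9 ⊢
  have hK0 : 0 ≤ K := by
    rw [hK]; exact div_nonneg (by positivity) (by nlinarith)
  have hα0 : 0 < α := by linarith
  have hft1 := f_pos hf ht1
  obtain ⟨p, hp⟩ : ∃ p, p = α * (2 - τ2) + τ2 / 2 := ⟨_, rfl⟩
  rw [← hp] at hcp ⊢
  have hp0 : 0 < p := by rw [hp]; nlinarith
  have sm : ∀ t ∈ Jp a, t ≤ t1 → f t ≤ f t1 := fun t ht h1 => (f_mono hf).monotoneOn ht ht1 h1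
  have jn : ∀ t ∈ Jp a, t ∈ Jn a := fun t ht => ht.2
  have e1 : ∀ t ∈ Jp a, t1 ≤ t → Γ t ^ (1 / α) = qq f t := by
    intro t ht h1
    rw [g5 t h1, ← rpow_mul (qq_pos hf ht).le, mul_one_div, div_self hα0.ne', rpow_one]
  have e2 : ∀ t ∈ Jp a, t1 ≤ t → Γ t ^ 2 = qq f t ^ (2 * α) := by
    intro t ht h1
    rw [g5 t h1, ← rpow_natCast, ← rpow_mul (qq_pos hf ht).le]; congr 1; push_cast; ring
  have e3 : ∀ t ∈ Jp a, t1 ≤ t → √(deriv f t) * Γ t ^ (2 - 1 / α) = f t * qq f t ^ (2 * α - 2) := by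
    intro t ht h1
    have hq := qq_pos hf ht
    rw [g5 t h1, ← rpow_mul hq.le, ← qq_mul hf ht, mul_assoc]
    congr 1
    nth_rewrite 2 [← rpow_one (qq f t)]
    rw [← rpow_add hq]; congr 1; field_simp; ring
  have nn : ∀ t ∈ Jp a, ∀ q : ℝ, 0 ≤ √(deriv f t) * Γ t ^ q := fun t ht q =>
    mul_nonneg (sqrt_nonneg _) (rpow_nonneg (g6 t (jn t ht)) _)
  refine ⟨Γ, Θ, max (max (f t1) C0) (c * f t1 ^ p), c, g1, g2, g3, g4, fun t ht => g6 t ht.2,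
    fun t ht => g10 t ht.2, by positivity, hc, ?_, ?_, ?_, ?_⟩
  · intro t ht
    rcases le_total t t1 with h1 | h1
    · have := nn t ht (1 / α)
      have := sm t ht h1
      have : f t1 ≤ max (max (f t1) C0) (c * f t1 ^ p) := (le_max_left _ _).trans (le_max_left _ _)
      linarith
    · rw [e1 t ht h1, qq_mul hf ht]
      have : 0 ≤ max (max (f t1) C0) (c * f t1 ^ p) := by positivity
      linarith
  · intro t ht
    have hm : C0 ≤ max (max (f t1) C0) (c * f t1 ^ p) := (le_max_right _ _).trans (le_max_left _ _)
    rcases le_total t t1 with h1 | h1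
    · have := mul_nonneg hK0 (nn t ht (2 - 1 / α))
      have := g8 t ht.2 h1
      linarith
    · rw [e3 t ht h1]
      have := g9 t ht.2 h1
      linarith
  · intro ε hε
    obtain ⟨D, hD, hDb⟩ := hgr (ε / (K + 1)) (by positivity)
    have hle : ε / (K + 1) ≤ ε := div_le_self hε.le (by linarith)
    refine ⟨f t1 + C0 + D + K * D, by positivity, fun t ht => ?_⟩
    have hKD : 0 ≤ K * D := by positivity
    rcases le_total t t1 with h1 | h1
    · have h2 : 0 ≤ ε * (√(deriv f t) * Γ t ^ 2) := by positivity
      have h3 := sm t ht h1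
      have h4 := g8 t ht.2 h1
      constructor <;> linarith
    · rw [e2 t ht h1]
      have hq := qq_pos hf ht
      obtain ⟨d1, d2⟩ := hDb t ht
      have h5 : 0 ≤ √(deriv f t) * qq f t ^ (2 * α) := by positivity
      have h6 := mul_le_mul_of_nonneg_right hle h5
      have h7 := g9 t ht.2 h1
      have h8 := mul_le_mul_of_nonneg_left d2 hK0
      have h9 : K * (ε / (K + 1) * (√(deriv f t) * qq f t ^ (2 * α))) ≤
          ε * (√(deriv f t) * qq f t ^ (2 * α)) := by
        rw [← mul_assoc]
        refine mul_le_mul_of_nonneg_right ?_ h5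
        rw [mul_div_assoc', div_le_iff₀ (by positivity)]; nlinarith
      constructor
      · linarith
      · nlinarith
  · intro t ht
    have hm : c * f t1 ^ p ≤ max (max (f t1) C0) (c * f t1 ^ p) := le_max_right _ _
    rcases le_total t t1 with h1 | h1
    · have h2 : 0 ≤ √(deriv f t) * Γ t ^ 2 := by positivity
      have h3 := mul_le_mul_of_nonneg_left (rpow_le_rpow (f_pos hf ht).le (sm t ht h1) hp0.le) hc.le
      linarith
    · rw [e2 t ht h1]
      have := hcp t ht
      have : 0 ≤ max (max (f t1) C0) (c * f t1 ^ p) := by positivity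
      linarith

/-- the `V`-side of the energy estimates -/
theorem V_side {α : ℝ} (hα : 1 < α) :
    ∃ (Γ Θ : ℝ → ℝ) (b0 : ℝ), ContDiffOn ℝ (⊤ : ℕ∞) Γ univ ∧ (∀ t ≤ 1, Γ t = 0) ∧
      (∀ t ≤ 1, Θ t = 0) ∧ (∀ t ∈ (univ : Set ℝ), HasDerivAt Θ ((deriv Γ t) ^ 2) t) ∧
      (∀ t, 0 ≤ Γ t) ∧ (∀ t, 0 ≤ Θ t) ∧ 0 ≤ b0 ∧
      (∀ t, t ≤ 1 * Γ t ^ (1 / α) + b0) ∧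
      (∀ t, Θ t ≤ α ^ 2 / (2 * α - 1) * Γ t ^ (2 - 1 / α) + b0) := by
  have hα0 : 0 < α := by linarith
  have h2α : 0 < 2 * α - 1 := by linarith
  have hB : ∀ t ∈ (univ : Set ℝ), 2 ≤ t → HasDerivAt (fun t : ℝ => α ^ 2 / (2 * α - 1) * t ^ (2 * α - 1))
      (α ^ 2 * t ^ (2 * α - 2)) t ∧ (deriv (fun t : ℝ => t ^ α) t) ^ 2 ≤ α ^ 2 * t ^ (2 * α - 2) := by
    intro t _ ht
    have ht0 : 0 < t := by linarith
    have hd : HasDerivAt (fun t : ℝ => t ^ α) (α * t ^ (α - 1)) t :=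
      hasDerivAt_rpow_const (Or.inl ht0.ne')
    have hd2 : HasDerivAt (fun t : ℝ => t ^ (2 * α - 1)) ((2 * α - 1) * t ^ (2 * α - 1 - 1)) t :=
      hasDerivAt_rpow_const (Or.inl ht0.ne')
    constructor
    · have := hd2.const_mul (α ^ 2 / (2 * α - 1))
      have e : α ^ 2 / (2 * α - 1) * ((2 * α - 1) * t ^ (2 * α - 1 - 1)) =
          α ^ 2 * t ^ (2 * α - 2) := by
        rw [show 2 * α - 1 - 1 = 2 * α - 2 by ring, ← mul_assoc, div_mul_cancel₀ _ h2α.ne']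
      rw [e] at this; exact this
    · rw [hd.deriv, mul_pow, ← rpow_natCast (t ^ (α - 1)), ← rpow_mul ht0.le]
      apply le_of_eq; congr 2; push_cast; ring
  obtain ⟨Γ, Θ, C0, g1, g2, g3, g4, g5, g6, g7, g8, g9, g10⟩ :=
    trunc (J := univ) isOpen_univ ordConnected_univ (t0 := 1) (t1 := 2) one_pos one_lt_two
      (mem_univ _) (mem_univ _) (g := fun t => t ^ α)
      (B := fun t => α ^ 2 / (2 * α - 1) * t ^ (2 * α - 1)) (B1 := fun t => α ^ 2 * t ^ (2 * α - 2))
      (fun t ht => (contDiffAt_rpow_const_of_ne (ne_of_gt ht.2)).contDiffWithinAt)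
      (fun t _ ht => rpow_nonneg ht.le _) hB (by positivity)
  refine ⟨Γ, Θ, max C0 2, g1, g2, g3, g4, fun t => g6 t (mem_univ _), fun t => g10 t (mem_univ _),
    by positivity, fun t => ?_, fun t => ?_⟩
  · have := rpow_nonneg (g6 t (mem_univ _)) (1 / α)
    rcases le_total t 2 with h | h
    · have := le_max_right C0 2
      linarith
    · rw [g5 t h, ← rpow_mul (by linarith), mul_one_div, div_self hα0.ne', rpow_one]
      have : (0:ℝ) ≤ max C0 2 := by positivity
      linarith
  · have h1 := rpow_nonneg (g6 t (mem_univ _)) (2 - 1 / α)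
    have h2 := le_max_left C0 2
    rcases le_total t 2 with h | h
    · have := g8 t (mem_univ _) h
      have : 0 ≤ α ^ 2 / (2 * α - 1) * Γ t ^ (2 - 1 / α) := by positivity
      linarith
    · rw [g5 t h, ← rpow_mul (by linarith)]
      have e : α * (2 - 1 / α) = 2 * α - 1 := by field_simp
      rw [e]
      have := g9 t (mem_univ _) h
      linarith

theorem xy_bound {r ℓ k : ℝ} (hr : 0 < r) (hℓ : 0 ≤ ℓ) (hk : 0 ≤ k) (hlk : ℓ * k < 1) :
    ∃ ε > 0, ∀ C, 0 ≤ C → ∃ M, ∀ X Y : ℝ, 0 ≤ X → 0 ≤ Y →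
      X ≤ (1 - r) * X + r * ℓ * Y + ε * (X + Y) + C →
      Y ≤ (1 - r) * Y + r * k * X + ε * (X + Y) + C → Y ≤ M := by
  have hcont : Continuous (fun ε : ℝ => (r - ε) ^ 2 - (r * k + ε) * (r * ℓ + ε)) := by fun_prop
  have h0 : 0 < (r - 0) ^ 2 - (r * k + 0) * (r * ℓ + 0) := by
    have : 0 < r ^ 2 * (1 - ℓ * k) := by
      have : 0 < 1 - ℓ * k := by linarith
      positivity
    nlinarith
  have ev : ∀ᶠ ε in 𝓝[>] (0:ℝ), 0 < (r - ε) ^ 2 - (r * k + ε) * (r * ℓ + ε) ∧ ε < r := by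
    refine nhdsWithin_le_nhds ?_
    exact (hcont.continuousAt.eventually (lt_mem_nhds h0)).and (gt_mem_nhds hr)
  obtain ⟨ε, ⟨h1, h2⟩, hε⟩ := (ev.and self_mem_nhdsWithin).exists
  have hε : 0 < ε := hε
  refine ⟨ε, hε, fun C hC => ⟨((r * k + ε) * C + (r - ε) * C) /
    ((r - ε) ^ 2 - (r * k + ε) * (r * ℓ + ε)), fun X Y hX hY hx hy => ?_⟩⟩
  rw [le_div_iff₀ h1]
  have a1 : (r - ε) * X ≤ (r * ℓ + ε) * Y + C := by linarith
  have a2 : (r - ε) * Y ≤ (r * k + ε) * X + C := by linarith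
  have a3 := mul_le_mul_of_nonneg_left a1 (show 0 ≤ r * k + ε by positivity)
  have a4 := mul_le_mul_of_nonneg_left a2 (show 0 ≤ r - ε by linarith)
  nlinarith

/-- bounded continuous on `Ω` -/
def BC {n : ℕ} (Ω : Set (Eu n)) (g : Eu n → ℝ) : Prop :=
  ContinuousOn g Ω ∧ ∃ M, ∀ x ∈ Ω, |g x| ≤ M

theorem BC.mul {n : ℕ} {Ω : Set (Eu n)} {g h : Eu n → ℝ} (hg : BC Ω g) (hh : BC Ω h) :
    BC Ω (fun x => g x * h x) := by
  obtain ⟨g1, M, g2⟩ := hg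
  obtain ⟨h1, N, h2⟩ := hh
  refine ⟨g1.mul h1, M * N, fun x hx => ?_⟩
  rw [abs_mul]
  exact mul_le_mul (g2 x hx) (h2 x hx) (abs_nonneg _) ((abs_nonneg _).trans (g2 x hx))

theorem BC.add {n : ℕ} {Ω : Set (Eu n)} {g h : Eu n → ℝ} (hg : BC Ω g) (hh : BC Ω h) :
    BC Ω (fun x => g x + h x) := by
  obtain ⟨g1, M, g2⟩ := hg
  obtain ⟨h1, N, h2⟩ := hh
  exact ⟨g1.add h1, M + N, fun x hx => (abs_add_le _ _).trans (add_le_add (g2 x hx) (h2 x hx))⟩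

theorem BC.const {n : ℕ} {Ω : Set (Eu n)} (c : ℝ) : BC Ω (fun _ => c) :=
  ⟨continuousOn_const, |c|, fun _ _ => le_rfl⟩

theorem BC.sq {n : ℕ} {Ω : Set (Eu n)} {g : Eu n → ℝ} (hg : BC Ω g) : BC Ω (fun x => g x ^ 2) := by
  have h : (fun x => g x ^ 2) = fun x => g x * g x := funext fun x => pow_two _
  rw [h]; exact hg.mul hg

theorem BC.int {n : ℕ} {Ω : Set (Eu n)} {g : Eu n → ℝ} (hg : BC Ω g) (hO : IsOpen Ω)
    (hb : Bornology.IsBounded Ω) : IntegrableOn g Ω := by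
  obtain ⟨g1, M, g2⟩ := hg
  exact bdd_int hO hb g1 g2

theorem BC.comp {n : ℕ} {Ω : Set (Eu n)} {z : Eu n → ℝ} {h : ℝ → ℝ} {c : ℝ} (hz : Continuous z)
    (hzc : ∀ x ∈ Ω, z x ∈ Icc 0 c) (hh : ContinuousOn h (Icc 0 c)) : BC Ω (fun x => h (z x)) := by
  refine ⟨hh.comp hz.continuousOn hzc, ?_⟩
  obtain ⟨M, hM⟩ := isCompact_Icc.exists_bound_of_continuousOn hh
  exact ⟨M, fun x hx => hM _ (hzc x hx)⟩

theorem BC.rpow {n : ℕ} {Ω : Set (Eu n)} {g : Eu n → ℝ} {p : ℝ} (hg : BC Ω g)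
    (hp : 0 ≤ p) (h0 : ∀ x ∈ Ω, 0 < g x) : BC Ω (fun x => g x ^ p) := by
  obtain ⟨g1, M, g2⟩ := hg
  refine ⟨g1.rpow_const fun x hx => Or.inl (h0 x hx).ne', M ^ p, fun x hx => ?_⟩
  rw [abs_of_nonneg (rpow_nonneg (h0 x hx).le _)]
  exact rpow_le_rpow (h0 x hx).le ((le_abs_self _).trans (g2 x hx)) hp

section
variable {n : ℕ} {Ω : Set (Eu n)} {a : EReal} {f : ℝ → ℝ} {lam : ℝ} {u V : Eu n → ℝ}

theorem SolF.bcf (S : SolF Ω a f lam u V) (hf : HypH a f) : BC Ω (fun x => f (u x)) := by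
  obtain ⟨M, hM⟩ := S.fb hf
  refine ⟨S.mc (hf.smooth.continuousOn.mono (Jp_sub a)), M, fun x hx => ?_⟩
  rw [abs_of_pos (f_pos hf (S.uJ x hx))]; exact hM x hx

theorem SolF.bcf1 (S : SolF Ω a f lam u V) (hf : HypH a f) : BC Ω (fun x => deriv f (u x)) := by
  obtain ⟨M, hM⟩ := S.f1b hf
  refine ⟨S.mc (f1_smooth hf).continuousOn, M, fun x hx => ?_⟩
  rw [abs_of_pos (f1_pos hf (S.uJ x hx))]; exact hM x hx

theorem SolF.bcs (S : SolF Ω a f lam u V) (hf : HypH a f) : BC Ω (fun x => √(deriv f (u x))) := by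
  obtain ⟨M, hM⟩ := S.f1b hf
  refine ⟨S.mc (sf1_cont hf), √M, fun x hx => ?_⟩
  rw [abs_of_nonneg (sqrt_nonneg _)]; exact sqrt_le_sqrt (hM x hx)

theorem SolF.bcu (S : SolF Ω a f lam u V) {g : ℝ → ℝ} (hg : ContinuousOn g (Jn a)) :
    BC Ω (fun x => g (u x)) := by
  obtain ⟨c, hc, h⟩ := S.ub
  exact BC.comp S.hu.continuous (fun x hx => ⟨(S.uJ x hx).1.le, h x hx⟩)
    (hg.mono fun t ht => Jn_lower hc.2 ht.2)

theorem SolF.bcV (S : SolF Ω a f lam u V) {g : ℝ → ℝ} (hg : ContinuousOn g univ) :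
    BC Ω (fun x => g (V x)) := by
  obtain ⟨c, h⟩ := S.Vb
  exact BC.comp S.hV.continuous (fun x hx => ⟨(S.Vp x hx).le, h x hx⟩)
    (hg.mono (subset_univ _))
end

theorem comb_stab {n : ℕ} (hn : 0 < n) {Ω : Set (Eu n)} (hΩ : GoodDomain Ω) {a : EReal} {f : ℝ → ℝ}
    (hf : HypH a f) {s : ℝ} (hs0 : 0 < s) (hs1 : s < 1) : ∃ σ > 0, ∀ lam u V, SolF Ω a f lam u V →
      ∀ φ : Eu n → ℝ, ContDiff ℝ (⊤ : ℕ∞) φ → HasCompactSupport φ → tsupport φ ⊆ Ω →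
      √lam * ∫ x in Ω, ((1 - s) * √(deriv f (u x)) + σ) * φ x ^ 2 ≤ ∫ x in Ω, ‖gradient φ x‖ ^ 2 := by
  obtain ⟨Λ, hΛ, hlb⟩ := lam_bound hn hΩ hf
  obtain ⟨hO, hb, hne⟩ := hΩ
  obtain ⟨cP, hcP, hP⟩ := poincare hn hO hb
  have hsΛ : 0 < √Λ := sqrt_pos.2 hΛ
  refine ⟨s * cP / √Λ, by positivity, fun lam u V S φ hφ hc hts => ?_⟩
  have h1 := S.st φ hφ hc hts
  have h2 := hP φ hφ hc hts
  have hφb : BC Ω φ := by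
    obtain ⟨M, hM⟩ := hc.exists_bound_of_continuous hφ.continuous
    exact ⟨hφ.continuous.continuousOn, M, fun x _ => hM x⟩
  have i1 := ((S.bcs hf).mul hφb.sq).int hO hb
  have i2 := hφb.sq.int hO hb
  have e : ∫ x in Ω, ((1 - s) * √(deriv f (u x)) + s * cP / √Λ) * φ x ^ 2 =
      (1 - s) * (∫ x in Ω, √(deriv f (u x)) * φ x ^ 2) + s * cP / √Λ * ∫ x in Ω, φ x ^ 2 := by
    rw [← integral_const_mul, ← integral_const_mul, ← integral_add (i1.const_mul _) (i2.const_mul _)]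
    refine integral_congr_ae (ae_of_all _ fun x => ?_)
    simp only; ring
  rw [e]
  obtain ⟨I, hI⟩ : ∃ I, I = ∫ x in Ω, √(deriv f (u x)) * φ x ^ 2 := ⟨_, rfl⟩
  obtain ⟨P, hPe⟩ : ∃ P, P = ∫ x in Ω, φ x ^ 2 := ⟨_, rfl⟩
  have hP0 : 0 ≤ P := by rw [hPe]; exact integral_nonneg fun x => by positivity
  rw [← hI] at h1 ⊢
  rw [← hPe] at h2 ⊢
  have h3 : √lam * (s * cP / √Λ) ≤ s * cP := by
    rw [mul_div_assoc', div_le_iff₀ hsΛ, mul_comm]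
    exact mul_le_mul_of_nonneg_left (sqrt_le_sqrt (hlb lam u V S)) (by positivity)
  have h4 := mul_le_mul_of_nonneg_right h3 hP0
  have h5 := mul_le_mul_of_nonneg_left h1 (show 0 ≤ 1 - s by linarith)
  have h6 := mul_le_mul_of_nonneg_left h2 hs0.le
  nlinarith

theorem int_le3 {n : ℕ} {Ω : Set (Eu n)} (hO : IsOpen Ω) (hb : Bornology.IsBounded Ω)
    {g p q : Eu n → ℝ} {c1 c2 C : ℝ} (hg : BC Ω g) (hp : BC Ω p) (hq : BC Ω q)
    (h : ∀ x ∈ Ω, g x ≤ c1 * p x + c2 * q x + C) :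
    ∫ x in Ω, g x ≤ c1 * (∫ x in Ω, p x) + c2 * (∫ x in Ω, q x) + C * volume.real Ω := by
  have ip := hp.int hO hb
  have iq := hq.int hO hb
  have ic := (BC.const (Ω := Ω) C).int hO hb
  have i12 : IntegrableOn (fun x => c1 * p x + c2 * q x) Ω := (ip.const_mul _).add (iq.const_mul _)
  have e : ∫ x in Ω, (c1 * p x + c2 * q x + C) =
      c1 * (∫ x in Ω, p x) + c2 * (∫ x in Ω, q x) + C * volume.real Ω := by
    rw [integral_add i12 ic,
      integral_add (ip.const_mul _) (iq.const_mul _), integral_const_mul, integral_const_mul,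
      setIntegral_const, smul_eq_mul, mul_comm C]
  rw [← e]
  exact setIntegral_mono_on (hg.int hO hb) (i12.add ic)
    hO.measurableSet h

set_option maxHeartbeats 2000000 in
theorem energy {n : ℕ} (hn : 0 < n) {Ω : Set (Eu n)} (hΩ : GoodDomain Ω) {a : EReal} {f : ℝ → ℝ}
    (hf : HypH a f) {t0 τ1 τ2 α s : ℝ} (h0 : t0 ∈ Jp a)
    (hα : 1 < α) (hτ20 : 0 < τ2) (hτ2 : τ2 < 2) (hs0 : 0 < s) (hs1 : s < 1)
    (h : ∀ t ∈ Jp a, t0 ≤ t →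
      τ1 * (deriv f t) ^ 2 ≤ f t * deriv (deriv f) t ∧
      f t * deriv (deriv f) t ≤ τ2 * (deriv f t) ^ 2)
    (hKL : α ^ 2 * (1 - τ1 / 2) ^ 2 / (1 + (α - 1) * (2 - τ2)) * (α ^ 2 / (2 * α - 1)) < (1 - s) ^ 2) :
    ∃ C, ∀ lam u V, SolF Ω a f lam u V →
      ∫ x in Ω, f (u x) ^ (α * (2 - τ2) + τ2 / 2) ≤ C := by
  obtain ⟨σ, hσ, hst⟩ := comb_stab hn hΩ hf hs0 hs1
  obtain ⟨hO, hb, hne⟩ := hΩ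
  obtain ⟨Γ, Θ, b0, c, g1, g2, g3, g4, g5, g6, g7, g8, g9, g10, g11, g12⟩ :=
    u_side hf h0 hα hτ20 hτ2 h
  obtain ⟨ζ, Z, b0', k1, k2, k3, k4, k5, k6, k7, k8, k9⟩ := V_side hα
  obtain ⟨K, hK⟩ : ∃ K, K = α ^ 2 * (1 - τ1 / 2) ^ 2 / (1 + (α - 1) * (2 - τ2)) := ⟨_, rfl⟩
  obtain ⟨L, hL⟩ : ∃ L, L = α ^ 2 / (2 * α - 1) := ⟨_, rfl⟩
  obtain ⟨p, hp⟩ : ∃ p, p = α * (2 - τ2) + τ2 / 2 := ⟨_, rfl⟩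
  obtain ⟨r, hr⟩ : ∃ r, r = 1 / (2 * α) := ⟨_, rfl⟩
  rw [← hK] at g10 hKL
  rw [← hL] at k9 hKL
  rw [← hp] at g12 ⊢
  have hp0 : 0 < p := by rw [hp]; nlinarith
  have hK0 : 0 ≤ K := by
    rw [hK]; exact div_nonneg (by positivity) (by nlinarith)
  have hL0 : 0 ≤ L := by
    rw [hL]; exact div_nonneg (by positivity) (by linarith)
  have hα0 : 0 < α := by linarith
  have hr0 : 0 < r := by rw [hr]; positivity
  have hr1 : r < 1 := by rw [hr, div_lt_one (by positivity)]; linarith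
  have h2r : 1 / α = 2 * r := by rw [hr]; field_simp
  rw [h2r] at g9 g10 k8 k9
  have hs' : 0 < 1 - s := by linarith
  obtain ⟨ℓ, hℓ⟩ : ∃ ℓ, ℓ = (L * (1 / (1 - s))) ^ (1 / r) := ⟨_, rfl⟩
  obtain ⟨k, hk⟩ : ∃ k, k = (1 * (K / (1 - s))) ^ (1 / r) := ⟨_, rfl⟩
  have hℓ0 : 0 ≤ ℓ := by rw [hℓ]; positivity
  have hk0 : 0 ≤ k := by rw [hk]; positivity
  have hℓr : ℓ ^ r = L * (1 / (1 - s)) := by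
    rw [hℓ, ← rpow_mul (by positivity), one_div_mul_cancel hr0.ne', rpow_one]
  have hkr : k ^ r = 1 * (K / (1 - s)) := by
    rw [hk, ← rpow_mul (by positivity), one_div_mul_cancel hr0.ne', rpow_one]
  have hlk : ℓ * k < 1 := by
    rw [hℓ, hk, ← mul_rpow (by positivity) (by positivity)]
    refine rpow_lt_one (by positivity) ?_ (by positivity)
    have : L * (1 / (1 - s)) * (1 * (K / (1 - s))) = K * L / (1 - s) ^ 2 := by field_simp
    rw [this, div_lt_one (by positivity)]; exact hKL
  obtain ⟨ε, hε, hXY⟩ := xy_bound hr0 hℓ0 hk0 hlk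
  -- constants
  obtain ⟨D, hD0, hD⟩ := g11 (ε / (b0' + 1) * (1 - s)) (by positivity)
  obtain ⟨C1, hC10, hC1⟩ := pw (a1 := L) (a0 := b0') (b1 := 1 / (1 - s)) (b0 := b0) (p := 2 - 2 * r)
    (σ := σ) (ε := ε) (D1 := D) hL0 k7 g7 (by linarith) (by linarith) hσ hε hD0
  obtain ⟨C2, hC20, hC2⟩ := pw (a1 := 1) (a0 := b0') (b1 := K / (1 - s)) (b0 := b0) (p := 2 * r)
    (σ := σ) (ε := ε) (D1 := D) zero_le_one k7 g7 (by linarith) (by linarith) hσ hε hD0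
  obtain ⟨M, hM⟩ := hXY (max C1 C2 * volume.real Ω) (by positivity)
  refine ⟨(c * (1 - s))⁻¹ * (M + (1 - s) * b0 * volume.real Ω), fun lam u V S => ?_⟩
  have hsl : 0 < √lam := sqrt_pos.2 S.lpos
  obtain ⟨ω, hω⟩ : ∃ ω : Eu n → ℝ, ω = fun x => (1 - s) * √(deriv f (u x)) + σ := ⟨_, rfl⟩
  have bω : BC Ω ω := by
    rw [hω]; exact ((BC.const _).mul (S.bcs hf)).add (BC.const _)
  have bS : BC Ω (fun x => ζ (V x)) := S.bcV k1.continuousOn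
  have bT : BC Ω (fun x => Γ (u x)) := S.bcu g1.continuousOn
  have bZ : BC Ω (fun x => Z (V x)) := S.bcV fun t ht => (k4 t ht).continuousAt.continuousWithinAt
  have bΘ : BC Ω (fun x => Θ (u x)) := S.bcu fun t ht => (g4 t ht).continuousAt.continuousWithinAt
  have bV : BC Ω V := S.bcV (g := id) continuousOn_id
  have bf := S.bcf hf
  have hst' := hst lam u V S
  have hst2 : ∀ φ : Eu n → ℝ, ContDiff ℝ (⊤ : ℕ∞) φ → HasCompactSupport φ → tsupport φ ⊆ Ω →
      √lam * ∫ x in Ω, ω x * φ x ^ 2 ≤ ∫ x in Ω, ‖gradient φ x‖ ^ 2 := by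
    rw [hω]; exact hst'
  have E1 := stab_energy isOpen_univ hO hb S.hV S.V0 (fun x _ => mem_univ _) one_pos k2 k3 k1 k4 hst2
  have E2 := stab_energy (Jn_open a) hO hb S.hu S.u0 (fun x hx => (S.uJ x hx).2) h0.1 g2 g3 g1 g4 hst2
  have E1' : ∫ x in Ω, ω x * ζ (V x) ^ 2 ≤ ∫ x in Ω, Z (V x) * f (u x) := by
    have e : ∫ x in Ω, Z (V x) * (-lap V x) = √lam * ∫ x in Ω, Z (V x) * f (u x) := by
      rw [← integral_const_mul]
      refine setIntegral_congr_fun hO.measurableSet fun x hx => ?_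
      simp only [S.lV x hx]; ring
    rw [e] at E1
    exact le_of_mul_le_mul_left E1 hsl
  have E2' : ∫ x in Ω, ω x * Γ (u x) ^ 2 ≤ ∫ x in Ω, V x * Θ (u x) := by
    have e : ∫ x in Ω, Θ (u x) * (-lap u x) = √lam * ∫ x in Ω, V x * Θ (u x) := by
      rw [← integral_const_mul]
      refine setIntegral_congr_fun hO.measurableSet fun x hx => ?_
      simp only [S.lu x hx]; ring
    rw [e] at E2
    exact le_of_mul_le_mul_left E2 hsl
  have hωσ : ∀ x ∈ Ω, σ ≤ ω x := by
    intro x hx; rw [hω]; simp only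
    have := sqrt_nonneg (deriv f (u x))
    nlinarith
  have hωs : ∀ x ∈ Ω, √(deriv f (u x)) ≤ 1 / (1 - s) * ω x := by
    intro x hx; rw [hω]; simp only
    rw [one_div, ← div_eq_inv_mul, le_div_iff₀ hs']; linarith
  have I1 := int_le3 hO hb (c1 := 1 - r + ε) (c2 := r * ℓ + ε) (C := C1) (bZ.mul bf)
    (bω.mul bS.sq) (bω.mul bT.sq) (fun x hx => by
      have hx' := S.uJ x hx
      have w := hωs x hx
      have w0 := hσ.trans_le (hωσ x hx)
      have hT := g5 _ hx'
      have hS := k5 (V x)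
      have e22 : (2:ℝ) - (2 - 2 * r) = 2 * r := by ring
      have := hC1 (ω x) (ζ (V x)) (Γ (u x)) (Z (V x)) (f (u x)) (hωσ x hx) hS hT
        (f_pos hf hx').le (k9 _) ?_ ?_
      · rw [e22] at this
        have y := mul_le_mul_of_nonneg_left (young2 hr0 hr1 hℓ0 hS hT) w0.le
        rw [hℓr] at y
        linarith
      · rw [e22]
        have := mul_le_mul_of_nonneg_right w (rpow_nonneg hT (2 * r))
        linarith [g9 _ hx']
      · have h1 := mul_le_mul_of_nonneg_right w (sq_nonneg (Γ (u x)))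
        have h2 := (hD _ hx').1
        have h3 := mul_le_mul_of_nonneg_left h1 (show 0 ≤ ε / (b0' + 1) * (1 - s) by positivity)
        have e : ε / (b0' + 1) * (1 - s) * (1 / (1 - s) * ω x * Γ (u x) ^ 2) =
          ε / (b0' + 1) * (ω x * Γ (u x) ^ 2) := by field_simp
        linarith)
  have I2 := int_le3 hO hb (c1 := r * k + ε) (c2 := 1 - r + ε) (C := C2) (bV.mul bΘ)
    (bω.mul bS.sq) (bω.mul bT.sq) (fun x hx => by
      have hx' := S.uJ x hx
      have w := hωs x hx
      have w0 := hσ.trans_le (hωσ x hx)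
      have hT := g5 _ hx'
      have hS := k5 (V x)
      have := hC2 (ω x) (ζ (V x)) (Γ (u x)) (V x) (Θ (u x)) (hωσ x hx) hS hT
        (g6 _ hx') (k8 _) ?_ ?_
      · have y := mul_le_mul_of_nonneg_left (young2 hr0 hr1 hk0 hT hS) w0.le
        rw [hkr] at y
        linarith
      · have h1 := mul_le_mul_of_nonneg_right w (rpow_nonneg hT (2 - 2 * r))
        have h2 := mul_le_mul_of_nonneg_left h1 hK0
        have e : K * (1 / (1 - s) * ω x * Γ (u x) ^ (2 - 2 * r)) =
          K / (1 - s) * (ω x * Γ (u x) ^ (2 - 2 * r)) := by field_simp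
        linarith [g10 _ hx']
      · have h1 := mul_le_mul_of_nonneg_right w (sq_nonneg (Γ (u x)))
        have h2 := (hD _ hx').2
        have h3 := mul_le_mul_of_nonneg_left h1 (show 0 ≤ ε / (b0' + 1) * (1 - s) by positivity)
        have e : ε / (b0' + 1) * (1 - s) * (1 / (1 - s) * ω x * Γ (u x) ^ 2) =
          ε / (b0' + 1) * (ω x * Γ (u x) ^ 2) := by field_simp
        linarith)
  have bp : BC Ω (fun x => f (u x) ^ p) := bf.rpow hp0.le fun x hx => f_pos hf (S.uJ x hx)
  have I3 := int_le3 hO hb (c1 := (c * (1 - s))⁻¹) (c2 := 0) (C := (c * (1 - s))⁻¹ * ((1 - s) * b0)) bp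
    (bω.mul bT.sq) (BC.const 0) (fun x hx => by
      have hx' := S.uJ x hx
      have w := hωs x hx
      have h1 := mul_le_mul_of_nonneg_right w (sq_nonneg (Γ (u x)))
      have h2 := g12 _ hx'
      have h3 : c * (1 - s) * f (u x) ^ p ≤ ω x * Γ (u x) ^ 2 + (1 - s) * b0 := by
        have h4 : (1 - s) * (1 / (1 - s) * ω x * Γ (u x) ^ 2) = ω x * Γ (u x) ^ 2 := by field_simp
        have h5 := mul_le_mul_of_nonneg_left h1 hs'.le
        have h6 := mul_le_mul_of_nonneg_left h2 hs'.le
        linarith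
      have h4 := mul_le_mul_of_nonneg_left h3 (show 0 ≤ (c * (1 - s))⁻¹ by positivity)
      rw [← mul_assoc, inv_mul_cancel₀ (by positivity)] at h4
      linarith)
  obtain ⟨X, hX⟩ : ∃ X, X = ∫ x in Ω, ω x * ζ (V x) ^ 2 := ⟨_, rfl⟩
  obtain ⟨Y, hY⟩ : ∃ Y, Y = ∫ x in Ω, ω x * Γ (u x) ^ 2 := ⟨_, rfl⟩
  have hX0 : 0 ≤ X := by
    rw [hX]; exact setIntegral_nonneg hO.measurableSet fun x hx =>
      mul_nonneg (hσ.le.trans (hωσ x hx)) (sq_nonneg _)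
  have hY0 : 0 ≤ Y := by
    rw [hY]; exact setIntegral_nonneg hO.measurableSet fun x hx =>
      mul_nonneg (hσ.le.trans (hωσ x hx)) (sq_nonneg _)
  rw [← hX] at E1' I1 I2
  rw [← hY] at E2' I1 I2 I3
  have hv : 0 ≤ volume.real Ω := measureReal_nonneg
  have c1 := mul_le_mul_of_nonneg_right (le_max_left C1 C2) hv
  have c2 := mul_le_mul_of_nonneg_right (le_max_right C1 C2) hv
  have hYM : Y ≤ M := hM X Y hX0 hY0 (by linarith) (by linarith)
  have c3 := mul_le_mul_of_nonneg_left hYM (show 0 ≤ (c * (1 - s))⁻¹ by positivity)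
  linarith

theorem rep_gen {n : ℕ} {Ω : Set (Eu n)} (hO : IsOpen Ω) (hb : Bornology.IsBounded Ω) {s C : ℝ}
    (hR : ∀ (φ g : Eu n → ℝ), ContDiff ℝ 2 φ → HasCompactSupport φ → tsupport φ ⊆ Ω →
      ContinuousOn g Ω → (∃ M, ∀ x ∈ Ω, |g x| ≤ M) → (∀ x ∈ Ω, 0 ≤ g x) →
      (∀ x ∈ Ω, -lap φ x ≤ g x) → ∀ x ∈ Ω, φ x ≤ C * ∫ y in Ω, ‖x - y‖ ^ (-s) * g y)
    {z g : Eu n → ℝ} (hz : ContDiff ℝ 2 z) (hz0 : ∀ x ∈ frontier Ω, z x = 0) {J : Set ℝ}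
    (hJ : IsOpen J) (hzJ : ∀ x ∈ Ω, z x ∈ J) {ε : ℝ} (hε : 0 < ε) {h h1 h2 : ℝ → ℝ}
    (hh0 : ∀ t ≤ ε, h t = 0) (hhc : ∀ t ∈ J, ContDiffAt ℝ 2 h t)
    (hd1 : ∀ t ∈ J, HasDerivAt h (h1 t) t) (hd2 : ∀ t ∈ J, HasDerivAt h1 (h2 t) t)
    (hp : ∀ t ∈ J, 0 ≤ h2 t) (hg : BC Ω g) (hg0 : ∀ x ∈ Ω, 0 ≤ g x)
    (hl : ∀ x ∈ Ω, h1 (z x) * (-lap z x) ≤ g x) :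
    ∀ x ∈ Ω, h (z x) ≤ C * ∫ y in Ω, ‖x - y‖ ^ (-s) * g y := by
  have hc : ContDiff ℝ 2 (tr Ω h z) := tr_contDiff hO hb hz hz0 hε hh0 fun x hx => hhc _ (hzJ x hx)
  have := hR (tr Ω h z) g hc (tr_hasCompact hO hb hz.continuous hz0 hε hh0)
    (tr_subset hO hb hz.continuous hz0 hε hh0) hg.1 hg.2 hg0 ?_
  · intro x hx
    have h3 := this x hx
    rwa [(tr_eq hO hx).eq_of_nhds] at h3
  · intro x hx
    have hx' := hzJ x hx
    rw [lap_congr (tr_eq hO hx), lap_comp hz (hhc _ hx')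
      (by filter_upwards [hJ.mem_nhds hx'] with t ht using hd1 t ht) (hd2 _ hx')]
    have h3 := hl x hx
    have h4 := mul_nonneg (hp _ hx') (Finset.sum_nonneg fun i (_ : i ∈ Finset.univ) => sq_nonneg (pd i z x))
    linarith

theorem GG2_deriv (t : ℝ) : HasDerivAt smoothTransition (deriv smoothTransition t) t :=
  ((smoothTransition.contDiff (n := 1)).differentiable (by simp) t).hasDerivAt

theorem rep_id {n : ℕ} {Ω : Set (Eu n)} (hO : IsOpen Ω) (hb : Bornology.IsBounded Ω) {s C : ℝ}
    (hR : ∀ (φ g : Eu n → ℝ), ContDiff ℝ 2 φ → HasCompactSupport φ → tsupport φ ⊆ Ω →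
      ContinuousOn g Ω → (∃ M, ∀ x ∈ Ω, |g x| ≤ M) → (∀ x ∈ Ω, 0 ≤ g x) →
      (∀ x ∈ Ω, -lap φ x ≤ g x) → ∀ x ∈ Ω, φ x ≤ C * ∫ y in Ω, ‖x - y‖ ^ (-s) * g y)
    {z g : Eu n → ℝ} (hz : ContDiff ℝ 2 z) (hz0 : ∀ x ∈ frontier Ω, z x = 0)
    (hg : BC Ω g) (hg0 : ∀ x ∈ Ω, 0 ≤ g x)
    (hl : ∀ x ∈ Ω, -lap z x = g x) :
    ∀ x ∈ Ω, z x - 2 ≤ C * ∫ y in Ω, ‖x - y‖ ^ (-s) * g y := by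
  intro x hx
  have d0 : ∀ t : ℝ, HasDerivAt (fun t : ℝ => t - 1) 1 t := fun t => (hasDerivAt_id t).sub_const 1
  have := rep_gen hO hb hR hz hz0 isOpen_univ (fun x _ => mem_univ _) one_pos
    (h := fun t => GG (t - 1)) (h1 := fun t => smoothTransition (t - 1))
    (h2 := fun t => deriv smoothTransition (t - 1))
    (fun t ht => GG_zero (by linarith))
    (fun t _ => ((GG_contDiff.of_le two_le_tp).comp (contDiff_id.sub contDiff_const)).contDiffAt)
    (fun t _ => by
      have := HasDerivAt.comp (h₂ := GG) (h := fun t : ℝ => t - 1) t (GG_deriv (t - 1)) (d0 t)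
      rw [mul_one] at this; exact this)
    (fun t _ => by
      have := HasDerivAt.comp (h₂ := smoothTransition) (h := fun t : ℝ => t - 1) t
        (GG2_deriv (t - 1)) (d0 t)
      rw [mul_one] at this; exact this)
    (fun t _ => st_deriv_nonneg _) hg hg0
    (fun x hx => by
      rw [hl x hx]
      exact mul_le_of_le_one_left (hg0 x hx) (smoothTransition.le_one _)) x hx
  have h2 := GG_ge (z x - 1)
  linarith

theorem f_near {a : EReal} {f : ℝ → ℝ} (hf : HypH a f) : ∃ ε ∈ Jp a, f ε ≤ f 0 + 1 := by
  have hc := hf.smooth.continuousOn 0 (zero_mem hf)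
  have h1 : ∀ᶠ t in 𝓝[domf a] 0, f t < f 0 + 1 := hc.eventually (gt_mem_nhds (by linarith))
  obtain ⟨c, hc, -⟩ := ev_af hf.a_pos (P := fun _ => True) (by simp)
  have h2 : ∀ᶠ t in 𝓝[>] (0:ℝ), t < c := nhdsWithin_le_nhds (gt_mem_nhds hc.1)
  rw [eventually_nhdsWithin_iff] at h1
  have h3 : ∀ᶠ t in 𝓝[>] (0:ℝ), t ∈ domf a → f t < f 0 + 1 := nhdsWithin_le_nhds h1
  obtain ⟨t, ⟨ht1, ht2⟩, ht0⟩ := ((h3.and h2).and self_mem_nhdsWithin).exists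
  have : t ∈ Jp a := ⟨ht0, Jn_lower hc.2 ht2.le⟩
  exact ⟨t, this, (ht1 (Jp_sub a this)).le⟩

theorem rep_f {n : ℕ} {Ω : Set (Eu n)} (hO : IsOpen Ω) (hb : Bornology.IsBounded Ω) {s C : ℝ}
    (hR : ∀ (φ g : Eu n → ℝ), ContDiff ℝ 2 φ → HasCompactSupport φ → tsupport φ ⊆ Ω →
      ContinuousOn g Ω → (∃ M, ∀ x ∈ Ω, |g x| ≤ M) → (∀ x ∈ Ω, 0 ≤ g x) →
      (∀ x ∈ Ω, -lap φ x ≤ g x) → ∀ x ∈ Ω, φ x ≤ C * ∫ y in Ω, ‖x - y‖ ^ (-s) * g y)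
    {a : EReal} {f : ℝ → ℝ} (hf : HypH a f)
    {z g : Eu n → ℝ} (hz : ContDiff ℝ 2 z) (hz0 : ∀ x ∈ frontier Ω, z x = 0)
    (hzJ : ∀ x ∈ Ω, z x ∈ Jp a) (hg : BC Ω g) (hg0 : ∀ x ∈ Ω, 0 ≤ g x)
    (hl : ∀ x ∈ Ω, deriv f (z x) * (-lap z x) = g x) :
    ∀ x ∈ Ω, f (z x) - f 0 - 2 ≤ C * ∫ y in Ω, ‖x - y‖ ^ (-s) * g y := by
  intro x hx
  obtain ⟨ε, hε, hfε⟩ := f_near hf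
  obtain ⟨h, hh⟩ : ∃ h : ℝ → ℝ, h = fun t => if t ≤ 0 then 0 else GG (f t - f 0 - 1) := ⟨_, rfl⟩
  have d0 : ∀ t ∈ Jp a, HasDerivAt (fun t => f t - f 0 - 1) (deriv f t) t := fun t ht =>
    ((f_d hf ht).sub_const _).sub_const 1
  have heq : ∀ t ∈ Jp a, h =ᶠ[𝓝 t] fun t => GG (f t - f 0 - 1) := by
    intro t ht
    filter_upwards [lt_mem_nhds ht.1] with r hr
    rw [hh]; simp only [not_le.2 hr, if_false]
  have hz00 : ∀ t ≤ ε, h t = 0 := by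
    intro t ht
    rw [hh]; simp only
    split_ifs with h0
    · rfl
    · refine GG_zero ?_
      have ht' : t ∈ Jp a := ⟨not_le.1 h0, Jn_lower hε.2 ht⟩
      have := (f_mono hf).monotoneOn ht' hε ht
      linarith
  have := rep_gen hO hb hR hz hz0 (Jp_open a) hzJ hε.1 (h := h)
    (h1 := fun t => smoothTransition (f t - f 0 - 1) * deriv f t)
    (h2 := fun t => (deriv smoothTransition (f t - f 0 - 1) * deriv f t) * deriv f t +
      smoothTransition (f t - f 0 - 1) * deriv (deriv f) t)
    hz00
    (fun t ht => by
      have h1 : ContDiffAt ℝ 2 (fun t => f t - f 0 - 1) t :=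
        (((f_smooth hf ht).of_le two_le_tp).sub contDiffAt_const).sub contDiffAt_const
      have h2 : ContDiffAt ℝ 2 (fun t => GG (f t - f 0 - 1)) t :=
        (GG_contDiff.of_le two_le_tp).contDiffAt.comp t h1
      exact h2.congr_of_eventuallyEq (heq t ht))
    (fun t ht => by
      have := HasDerivAt.comp (h₂ := GG) (h := fun t : ℝ => f t - f 0 - 1) t (GG_deriv _) (d0 t ht)
      exact this.congr_of_eventuallyEq (heq t ht))
    (fun t ht => by
      have h1 := HasDerivAt.comp (h₂ := smoothTransition) (h := fun t : ℝ => f t - f 0 - 1) t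
        (GG2_deriv _) (d0 t ht)
      exact h1.mul (f_dd hf ht))
    (fun t ht => by
      have h1 := f1_pos hf ht
      have h2 := f2_nonneg hf ht
      have h3 := st_deriv_nonneg (f t - f 0 - 1)
      have h4 := smoothTransition.nonneg (f t - f 0 - 1)
      positivity) hg hg0
    (fun x hx => by
      rw [mul_assoc, hl x hx]
      exact mul_le_of_le_one_left (hg0 x hx) (smoothTransition.le_one _)) x hx
  rw [(heq _ (hzJ x hx)).eq_of_nhds] at this
  have h2 := GG_ge (f (z x) - f 0 - 1)
  linarith

theorem rep_app {n : ℕ} (hn : 0 < n) {Ω : Set (Eu n)} (hΩ : GoodDomain Ω) {a : EReal} {f : ℝ → ℝ}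
    (hf : HypH a f) {s : ℝ} (hs0 : 0 < s) (hs2 : (n:ℝ) - 2 ≤ s) (hsn : s < n) :
    ∃ C, 0 < C ∧ ∀ lam u V, SolF Ω a f lam u V → ∀ x ∈ Ω,
      u x ≤ 2 + C * (∫ y in Ω, ‖x - y‖ ^ (-s) * V y) ∧
      V x ≤ 2 + C * (∫ y in Ω, ‖x - y‖ ^ (-s) * f (u y)) ∧
      f (u x) ≤ f 0 + 2 + C * (∫ y in Ω, ‖x - y‖ ^ (-s) * (deriv f (u y) * V y)) := by
  obtain ⟨Λ, hΛ, hlb⟩ := lam_bound hn hΩ hf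
  obtain ⟨hO, hb, hne⟩ := hΩ
  obtain ⟨C, hC, hR⟩ := rep hn hO hb hs0 hs2 hsn
  have hsΛ : 0 < √Λ := sqrt_pos.2 hΛ
  refine ⟨C * √Λ, by positivity, fun lam u V S x hx => ?_⟩
  have hl : √lam ≤ √Λ := sqrt_le_sqrt (hlb lam u V S)
  have bV : BC Ω V := S.bcV (g := id) continuousOn_id
  have key : ∀ g : Eu n → ℝ, (∀ y ∈ Ω, 0 ≤ g y) →
      C * (∫ y in Ω, ‖x - y‖ ^ (-s) * (√lam * g y)) ≤ C * √Λ * ∫ y in Ω, ‖x - y‖ ^ (-s) * g y := by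
    intro g hg
    have e : ∫ y in Ω, ‖x - y‖ ^ (-s) * (√lam * g y) = √lam * ∫ y in Ω, ‖x - y‖ ^ (-s) * g y := by
      rw [← integral_const_mul]; congr 1; ext y; ring
    rw [e, mul_assoc]
    refine mul_le_mul_of_nonneg_left (mul_le_mul_of_nonneg_right hl ?_) hC.le
    exact setIntegral_nonneg hO.measurableSet fun y hy => mul_nonneg (by positivity) (hg y hy)
  have p1 : ∀ y ∈ Ω, 0 ≤ V y := fun y hy => (S.Vp y hy).le
  have p2 : ∀ y ∈ Ω, 0 ≤ f (u y) := fun y hy => (f_pos hf (S.uJ y hy)).le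
  have p3 : ∀ y ∈ Ω, 0 ≤ deriv f (u y) * V y := fun y hy =>
    mul_nonneg (f1_pos hf (S.uJ y hy)).le (p1 y hy)
  have r1 := rep_id hO hb hR (S.hu.of_le two_le_tp) S.u0 ((BC.const (√lam)).mul bV)
    (fun y hy => mul_nonneg (sqrt_nonneg _) (p1 y hy)) S.lu x hx
  have r2 := rep_id hO hb hR (S.hV.of_le two_le_tp) S.V0 ((BC.const (√lam)).mul (S.bcf hf))
    (fun y hy => mul_nonneg (sqrt_nonneg _) (p2 y hy)) S.lV x hx
  have r3 := rep_f hO hb hR hf (S.hu.of_le two_le_tp) S.u0 S.uJ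
    ((BC.const (√lam)).mul ((S.bcf1 hf).mul bV))
    (fun y hy => mul_nonneg (sqrt_nonneg _) (p3 y hy)) (fun y hy => by rw [S.lu y hy]; ring) x hx
  have k1 := key _ p1
  have k2 := key _ p2
  have k3 := key _ p3
  refine ⟨by linarith, by linarith, by linarith⟩

theorem lin_absorb {e δ : ℝ} (he0 : 0 < e) (he : e < 1) (hδ : 0 < δ) :
    ∃ D, 0 ≤ D ∧ ∀ M : ℝ, 0 ≤ M → M ^ e ≤ δ * M + D := by
  obtain ⟨D, hD, h⟩ := pow_absorb (p := 2 * e) (by linarith) (by linarith) hδ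
  refine ⟨D, hD, fun M hM => ?_⟩
  have := h (√M) (sqrt_nonneg _)
  rw [sq_sqrt hM, sqrt_eq_rpow, ← rpow_mul hM] at this
  have e : (1 / 2 : ℝ) * (2 * e) = e := by ring
  rwa [e] at this

theorem young_kf {k F p δ : ℝ} (hk : 0 ≤ k) (hF : 0 ≤ F) (hδ : 0 < δ) (hp : δ < p) :
    k * F ^ δ ≤ k ^ (p / (p - δ)) + F ^ p := by
  have hp0 : 0 < p := hδ.trans hp
  have hpd : 0 < p - δ := by linarith
  have hc : (p / (p - δ)).HolderConjugate (p / δ) := by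
    rw [holderConjugate_iff]
    refine ⟨by rw [lt_div_iff₀ hpd]; linarith, ?_⟩
    field_simp; ring
  have h := young_inequality_of_nonneg hk (rpow_nonneg hF δ) hc
  rw [← rpow_mul hF, mul_div_cancel₀ _ hδ.ne'] at h
  have h1 : k ^ (p / (p - δ)) / (p / (p - δ)) ≤ k ^ (p / (p - δ)) :=
    div_le_self (rpow_nonneg hk _) (by rw [le_div_iff₀ hpd]; linarith)
  have h2 : F ^ p / (p / δ) ≤ F ^ p :=
    div_le_self (rpow_nonneg hF _) (by rw [le_div_iff₀ hδ]; linarith)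
  linarith

theorem kint_f {n : ℕ} (hn : 0 < n) {Ω : Set (Eu n)} (hO : IsOpen Ω) (hb : Bornology.IsBounded Ω)
    {s p δ E : ℝ} (hδ : 0 < δ) (hp : δ < p) (hs : s * (p / (p - δ)) < n) :
    ∃ A, 0 ≤ A ∧ ∀ F : Eu n → ℝ, BC Ω F → (∀ x ∈ Ω, 0 < F x) → ∫ x in Ω, F x ^ p ≤ E → ∀ x ∈ Ω,
      ∫ y in Ω, ‖x - y‖ ^ (-s) * F y ^ δ ≤ A := by
  obtain ⟨A, hA, hk⟩ := kernel_int hn hO hb hs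
  refine ⟨A + |E|, by positivity, fun F hF h0 hE x hx => ?_⟩
  obtain ⟨k1, k2⟩ := hk x hx
  have bp : BC Ω (fun x => F x ^ p) := hF.rpow (hδ.trans hp).le h0
  have ip := bp.int hO hb
  have h1 : ∫ y in Ω, ‖x - y‖ ^ (-s) * F y ^ δ ≤
      ∫ y in Ω, (‖x - y‖ ^ (-(s * (p / (p - δ)))) + F y ^ p) := by
    refine integral_mono_of_nonneg ?_ (k1.add ip) ?_
    · filter_upwards [ae_restrict_mem hO.measurableSet] with y hy
      exact mul_nonneg (by positivity) (rpow_nonneg (h0 y hy).le _)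
    · filter_upwards [ae_restrict_mem hO.measurableSet] with y hy
      have := young_kf (k := ‖x - y‖ ^ (-s)) (by positivity) (h0 y hy).le hδ hp
      rw [← rpow_mul (norm_nonneg _), neg_mul] at this
      exact this
  rw [integral_add k1 ip] at h1
  linarith [le_abs_self E]

theorem caseB {n : ℕ} (hn : 0 < n) {Ω : Set (Eu n)} (hΩ : GoodDomain Ω) {a : EReal} {f : ℝ → ℝ}
    (hf : HypH a f) {p τ2 C1 E : ℝ} (hp : 1 < p) (hτ0 : 0 < τ2) (hτ2 : τ2 < 2) (hC1 : 0 < C1)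
    (hf1 : ∀ t ∈ Jp a, deriv f t ≤ C1 * f t ^ τ2) (hnp : n * τ2 < 4 * p)
    (hE : ∀ lam u V, SolF Ω a f lam u V → ∫ x in Ω, f (u x) ^ p ≤ E) :
    ∃ C : ℝ, (C : EReal) < a ∧ ∀ lam u V, SolF Ω a f lam u V → ∀ x ∈ Ω, u x ≤ C := by
  have hn' : (0:ℝ) < n := by exact_mod_cast hn
  have hΩ' := hΩ
  obtain ⟨hO, hb, hne⟩ := hΩ
  obtain ⟨δ, hδ1, hδ2⟩ : ∃ δ, τ2 / 2 < δ ∧ δ < min (min 1 τ2) (2 * p / n) := by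
    apply exists_between
    refine lt_min (lt_min (by linarith) (by linarith)) ?_
    rw [lt_div_iff₀ hn']; linarith
  have hδa : δ < 1 := hδ2.trans_le ((min_le_left _ _).trans (min_le_left _ _))
  have hδb : δ < τ2 := hδ2.trans_le ((min_le_left _ _).trans (min_le_right _ _))
  have hδc : δ < 2 * p / n := hδ2.trans_le (min_le_right _ _)
  have hδ0 : 0 < δ := by linarith
  rw [lt_div_iff₀ hn'] at hδc
  have hp0 : 0 < p := by linarith
  obtain ⟨s, hs1, hs2⟩ : ∃ s, max 0 ((n:ℝ) - 2) < s ∧ s < n * (p - δ) / p := by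
    apply exists_between
    refine max_lt (div_pos (mul_pos hn' (by linarith)) hp0) ?_
    rw [lt_div_iff₀ hp0]; nlinarith
  have hs0 : 0 < s := (le_max_left _ _).trans_lt hs1
  have hsn2 : (n:ℝ) - 2 ≤ s := (le_max_right _ _).trans hs1.le
  rw [lt_div_iff₀ hp0] at hs2
  have hsn : s < n := by nlinarith
  have hpd : 0 < p - δ := by linarith
  obtain ⟨A, hA, hk⟩ := kint_f hn hO hb (s := s) (E := E) hδ0 (show δ < p by linarith)
    (by rw [← mul_div_assoc, div_lt_iff₀ hpd]; exact hs2)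
  obtain ⟨C, hC, hR⟩ := rep_app hn hΩ' hf hs0 hsn2 hsn
  obtain ⟨D1, hD1, hd1⟩ := lin_absorb (e := τ2 - δ) (δ := 1 / (4 * (2 * C * C1 * A + 1))) (by linarith) (by linarith) (by positivity)
  obtain ⟨D2, hD2, hd2⟩ := lin_absorb (e := 1 + τ2 - 2 * δ) (δ := 1 / (4 * (C * C1 * A * (C * A) + 1))) (by linarith) (by linarith) (by positivity)
  obtain ⟨B, hB, hBb⟩ := bound_of_f hf
    (M := 2 * (f 0 + 2 + 2 * C * C1 * A * D1 + C * C1 * A * (C * A) * D2))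
  refine ⟨B, hB, fun lam u V S => ?_⟩
  obtain ⟨x0, hx0, hmax⟩ := sol_bd hb hne S.hu.continuous S.u0 fun x hx => (S.uJ x hx).1
  have hJ0 := S.uJ x0 hx0
  obtain ⟨M, hM⟩ : ∃ M, M = f (u x0) := ⟨_, rfl⟩
  have hM0 : 0 < M := by rw [hM]; exact f_pos hf hJ0
  have hfM : ∀ x ∈ Ω, f (u x) ≤ M := fun x hx => by
    rw [hM]; exact (f_mono hf).monotoneOn (S.uJ x hx) hJ0 (hmax x hx)
  have hfp : ∀ x ∈ Ω, 0 < f (u x) := fun x hx => f_pos hf (S.uJ x hx)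
  have hkx := hk (fun x => f (u x)) (S.bcf hf) hfp (hE lam u V S)
  obtain ⟨_, _, hki⟩ := kernel_int hn hO hb hsn
  have bδ : BC Ω (fun x => f (u x) ^ δ) := (S.bcf hf).rpow hδ0.le hfp
  have ik : ∀ x ∈ Ω, IntegrableOn (fun y => ‖x - y‖ ^ (-s) * f (u y) ^ δ) Ω := by
    intro x hx
    obtain ⟨b1, N, b2⟩ := bδ
    exact kmul_int hO (hki x hx).1 b1 b2
  have gen : ∀ (g : Eu n → ℝ) (c : ℝ), 0 ≤ c → (∀ y ∈ Ω, 0 ≤ g y) → (∀ y ∈ Ω, g y ≤ c * f (u y) ^ δ) →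
      ∀ x ∈ Ω, ∫ y in Ω, ‖x - y‖ ^ (-s) * g y ≤ c * A := by
    intro g c hc hg0 hg x hx
    have h1 : ∫ y in Ω, ‖x - y‖ ^ (-s) * g y ≤ ∫ y in Ω, c * (‖x - y‖ ^ (-s) * f (u y) ^ δ) := by
      refine integral_mono_of_nonneg ?_ ((ik x hx).const_mul c) ?_
      · filter_upwards [ae_restrict_mem hO.measurableSet] with y hy
        exact mul_nonneg (by positivity) (hg0 y hy)
      · filter_upwards [ae_restrict_mem hO.measurableSet] with y hy
        have := mul_le_mul_of_nonneg_left (hg y hy) (show 0 ≤ ‖x - y‖ ^ (-s) by positivity)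
        linarith
    rw [integral_const_mul] at h1
    exact h1.trans (mul_le_mul_of_nonneg_left (hkx x hx) hc)
  have spl : ∀ y ∈ Ω, ∀ e, δ ≤ e → f (u y) ^ e ≤ M ^ (e - δ) * f (u y) ^ δ := by
    intro y hy e he
    have h1 : f (u y) ^ e = f (u y) ^ (e - δ) * f (u y) ^ δ := by
      rw [← rpow_add (hfp y hy)]; ring_nf
    rw [h1]
    exact mul_le_mul_of_nonneg_right (rpow_le_rpow (hfp y hy).le (hfM y hy) (by linarith))
      (rpow_nonneg (hfp y hy).le _)
  have vb : ∀ x ∈ Ω, V x ≤ 2 + C * (M ^ (1 - δ) * A) := by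
    intro x hx
    have h1 := (hR lam u V S x hx).2.1
    have h2 := gen (fun y => f (u y)) (M ^ (1 - δ)) (by positivity) (fun y hy => (hfp y hy).le)
      (fun y hy => by have := spl y hy 1 hδa.le; rwa [rpow_one] at this) x hx
    have h3 := mul_le_mul_of_nonneg_left h2 hC.le
    linarith
  obtain ⟨W, hW⟩ : ∃ W, W = 2 + C * (M ^ (1 - δ) * A) := ⟨_, rfl⟩
  rw [← hW] at vb
  have hW0 : 0 ≤ W := by rw [hW]; positivity
  have h1 := (hR lam u V S x0 hx0).2.2
  have h2 := gen (fun y => deriv f (u y) * V y) (C1 * M ^ (τ2 - δ) * W) (by positivity)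
    (fun y hy => mul_nonneg (f1_pos hf (S.uJ y hy)).le (S.Vp y hy).le)
    (fun y hy => by
      have a1 := hf1 _ (S.uJ y hy)
      have a2 := mul_le_mul_of_nonneg_left (spl y hy τ2 hδb.le) hC1.le
      have a3 := mul_le_mul (a1.trans a2) (vb y hy) (S.Vp y hy).le
        (mul_nonneg hC1.le (mul_nonneg (by positivity) (rpow_nonneg (hfp y hy).le _)))
      linarith) x0 hx0
  have h3 := mul_le_mul_of_nonneg_left h2 hC.le
  rw [← hM] at h1
  have e1 : C * (C1 * M ^ (τ2 - δ) * W * A) =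
      2 * C * C1 * A * M ^ (τ2 - δ) + C * C1 * A * (C * A) * M ^ (1 + τ2 - 2 * δ) := by
    have : M ^ (1 + τ2 - 2 * δ) = M ^ (τ2 - δ) * M ^ (1 - δ) := by
      rw [← rpow_add hM0]; ring_nf
    rw [this, hW]; ring
  have q : ∀ c : ℝ, 0 ≤ c → c * (1 / (4 * (c + 1)) * M) ≤ M / 4 := by
    intro c hc
    rw [← mul_assoc, mul_one_div, div_mul_eq_mul_div, div_le_div_iff₀ (by positivity) (by norm_num)]
    nlinarith
  have h4 := mul_le_mul_of_nonneg_left (hd1 M hM0.le) (show 0 ≤ 2 * C * C1 * A by positivity)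
  have h5 := mul_le_mul_of_nonneg_left (hd2 M hM0.le) (show 0 ≤ C * C1 * A * (C * A) by positivity)
  have h6 := q (2 * C * C1 * A) (by positivity)
  have h7 := q (C * C1 * A * (C * A)) (by positivity)
  have hMB : M ≤ 2 * (f 0 + 2 + 2 * C * C1 * A * D1 + C * C1 * A * (C * A) * D2) := by linarith
  intro x hx
  exact hBb _ (S.uJ x hx) ((hfM x hx).trans hMB)

theorem swap_int {n : ℕ} {Ω : Set (Eu n)} (hO : IsOpen Ω) (hb : Bornology.IsBounded Ω)
    {e K : ℝ} {g : Eu n → ℝ} (hK : 0 ≤ K)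
    (hk : ∀ x ∈ Ω, IntegrableOn (fun y => ‖x - y‖ ^ (-e)) Ω ∧ ∫ y in Ω, ‖x - y‖ ^ (-e) ≤ K)
    (hg : BC Ω g) (g0 : ∀ x ∈ Ω, 0 ≤ g x) :
    IntegrableOn (fun y => ∫ z in Ω, ‖y - z‖ ^ (-e) * g z) Ω ∧
      ∫ y in Ω, ∫ z in Ω, ‖y - z‖ ^ (-e) * g z ≤ K * ∫ z in Ω, g z := by
  have hgi := hg.int hO hb
  have hm : AEStronglyMeasurable (fun q : Eu n × Eu n => ‖q.1 - q.2‖ ^ (-e) * g q.2)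
      ((volume.restrict Ω).prod (volume.restrict Ω)) := by
    refine AEStronglyMeasurable.mul ?_ hgi.aestronglyMeasurable.comp_snd
    have : Measurable (fun q : Eu n × Eu n => ‖q.1 - q.2‖ ^ (-e)) := by fun_prop
    exact this.aestronglyMeasurable
  have hk' : ∀ z ∈ Ω, IntegrableOn (fun y => ‖y - z‖ ^ (-e)) Ω ∧ ∫ y in Ω, ‖y - z‖ ^ (-e) ≤ K := by
    intro z hz
    have := hk z hz
    simp only [norm_sub_rev z] at this
    exact this
  have hF : Integrable (fun q : Eu n × Eu n => ‖q.1 - q.2‖ ^ (-e) * g q.2)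
      ((volume.restrict Ω).prod (volume.restrict Ω)) := by
    rw [integrable_prod_iff' hm]
    constructor
    · filter_upwards [ae_restrict_mem hO.measurableSet] with z hz
      exact (hk' z hz).1.mul_const _
    · have h2 := hm.norm.prod_swap.integral_prod_right'
      refine Integrable.mono' (hgi.const_mul K) h2 ?_
      filter_upwards [ae_restrict_mem hO.measurableSet] with z hz
      have e1 : ∀ y : Eu n, ‖‖y - z‖ ^ (-e) * g z‖ = ‖y - z‖ ^ (-e) * g z := fun y =>
        norm_of_nonneg (mul_nonneg (by positivity) (g0 z hz))
      simp only [e1]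
      rw [integral_mul_const, norm_of_nonneg]
      · exact mul_le_mul_of_nonneg_right (hk' z hz).2 (g0 z hz)
      · exact mul_nonneg (integral_nonneg fun y => by positivity) (g0 z hz)
  refine ⟨hF.integral_prod_left, ?_⟩
  have hs := integral_integral_swap (f := fun y z => ‖y - z‖ ^ (-e) * g z) hF
  rw [hs, ← integral_const_mul]
  refine setIntegral_mono_on hF.integral_prod_right (hgi.const_mul K) hO.measurableSet ?_
  intro z hz
  rw [integral_mul_const]
  exact mul_le_mul_of_nonneg_right (hk' z hz).2 (g0 z hz)

theorem pt_young {r1 r2 F s A p : ℝ} (h1 : 0 ≤ r1) (h2 : 0 ≤ r2) (hF : 0 ≤ F)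
    (hA0 : 0 < A) (hA1 : A < 1) (hp : 1 < p) :
    r1 ^ (-s) * (r2 ^ (-s) * F) ≤ r1 ^ (-(s * A * (p / (p - 1)))) * r2 ^ (-(s * A * (p / (p - 1))))
      + (r1 ^ (-(2 * s * (1 - A) * p)) * F ^ p + r2 ^ (-(2 * s * (1 - A) * p)) * F ^ p) := by
  have hk : 0 ≤ r1 * r2 := by positivity
  have hks : 0 ≤ (r1 * r2) ^ (-s) := by positivity
  have y := young_kf (k := ((r1 * r2) ^ (-s)) ^ A) (F := ((r1 * r2) ^ (-s)) ^ (1 - A) * F) (δ := 1)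
    (p := p) (by positivity) (by positivity) one_pos hp
  have ek : ((r1 * r2) ^ (-s)) ^ A * ((r1 * r2) ^ (-s)) ^ (1 - A) = (r1 * r2) ^ (-s) := by
    rw [← rpow_add_of_nonneg hks hA0.le (by linarith), show A + (1 - A) = 1 by ring, rpow_one]
  rw [rpow_one, ← mul_assoc, ek, mul_rpow (by positivity) hF] at y
  simp only [← rpow_mul hk] at y
  rw [mul_rpow h1 h2, mul_rpow h1 h2, mul_rpow h1 h2] at y
  have e1 : -s * A * (p / (p - 1)) = -(s * A * (p / (p - 1))) := by ring
  rw [e1] at y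
  have q : ∀ r : ℝ, 0 ≤ r → r ^ (-(2 * s * (1 - A) * p)) = (r ^ (-s * (1 - A) * p)) ^ 2 := by
    intro r hr
    rw [← rpow_natCast, ← rpow_mul hr]; congr 1; push_cast; ring
  rw [q r1 h1, q r2 h2]
  have e2 : r1 ^ (-s * (1 - A) * p) * r2 ^ (-s * (1 - A) * p) ≤
      (r1 ^ (-s * (1 - A) * p)) ^ 2 + (r2 ^ (-s * (1 - A) * p)) ^ 2 := by
    nlinarith [sq_nonneg (r1 ^ (-s * (1 - A) * p) - r2 ^ (-s * (1 - A) * p)),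
      sq_nonneg (r1 ^ (-s * (1 - A) * p) + r2 ^ (-s * (1 - A) * p))]
  have e3 := mul_le_mul_of_nonneg_right e2 (rpow_nonneg hF p)
  linarith

theorem caseA {n : ℕ} (hn : 0 < n) {Ω : Set (Eu n)} (hΩ : GoodDomain Ω) {a : EReal} {f : ℝ → ℝ}
    (hf : HypH a f) {p E : ℝ} (hp : 1 < p) (ha : a = ⊤) (hnp : (n:ℝ) < 4 * p)
    (hE : ∀ lam u V, SolF Ω a f lam u V → ∫ x in Ω, f (u x) ^ p ≤ E) :
    ∃ C : ℝ, (C : EReal) < a ∧ ∀ lam u V, SolF Ω a f lam u V → ∀ x ∈ Ω, u x ≤ C := by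
  have hn' : (0:ℝ) < n := by exact_mod_cast hn
  have hΩ' := hΩ
  obtain ⟨hO, hb, hne⟩ := hΩ
  obtain ⟨s, hs1, hs2⟩ : ∃ s, max 0 ((n:ℝ) - 2) < s ∧ s < n * (2 * p - 1) / (2 * p) := by
    apply exists_between
    refine max_lt (div_pos (mul_pos hn' (by linarith)) (by linarith)) ?_
    rw [lt_div_iff₀ (by linarith)]; nlinarith
  have hs0 : 0 < s := (le_max_left _ _).trans_lt hs1
  have hsn2 : (n:ℝ) - 2 ≤ s := (le_max_right _ _).trans hs1.le
  rw [lt_div_iff₀ (by linarith)] at hs2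
  have hsn : s < n := by nlinarith
  have hsp : 0 < s * p := by nlinarith
  obtain ⟨A, hA1, hA2⟩ : ∃ A, max 0 (1 - n / (2 * (s * p))) < A ∧ A < min 1 (n * (p - 1) / (s * p)) := by
    apply exists_between
    refine max_lt (lt_min one_pos (div_pos (mul_pos hn' (by linarith)) hsp)) (lt_min ?_ ?_)
    · have : 0 < n / (2 * (s * p)) := by positivity
      linarith
    · have : (n:ℝ) / (2 * (s * p)) = n / 2 / (s * p) := by field_simp
      rw [this, sub_lt_iff_lt_add, ← add_div, lt_div_iff₀ hsp]; linarith
  have hA0 : 0 < A := (le_max_left _ _).trans_lt hA1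
  have hAe : 1 - n / (2 * (s * p)) < A := (le_max_right _ _).trans_lt hA1
  have hA1' : A < 1 := hA2.trans_le (min_le_left _ _)
  have hAa : A < n * (p - 1) / (s * p) := hA2.trans_le (min_le_right _ _)
  rw [lt_div_iff₀ hsp] at hAa
  rw [sub_lt_comm, lt_div_iff₀ (by linarith)] at hAe
  obtain ⟨a1, ha1⟩ : ∃ a1, a1 = s * A * (p / (p - 1)) := ⟨_, rfl⟩
  obtain ⟨e, he⟩ : ∃ e, e = 2 * s * (1 - A) * p := ⟨_, rfl⟩
  have ha1n : a1 < n := by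
    rw [ha1, ← mul_div_assoc, div_lt_iff₀ (by linarith)]; linarith
  have hen : e < n := by rw [he]; linarith
  obtain ⟨Ks, hKs, hks⟩ := kernel_int hn hO hb hsn
  obtain ⟨Ka, hKa, hka⟩ := kernel_int hn hO hb ha1n
  obtain ⟨Ke, hKe, hke⟩ := kernel_int hn hO hb hen
  obtain ⟨C, hC, hR⟩ := rep_app hn hΩ' hf hs0 hsn2 hsn
  refine ⟨2 + C * (2 * Ks + C * (Ka * Ka + Ke * |E| + Ke * |E|)), by rw [ha]; exact EReal.coe_lt_top _,
    fun lam u V S x hx => ?_⟩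
  have hfp : ∀ x ∈ Ω, 0 < f (u x) := fun x hx => f_pos hf (S.uJ x hx)
  have bf := S.bcf hf
  have bp : BC Ω (fun x => f (u x) ^ p) := bf.rpow (by linarith) hfp
  have ip := bp.int hO hb
  have hfp0 : ∀ x ∈ Ω, 0 ≤ f (u x) ^ p := fun x hx => rpow_nonneg (hfp x hx).le _
  have hEE : ∫ x in Ω, f (u x) ^ p ≤ |E| := (hE lam u V S).trans (le_abs_self _)
  obtain ⟨sw1, sw2⟩ := swap_int hO hb hKe hke bp hfp0
  have pt : ∀ y ∈ Ω, ‖x - y‖ ^ (-s) * V y ≤ 2 * ‖x - y‖ ^ (-s) + C * (‖x - y‖ ^ (-a1) * Ka +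
      ‖x - y‖ ^ (-e) * |E| + ∫ z in Ω, ‖y - z‖ ^ (-e) * f (u z) ^ p) := by
    intro y hy
    have hV := (hR lam u V S y hy).2.1
    have h0 : 0 ≤ ‖x - y‖ ^ (-s) := by positivity
    have i3 : IntegrableOn (fun z => ‖y - z‖ ^ (-e) * f (u z) ^ p) Ω := by
      obtain ⟨b1, M, b2⟩ := bp
      exact kmul_int hO (hke y hy).1 b1 b2
    have i1 := (hka y hy).1.const_mul (‖x - y‖ ^ (-a1))
    have i2 := ip.const_mul (‖x - y‖ ^ (-e))
    have h1 : ∫ z in Ω, ‖x - y‖ ^ (-s) * (‖y - z‖ ^ (-s) * f (u z)) ≤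
        ∫ z in Ω, (‖x - y‖ ^ (-a1) * ‖y - z‖ ^ (-a1) +
          (‖x - y‖ ^ (-e) * f (u z) ^ p + ‖y - z‖ ^ (-e) * f (u z) ^ p)) := by
      refine integral_mono_of_nonneg ?_ (i1.add (i2.add i3)) ?_
      · filter_upwards [ae_restrict_mem hO.measurableSet] with z hz
        exact mul_nonneg h0 (mul_nonneg (by positivity) (hfp z hz).le)
      · filter_upwards [ae_restrict_mem hO.measurableSet] with z hz
        rw [ha1, he]
        exact pt_young (norm_nonneg _) (norm_nonneg _) (hfp z hz).le hA0 hA1' hp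
    have h2 := integral_add i1 (i2.add i3)
    have h3 := integral_add i2 i3
    simp only [Pi.add_apply] at h2 h3
    rw [h2, h3, integral_const_mul, integral_const_mul, integral_const_mul] at h1
    have h4 := mul_le_mul_of_nonneg_left (hka y hy).2 (show 0 ≤ ‖x - y‖ ^ (-a1) by positivity)
    have h5 := mul_le_mul_of_nonneg_left hEE (show 0 ≤ ‖x - y‖ ^ (-e) by positivity)
    have h6 := mul_le_mul_of_nonneg_left hV h0
    have h7 : C * (‖x - y‖ ^ (-s) * ∫ z in Ω, ‖y - z‖ ^ (-s) * f (u z)) ≤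
        C * (‖x - y‖ ^ (-a1) * Ka +
      ‖x - y‖ ^ (-e) * |E| + ∫ z in Ω, ‖y - z‖ ^ (-e) * f (u z) ^ p) :=
      mul_le_mul_of_nonneg_left (by linarith) hC.le
    linarith
  have j1 := (hks x hx).1.const_mul 2
  have j2 := (hka x hx).1.mul_const Ka
  have j3 := (hke x hx).1.mul_const |E|
  have H : ∫ y in Ω, ‖x - y‖ ^ (-s) * V y ≤ ∫ y in Ω, (2 * ‖x - y‖ ^ (-s) + C * (‖x - y‖ ^ (-a1) * Ka +
      ‖x - y‖ ^ (-e) * |E| + ∫ z in Ω, ‖y - z‖ ^ (-e) * f (u z) ^ p)) := by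
    refine integral_mono_of_nonneg ?_ (j1.add (((j2.add j3).add sw1).const_mul C)) ?_
    · filter_upwards [ae_restrict_mem hO.measurableSet] with y hy
      exact mul_nonneg (by positivity) (S.Vp y hy).le
    · filter_upwards [ae_restrict_mem hO.measurableSet] with y hy using pt y hy
  have q1 := integral_add j1 (((j2.add j3).add sw1).const_mul C)
  have q2 := integral_add (j2.add j3) sw1
  have q3 := integral_add j2 j3
  simp only [Pi.add_apply] at q1 q2 q3
  rw [q1, integral_const_mul, integral_const_mul, q2, q3, integral_mul_const, integral_mul_const] at H
  have t1 := (hks x hx).2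
  have t2 := mul_le_mul_of_nonneg_right (hka x hx).2 hKa
  have t3 := mul_le_mul_of_nonneg_right (hke x hx).2 (abs_nonneg E)
  have t4 := sw2.trans (mul_le_mul_of_nonneg_left hEE hKe)
  have hU := (hR lam u V S x hx).1
  have t5 : C * ((∫ y in Ω, ‖x - y‖ ^ (-a1)) * Ka + (∫ y in Ω, ‖x - y‖ ^ (-e)) * |E| +
      ∫ y in Ω, ∫ z in Ω, ‖y - z‖ ^ (-e) * f (u z) ^ p) ≤ C * (Ka * Ka + Ke * |E| + Ke * |E|) :=
    mul_le_mul_of_nonneg_left (by linarith) hC.le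
  have t6 : C * ∫ y in Ω, ‖x - y‖ ^ (-s) * V y ≤
      C * (2 * Ks + C * (Ka * Ka + Ke * |E| + Ke * |E|)) :=
    mul_le_mul_of_nonneg_left (by linarith) hC.le
  linarith

/-- **Theorem 1.1.** If `f` satisfies (H) with `0 < τ₋ ≤ τ₊ < 2` and `(u_m)` is a sequence of
semistable solutions of `(N_{λ_m})` satisfying the stability inequality, then
`sup_m ‖u_m‖_{L^∞(Ω)} < a_f` whenever `n < N(f)`, where `α*` is the largest root of
`P_f(α, τ₋, τ₊)`. -/
theorem statement0 {n : ℕ} (Ω : Set (EuclideanSpace ℝ (Fin n))) (hΩ : GoodDomain Ω)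
    (a : EReal) (f : ℝ → ℝ) (hf : HypH a f)
    (hτm : 0 < tauMinus a f) (hττ : tauMinus a f ≤ tauPlus a f) (hτp : tauPlus a f < 2)
    (lam : ℕ → ℝ) (hlam : ∀ m, 0 < lam m)
    (u : ℕ → EuclideanSpace ℝ (Fin n) → ℝ)
    (hsol : ∀ m, Solves Ω a (lam m) f (u m))
    (hsemi : ∀ m, Semistable Ω (lam m) f (u m))
    (hstab : ∀ m, StabIneq Ω (lam m) f (u m))
    (αstar : ℝ) (hroot : Pf (tauMinus a f) (tauPlus a f) αstar = 0)
    (hmax : ∀ β : ℝ, Pf (tauMinus a f) (tauPlus a f) β = 0 → β ≤ αstar)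
    (hn : (n : ℝ) < (4 * αstar * (2 - tauPlus a f) + 2 * tauPlus a f) / tauPlus a f *
      (if a = ⊤ then max 1 (tauPlus a f) else 1)) :
    ∃ C : ℝ, (C : EReal) < a ∧ ∀ m, ∀ x ∈ Ω, u m x ≤ C := by
  rcases Nat.eq_zero_or_pos n with h0 | hpos
  · exfalso
    subst h0
    obtain ⟨x, hx⟩ := hΩ.2.2
    have h1 := (hsol 0).2.2.1 x hx
    have h2 := hf.pos _ ((hsol 0).2.1 x hx)
    have h3 : lap (lap (u 0)) x = 0 := by simp [lap]
    rw [h3] at h1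
    have := mul_pos (hlam 0) h2
    linarith
  have hτp0 : 0 < tauPlus a f := hτm.trans_le hττ
  obtain ⟨α, τ1, τ2, s, hα, hτ1, hτ1m, hτ2p, hτ2, hs0, hs1, hKL, hcase⟩ :=
    params hτm hττ hτp hroot hmax hn
  obtain ⟨t0, ht0, ht⟩ := tau_bounds hf hτm hτp0 hτ1m hτ2p
  have hτ20 : 0 < τ2 := hτp0.trans hτ2p
  obtain ⟨E, hE⟩ := energy hpos hΩ hf ht0 hα hτ20 hτ2 hs0 hs1 ht hKL
  obtain ⟨C1, hC1, hf1⟩ := f1_le hf ht0 hτ20 fun t h h' => (ht t h h').2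
  have hp : 1 < α * (2 - τ2) + τ2 / 2 := by nlinarith
  have key : ∃ C : ℝ, (C : EReal) < a ∧
      ∀ lam u V, SolF Ω a f lam u V → ∀ x ∈ Ω, u x ≤ C := by
    rcases hcase with h | ⟨hT, h⟩
    · exact caseB hpos hΩ hf hp hτ20 hτ2 hC1 hf1 h hE
    · exact caseA hpos hΩ hf hp hT h hE
  obtain ⟨C, hC, hb⟩ := key
  refine ⟨C, hC, fun m x hx => ?_⟩
  obtain ⟨V, S⟩ := solF_of hΩ hf (hlam m) (hsol m) (hstab m)
  exact hb _ _ _ S x hx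

end
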